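/- There exists a constant C > 0 such that for every integral binary cubic form f with |Disc(f)| ≥ C, the equation f(x,y) = 1 has at most 7 solutions in integers (x,y). -/

import Mathlib

/-- The discriminant of the integral binary cubic form `ax³ + bx²y + cxy² + dy³`. -/
def cubicDisc (a b c d : ℤ) : ℤ :=
  18 * a * b * c * d + b ^ 2 * c ^ 2 - 4 * a * c ^ 3 - 4 * b ^ 3 * d - 27 * a ^ 2 * d ^ 2

theorem iteratedDeriv_succ_eq_of_eq_add_sub_mul {f g : ℂ → ℂ} {a c : ℂ} (hg : ContDiff ℂ ⊤ g)
    (h : ∀ z, f z = c + (z - a) * g z) (i : ℕ) (z : ℂ) :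
    iteratedDeriv (i + 1) f z =
      (z - a) * iteratedDeriv (i + 1) g z + (i + 1) * iteratedDeriv i g z := by
  have hd : ∀ j w, HasDerivAt (iteratedDeriv j g) (iteratedDeriv (j + 1) g w) w := by
    intro j w
    rw [iteratedDeriv_succ]
    exact ((hg.differentiable_iteratedDeriv j (WithTop.coe_lt_top _)) w).hasDerivAt
  induction i generalizing z with
  | zero =>
    have hf : f = fun z => c + (z - a) * g z := funext h
    have h0 : HasDerivAt (fun z => c + (z - a) * g z)
        (1 * iteratedDeriv 0 g z + (z - a) * iteratedDeriv 1 g z) z :=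
      (((hasDerivAt_id' z).sub_const a).mul (hd 0 z)).const_add c
    rw [iteratedDeriv_one, hf, h0.deriv]
    push_cast
    ring
  | succ i ih =>
    rw [iteratedDeriv_succ, funext ih]
    have h1 : HasDerivAt
        (fun z => (z - a) * iteratedDeriv (i + 1) g z + ((i : ℂ) + 1) * iteratedDeriv i g z)
        (1 * iteratedDeriv (i + 1) g z + (z - a) * iteratedDeriv (i + 1 + 1) g z +
          ((i : ℂ) + 1) * iteratedDeriv (i + 1) g z) z :=
      (((hasDerivAt_id' z).sub_const a).mul (hd (i + 1) z)).add ((hd i z).const_mul ((i : ℂ) + 1))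
    rw [h1.deriv]
    push_cast
    ring

theorem norm_iteratedDeriv_le_of_eq_add_sub_mul {f g : ℂ → ℂ} {a b : ℂ} (hg : ContDiff ℂ ⊤ g)
    (h : ∀ z, f z = f a + (z - a) * g z) (hab : 1 ≤ ‖b - a‖) {η : ℝ} (ha : ‖f a‖ ≤ η) {m : ℕ}
    (hb : ∀ i < m, ‖iteratedDeriv i f b‖ ≤ η) (i : ℕ) (hi : i < m) :
    ‖iteratedDeriv i g b‖ ≤ 2 * (i + 1).factorial * η := by
  have hη : 0 ≤ η := (norm_nonneg _).trans ha
  induction i with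
  | zero =>
    have h0 := hb 0 hi
    simp only [iteratedDeriv_zero] at h0 ⊢
    have h1 : ‖b - a‖ * ‖g b‖ ≤ 2 * η := by
      rw [← norm_mul]
      have : (b - a) * g b = f b - f a := by rw [h b]; ring
      rw [this]
      linarith [norm_sub_le (f b) (f a)]
    simp
    nlinarith [norm_nonneg (g b)]
  | succ i ih =>
    have h0 := ih (by omega)
    have h1 := hb (i + 1) hi
    have h2 : (b - a) * iteratedDeriv (i + 1) g b =
        iteratedDeriv (i + 1) f b - (i + 1) * iteratedDeriv i g b := by
      rw [iteratedDeriv_succ_eq_of_eq_add_sub_mul hg h]; ring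
    have h3 : ‖b - a‖ * ‖iteratedDeriv (i + 1) g b‖ ≤
        η + (i + 1) * (2 * (i + 1).factorial * η) := by
      rw [← norm_mul, h2]
      refine (norm_sub_le _ _).trans (add_le_add h1 ?_)
      rw [norm_mul]
      have : ‖((i : ℂ) + 1)‖ = i + 1 := by
        rw [← Nat.cast_succ, Complex.norm_natCast]; simp
      rw [this]
      gcongr
    have h4 : ((i + 1 + 1).factorial : ℝ) = (i + 2) * (i + 1).factorial := by
      rw [Nat.factorial_succ]; push_cast; ring
    have h5 : (1 : ℝ) ≤ (i + 1).factorial := by exact_mod_cast Nat.factorial_pos _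
    rw [h4]
    have h6 : ‖iteratedDeriv (i + 1) g b‖ ≤ ‖b - a‖ * ‖iteratedDeriv (i + 1) g b‖ :=
      le_mul_of_one_le_left (norm_nonneg _) hab
    nlinarith [mul_nonneg hη (sub_nonneg.2 h5)]

/-- Schwarz lemma with approximate zeros at integers. -/
theorem norm_le_of_approx_zeros {S M : ℕ} {ρ : ℝ} (hρ : 1 ≤ ρ) (hS : (S : ℝ) ≤ ρ) (n : ℕ)
    (m : ℕ → ℕ) (hmM : ∀ s, m s ≤ M) (hn : ∑ s ∈ Finset.range S, m s = n) {f : ℂ → ℂ}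
    (hf : Differentiable ℂ f) {η B : ℝ} (hη : 0 ≤ η)
    (hz : ∀ s < S, ∀ i < m s, ‖iteratedDeriv i f s‖ ≤ η)
    (hB : ∀ z, ‖z‖ = 5 * ρ → ‖f z‖ ≤ B) {x : ℂ} (hx : ‖x‖ ≤ ρ) :
    ‖f x‖ ≤ B / 2 ^ n + (4 * ρ * (2 * M.factorial)) ^ n * η := by
  induction n generalizing m f η B with
  | zero =>
    have h1 : ‖f x‖ ≤ B := by
      refine Complex.norm_le_of_forall_mem_frontier_norm_le (U := Metric.ball 0 (5 * ρ))
        Metric.isBounded_ball hf.diffContOnCl ?_ (subset_closure ?_)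
      · intro z hz
        rw [frontier_ball _ (by positivity)] at hz
        exact hB z (by simpa using hz)
      · simp only [Metric.mem_ball, dist_zero_right]; linarith
    simp; linarith
  | succ n ih =>
    have hex : ∃ a ∈ Finset.range S, m a ≠ 0 := by
      by_contra! hc
      rw [Finset.sum_eq_zero hc] at hn
      omega
    obtain ⟨a, haS, ha0⟩ := hex
    have haS' : a < S := Finset.mem_range.1 haS
    set g := dslope f (a : ℂ) with hg
    have hgd : Differentiable ℂ g := by
      rw [← differentiableOn_univ] at hf ⊢
      exact (Complex.differentiableOn_dslope Filter.univ_mem).2 hf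
    have hgc : ContDiff ℂ ⊤ g := hgd.contDiff
    have hfg : ∀ z, f z = f a + (z - a) * g z := by
      intro z
      have := sub_smul_dslope f (a : ℂ) z
      rw [smul_eq_mul] at this
      rw [this]; ring
    have hfa : ‖f a‖ ≤ η := by simpa using hz a haS' 0 (Nat.pos_of_ne_zero ha0)
    have haρ : ‖(a : ℂ)‖ ≤ ρ := by
      rw [Complex.norm_natCast]
      exact le_trans (by exact_mod_cast haS'.le) hS
    set C : ℝ := 2 * M.factorial with hC
    have hM1 : (1 : ℝ) ≤ M.factorial := by exact_mod_cast Nat.factorial_pos _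
    have hC1 : 2 ≤ C := by linarith
    set m' : ℕ → ℕ := Function.update m a (m a - 1) with hm'
    have key := ih m' (f := g) (η := C * η) (B := (B + η) / (4 * ρ)) ?_ ?_ hgd (by positivity)
      ?_ ?_
    · have e1 : ‖f x‖ ≤ η + 2 * ρ * ‖g x‖ := by
        rw [hfg x]
        refine (norm_add_le _ _).trans (add_le_add hfa ?_)
        rw [norm_mul]
        gcongr
        linarith [norm_sub_le x (a : ℂ)]
      have e2 : 2 * ρ * ‖g x‖ ≤
          2 * ρ * ((B + η) / (4 * ρ) / 2 ^ n + (4 * ρ * C) ^ n * (C * η)) := by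
        gcongr
      have e3 : 2 * ρ * ((B + η) / (4 * ρ) / 2 ^ n + (4 * ρ * C) ^ n * (C * η)) =
          B / 2 ^ (n + 1) + η / 2 ^ (n + 1) + (4 * ρ * C) ^ (n + 1) * η / 2 := by
        field_simp
        ring
      have e4 : η / 2 ^ (n + 1) ≤ η := div_le_self hη (one_le_pow₀ (by norm_num))
      have e5 : (4 : ℝ) ≤ (4 * ρ * C) ^ (n + 1) := by
        have : (4 : ℝ) ≤ 4 * ρ * C := by nlinarith
        exact this.trans (le_self_pow₀ (by linarith) (by omega))
      nlinarith
    · intro s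
      by_cases h : s = a
      · subst h; simp [hm']; have := hmM s; omega
      · simp [hm', h, hmM]
    · have := Finset.sum_update_of_mem haS m (m a - 1)
      rw [hm', this]
      have h2 := Finset.add_sum_erase _ m haS
      rw [Finset.sdiff_singleton_eq_erase]
      omega
    · intro s hs i hi
      by_cases h : s = a
      · subst h
        simp only [hm', Function.update_self] at hi
        have h1 := hz s hs (i + 1) (by omega)
        rw [iteratedDeriv_succ_eq_of_eq_add_sub_mul hgc hfg] at h1
        simp only [sub_self, zero_mul, zero_add, norm_mul] at h1
        have : ‖((i : ℂ) + 1)‖ = i + 1 := by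
          rw [← Nat.cast_succ, Complex.norm_natCast]; simp
        rw [this] at h1
        have h2 : (0:ℝ) ≤ i := Nat.cast_nonneg _
        nlinarith [norm_nonneg (iteratedDeriv i g s)]
      · simp only [hm', Function.update_of_ne h] at hi
        refine (norm_iteratedDeriv_le_of_eq_add_sub_mul hgc hfg ?_ hfa (hz s hs) i hi).trans ?_
        · have h1 : ((s : ℂ) - a) = ((s - a : ℤ) : ℂ) := by push_cast; ring
          rw [h1, Complex.norm_intCast]
          have : (1 : ℤ) ≤ |(s : ℤ) - a| := Int.one_le_abs (by omega)
          exact_mod_cast this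
        · rw [hC]
          gcongr
          exact_mod_cast (show i + 1 ≤ M from lt_of_lt_of_le hi (hmM s))
    · intro z hz
      have h1 : 4 * ρ ≤ ‖z - a‖ := by linarith [norm_sub_norm_le z (a : ℂ)]
      rw [le_div_iff₀ (by positivity)]
      calc ‖g z‖ * (4 * ρ) ≤ ‖g z‖ * ‖z - a‖ := by gcongr
        _ = ‖f z - f a‖ := by rw [← norm_mul, hfg z]; congr 1; ring
        _ ≤ B + η := (norm_sub_le _ _).trans (add_le_add (hB z hz) hfa)

/-- Siegel-type pigeonhole: a nonzero integer vector making many complex linear forms small. -/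
theorem exists_int_vec_norm_sum_lt_one {ι R : Type*} [Fintype ι] [Fintype R]
    (v : R → ι → ℂ) {V : ℝ} (hV : ∀ r i, ‖v r i‖ ≤ V) (P Q : ℕ)
    (hQ : 2 * P * Fintype.card ι * V + 1 ≤ Q)
    (hcard : (2 * Q + 1) ^ (2 * Fintype.card R) < (P + 1) ^ Fintype.card ι) :
    ∃ p : ι → ℤ, p ≠ 0 ∧ (∀ i, |p i| ≤ P) ∧ ∀ r, ‖∑ i, (p i : ℂ) * v r i‖ < 1 := by
  classical
  let Ψ : (ι → Fin (P + 1)) → R → ℂ := fun x r => ∑ i, ((x i : ℕ) : ℂ) * v r i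
  have hΨ : ∀ x r, ‖Ψ x r‖ ≤ P * Fintype.card ι * V := by
    intro x r
    refine (norm_sum_le _ _).trans ?_
    have : ∀ i ∈ Finset.univ, ‖((x i : ℕ) : ℂ) * v r i‖ ≤ P * V := by
      intro i _
      rw [norm_mul, Complex.norm_natCast]
      have h1 : ((x i : ℕ) : ℝ) ≤ P := by exact_mod_cast Nat.lt_succ_iff.1 (x i).2
      exact mul_le_mul h1 (hV r i) (norm_nonneg _) (Nat.cast_nonneg _)
    refine (Finset.sum_le_card_nsmul _ _ _ this).trans ?_
    rw [nsmul_eq_mul, Finset.card_univ]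
    apply le_of_eq; ring
  let box : Finset (ℤ × ℤ) := Finset.Icc (-(Q : ℤ)) Q ×ˢ Finset.Icc (-(Q : ℤ)) Q
  let Φ : (ι → Fin (P + 1)) → R → ℤ × ℤ := fun x r => (⌊2 * (Ψ x r).re⌋, ⌊2 * (Ψ x r).im⌋)
  have hfl : ∀ t : ℝ, |t| ≤ P * Fintype.card ι * V → ⌊2 * t⌋ ∈ Finset.Icc (-(Q : ℤ)) Q := by
    intro t ht
    have h1 := abs_le.1 ht
    rw [Finset.mem_Icc]
    constructor
    · rw [Int.le_floor]; push_cast; linarith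
    · have : (⌊2 * t⌋ : ℝ) ≤ Q := (Int.floor_le _).trans (by linarith)
      exact_mod_cast this
  have hmaps : ∀ x ∈ (Finset.univ : Finset (ι → Fin (P + 1))),
      Φ x ∈ Fintype.piFinset fun _ : R => box := by
    intro x _
    rw [Fintype.mem_piFinset]
    intro r
    exact Finset.mem_product.2 ⟨hfl _ ((Complex.abs_re_le_norm _).trans (hΨ x r)),
      hfl _ ((Complex.abs_im_le_norm _).trans (hΨ x r))⟩
  have hc : (Fintype.piFinset fun _ : R => box).card <
      (Finset.univ : Finset (ι → Fin (P + 1))).card := by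
    rw [Fintype.card_piFinset, Finset.prod_const, Finset.card_univ, Finset.card_univ,
      Fintype.card_fun, Fintype.card_fin]
    have : box.card = (2 * Q + 1) ^ 2 := by
      simp only [box, Finset.card_product, Int.card_Icc]
      rw [sq]
      congr 1 <;> omega
    rw [this, ← pow_mul]
    exact hcard
  obtain ⟨x, _, y, _, hxy, he⟩ := Finset.exists_ne_map_eq_of_card_lt_of_maps_to hc hmaps
  refine ⟨fun i => ((x i : ℕ) : ℤ) - ((y i : ℕ) : ℤ), ?_, ?_, ?_⟩
  · intro h0
    apply hxy
    funext i
    have := congrFun h0 i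
    simp only [Pi.zero_apply] at this
    ext; omega
  · intro i
    have h1 := (x i).2
    have h2 := (y i).2
    change |((x i : ℕ) : ℤ) - ((y i : ℕ) : ℤ)| ≤ P
    rw [abs_le]; constructor <;> omega
  · intro r
    have e1 : ∑ i, (((((x i : ℕ) : ℤ) - ((y i : ℕ) : ℤ) : ℤ)) : ℂ) * v r i = Ψ x r - Ψ y r := by
      simp only [Ψ, ← Finset.sum_sub_distrib]
      refine Finset.sum_congr rfl fun i _ => ?_
      push_cast; ring
    rw [e1]
    have h2 := congrFun he r
    simp only [Φ, Prod.mk.injEq] at h2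
    have h3 := Int.abs_sub_lt_one_of_floor_eq_floor h2.1
    have h4 := Int.abs_sub_lt_one_of_floor_eq_floor h2.2
    refine (Complex.norm_le_abs_re_add_abs_im _).trans_lt ?_
    simp only [Complex.sub_re, Complex.sub_im]
    rw [← mul_sub, abs_mul, abs_two] at h3 h4
    linarith

/-- Liouville's inequality in the form of a vanishing criterion. -/
theorem eq_zero_of_isIntegral_of_norm_lt {L : Type*} [Field L] [NumberField L] {n : ℕ}
    (hn : Module.finrank ℚ L ≤ n + 1) (φ₀ : L →+* ℂ) {x : L} (hx : IsIntegral ℤ x) {ε V : ℝ}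
    (hV : 1 ≤ V) (hε : ‖φ₀ x‖ ≤ ε) (hall : ∀ φ : L →+* ℂ, ‖φ x‖ ≤ V) (hlt : ε * V ^ n < 1) :
    x = 0 := by
  classical
  have h1 : ∀ φ : L →ₐ[ℚ] ℂ, ‖φ x‖ ≤ V := fun φ => hall φ.toRingHom
  let ψ₀ : L →ₐ[ℚ] ℂ := φ₀.toRatAlgHom
  have hprod : ‖∏ φ : L →ₐ[ℚ] ℂ, φ x‖ < 1 := by
    rw [norm_prod, ← Finset.mul_prod_erase _ _ (Finset.mem_univ ψ₀)]
    refine lt_of_le_of_lt ?_ hlt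
    have hε0 : 0 ≤ ε := (norm_nonneg _).trans hε
    refine mul_le_mul hε ?_ (Finset.prod_nonneg fun _ _ => norm_nonneg _) hε0
    refine (Finset.prod_le_prod (fun _ _ => norm_nonneg _) fun φ _ => h1 φ).trans ?_
    rw [Finset.prod_const]
    refine pow_le_pow_right₀ hV ?_
    rw [Finset.card_erase_of_mem (Finset.mem_univ _), Finset.card_univ, AlgHom.card]
    omega
  rw [← Algebra.norm_eq_prod_embeddings ℚ ℂ x] at hprod
  have h2 : IsIntegral ℤ (Algebra.norm ℚ x) := Algebra.isIntegral_norm ℚ hx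
  obtain ⟨m, hm⟩ := IsIntegrallyClosed.isIntegral_iff.1 h2
  rw [← hm] at hprod
  simp only [algebraMap_int_eq, eq_intCast, map_intCast, Complex.norm_intCast] at hprod
  have hm0 : m = 0 := by
    have : |m| < 1 := by exact_mod_cast hprod
    exact Int.abs_lt_one_iff.1 this
  rw [hm0, map_zero] at hm
  exact Algebra.norm_eq_zero_iff.1 hm.symm

/-- Vanishing of many mixed power moments forces the weights to vanish. -/
theorem eq_zero_of_sum_pow_mul_pow_mul_pow_eq_zero {ι L : Type*} [Fintype ι] [Field L]
    [CharZero L] (p : ι → ℤ) (B : ι → L) (c c' : ι → ℤ) {n₁ n₂ : ℕ}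
    (h : ∀ m₁ < n₁, ∀ m₂ < n₁, ∀ s < n₂,
      ∑ i, (p i : L) * (c i : L) ^ m₁ * (c' i : L) ^ m₂ * B i ^ s = 0)
    (hcard : Fintype.card ι ≤ n₂)
    (hcl : ∀ i, ∃ t : Finset ι, t.card ≤ n₁ ∧ ∀ j, B j = B i → j ∈ t)
    (hinj : ∀ i j, B i = B j → c i = c j → c' i = c' j → i = j) : p = 0 := by
  classical
  by_contra hp
  obtain ⟨k, hk⟩ := Function.ne_iff.1 hp
  have hpoly : ∀ r₁ r₂ q : Polynomial L, r₁.natDegree < n₁ → r₂.natDegree < n₁ →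
      q.natDegree < n₂ →
      ∑ i, (p i : L) * r₁.eval (c i : L) * r₂.eval (c' i : L) * q.eval (B i) = 0 := by
    intro r₁ r₂ q h1 h2 h3
    simp only [Polynomial.eval_eq_sum_range' h1, Polynomial.eval_eq_sum_range' h2,
      Polynomial.eval_eq_sum_range' h3]
    have : ∀ i, (p i : L) * (∑ m ∈ Finset.range n₁, r₁.coeff m * (c i : L) ^ m) *
        (∑ m ∈ Finset.range n₁, r₂.coeff m * (c' i : L) ^ m) *
        (∑ s ∈ Finset.range n₂, q.coeff s * B i ^ s) =
        ∑ m₁ ∈ Finset.range n₁, ∑ m₂ ∈ Finset.range n₁, ∑ s ∈ Finset.range n₂,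
          r₁.coeff m₁ * r₂.coeff m₂ * q.coeff s *
            ((p i : L) * (c i : L) ^ m₁ * (c' i : L) ^ m₂ * B i ^ s) := by
      intro i
      rw [mul_assoc, mul_assoc, Finset.sum_mul_sum, Finset.sum_mul_sum, Finset.mul_sum]
      refine Finset.sum_congr rfl fun m₁ _ => ?_
      rw [Finset.mul_sum]
      simp only [Finset.mul_sum]
      refine Finset.sum_congr rfl fun m₂ _ => ?_
      refine Finset.sum_congr rfl fun s _ => ?_
      ring
    simp only [this]
    rw [Finset.sum_comm]
    refine Finset.sum_eq_zero fun m₁ hm₁ => ?_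
    rw [Finset.sum_comm]
    refine Finset.sum_eq_zero fun m₂ hm₂ => ?_
    rw [Finset.sum_comm]
    refine Finset.sum_eq_zero fun s hs => ?_
    rw [← Finset.mul_sum, h m₁ (Finset.mem_range.1 hm₁) m₂ (Finset.mem_range.1 hm₂) s
      (Finset.mem_range.1 hs), mul_zero]
  have hann : ∀ (t : Finset L) (a : L) (n : ℕ), a ∈ t → t.card ≤ n →
      ∃ r : Polynomial L, r.natDegree < n ∧ r.eval a ≠ 0 ∧ ∀ b ∈ t, b ≠ a → r.eval b = 0 := by
    intro t a n ha hn
    refine ⟨∏ b ∈ t.erase a, (Polynomial.X - Polynomial.C b), ?_, ?_, ?_⟩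
    · rw [Polynomial.natDegree_finsetProd_X_sub_C_eq_card, Finset.card_erase_of_mem ha]
      have : 0 < t.card := Finset.card_pos.2 ⟨a, ha⟩
      omega
    · rw [Polynomial.eval_prod, Finset.prod_ne_zero_iff]
      intro b hb
      simp only [Polynomial.eval_sub, Polynomial.eval_X, Polynomial.eval_C]
      exact sub_ne_zero.2 (Finset.ne_of_mem_erase hb).symm
    · intro b hb hba
      rw [Polynomial.eval_prod]
      exact Finset.prod_eq_zero (Finset.mem_erase.2 ⟨hba, hb⟩) (by simp)
  obtain ⟨t, ht, htm⟩ := hcl k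
  obtain ⟨q, q1, q2, q3⟩ := hann (Finset.univ.image B) (B k) n₂ (by simp)
    (Finset.card_image_le.trans (by simpa using hcard))
  obtain ⟨r₁, a1, a2, a3⟩ := hann (t.image fun i => (c i : L)) (c k : L) n₁
    (Finset.mem_image_of_mem _ (htm k rfl)) (Finset.card_image_le.trans ht)
  obtain ⟨r₂, b1, b2, b3⟩ := hann (t.image fun i => (c' i : L)) (c' k : L) n₁
    (Finset.mem_image_of_mem _ (htm k rfl)) (Finset.card_image_le.trans ht)
  have hs := hpoly r₁ r₂ q a1 b1 q1
  rw [Finset.sum_eq_single k] at hs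
  · have : (p k : L) ≠ 0 := by exact_mod_cast hk
    simp_all
  · intro i _ hik
    by_cases hB : B i = B k
    · have hit := htm i hB
      by_cases hc : c i = c k
      · have hc' : c' i ≠ c' k := fun h' => hik (hinj i k hB hc h')
        rw [b3 _ (Finset.mem_image_of_mem _ hit) (by exact_mod_cast hc')]; ring
      · rw [a3 _ (Finset.mem_image_of_mem _ hit) (by exact_mod_cast hc)]; ring
    · rw [q3 _ (Finset.mem_image_of_mem _ (Finset.mem_univ _)) hB]; ring
  · simp

/-- Exponential polynomials with two frequencies. -/
noncomputable def expSum {ι : Type*} [Fintype ι] (p c c' : ι → ℤ) (l₁ l₂ : ℝ) (m₁ m₂ : ℕ)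
    (z : ℂ) : ℂ :=
  ∑ i, (p i : ℂ) * (c i : ℂ) ^ m₁ * (c' i : ℂ) ^ m₂ *
    Complex.exp (((c i * l₁ + c' i * l₂ : ℝ) : ℂ) * z)

theorem hasDerivAt_expSum {ι : Type*} [Fintype ι] (p c c' : ι → ℤ) (l₁ l₂ : ℝ) (m₁ m₂ : ℕ)
    (z : ℂ) :
    HasDerivAt (expSum p c c' l₁ l₂ m₁ m₂)
      (l₁ * expSum p c c' l₁ l₂ (m₁ + 1) m₂ z + l₂ * expSum p c c' l₁ l₂ m₁ (m₂ + 1) z) z := by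
  have h : ∀ i ∈ (Finset.univ : Finset ι), HasDerivAt
      (fun z => (p i : ℂ) * (c i : ℂ) ^ m₁ * (c' i : ℂ) ^ m₂ *
        Complex.exp (((c i * l₁ + c' i * l₂ : ℝ) : ℂ) * z))
      ((p i : ℂ) * (c i : ℂ) ^ m₁ * (c' i : ℂ) ^ m₂ *
        (Complex.exp (((c i * l₁ + c' i * l₂ : ℝ) : ℂ) * z) *
          (((c i * l₁ + c' i * l₂ : ℝ) : ℂ) * 1))) z := fun i _ =>
    (((hasDerivAt_id' z).const_mul _).cexp).const_mul _
  have h2 := HasDerivAt.fun_sum h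
  have e : expSum p c c' l₁ l₂ m₁ m₂ = fun z => ∑ i, (p i : ℂ) * (c i : ℂ) ^ m₁ *
    (c' i : ℂ) ^ m₂ * Complex.exp (((c i * l₁ + c' i * l₂ : ℝ) : ℂ) * z) := rfl
  rw [e]
  refine h2.congr_deriv ?_
  simp only [expSum, Finset.mul_sum, ← Finset.sum_add_distrib]
  refine Finset.sum_congr rfl fun i _ => ?_
  push_cast
  ring

theorem differentiable_expSum {ι : Type*} [Fintype ι] (p c c' : ι → ℤ) (l₁ l₂ : ℝ)
    (m₁ m₂ : ℕ) : Differentiable ℂ (expSum p c c' l₁ l₂ m₁ m₂) :=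
  fun z => (hasDerivAt_expSum p c c' l₁ l₂ m₁ m₂ z).differentiableAt

theorem norm_iteratedDeriv_expSum_le {ι : Type*} [Fintype ι] (p c c' : ι → ℤ) {l₁ l₂ X : ℝ}
    (h₁ : |l₁| ≤ X) (h₂ : |l₂| ≤ X) {η : ℝ} (z : ℂ) (i : ℕ) (m₁ m₂ : ℕ)
    (h : ∀ u v, u + v = i → ‖expSum p c c' l₁ l₂ (m₁ + u) (m₂ + v) z‖ ≤ η) :
    ‖iteratedDeriv i (expSum p c c' l₁ l₂ m₁ m₂) z‖ ≤ (2 * X) ^ i * η := by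
  induction i generalizing m₁ m₂ with
  | zero => simpa using h 0 0 rfl
  | succ i ih =>
    have e : deriv (expSum p c c' l₁ l₂ m₁ m₂) = fun z =>
        (l₁ : ℂ) * expSum p c c' l₁ l₂ (m₁ + 1) m₂ z +
          (l₂ : ℂ) * expSum p c c' l₁ l₂ m₁ (m₂ + 1) z :=
      funext fun z => (hasDerivAt_expSum p c c' l₁ l₂ m₁ m₂ z).deriv
    have hcd : ∀ a b, ContDiffAt ℂ i (expSum p c c' l₁ l₂ a b) z := fun a b =>
      (differentiable_expSum p c c' l₁ l₂ a b).contDiff.contDiffAt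
    rw [iteratedDeriv_succ', e, iteratedDeriv_fun_add (contDiffAt_const.mul (hcd _ _))
      (contDiffAt_const.mul (hcd _ _)), iteratedDeriv_const_mul_field,
      iteratedDeriv_const_mul_field]
    refine (norm_add_le _ _).trans ?_
    rw [norm_mul, norm_mul, Complex.norm_real, Complex.norm_real, Real.norm_eq_abs,
      Real.norm_eq_abs]
    have i1 := ih (m₁ + 1) m₂ (fun u v huv => by
      have := h (u + 1) v (by omega)
      rwa [show m₁ + (u + 1) = m₁ + 1 + u by ring] at this)
    have i2 := ih m₁ (m₂ + 1) (fun u v huv => by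
      have := h u (v + 1) (by omega)
      rwa [show m₂ + (v + 1) = m₂ + 1 + v by ring] at this)
    have hX : 0 ≤ X := (abs_nonneg _).trans h₁
    calc _ ≤ X * ((2 * X) ^ i * η) + X * ((2 * X) ^ i * η) := by gcongr
      _ = _ := by ring

theorem norm_expSum_le {ι : Type*} [Fintype ι] {p c c' : ι → ℤ} {l₁ l₂ P E K : ℝ}
    (hp : ∀ i, |(p i : ℝ)| ≤ P) (hc : ∀ i, |(c i : ℝ)| ≤ E) (hc' : ∀ i, |(c' i : ℝ)| ≤ E)
    (hK : ∀ i, |c i * l₁ + c' i * l₂| ≤ K) (m₁ m₂ : ℕ) (z : ℂ) :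
    ‖expSum p c c' l₁ l₂ m₁ m₂ z‖ ≤
      Fintype.card ι * (P * E ^ m₁ * E ^ m₂ * Real.exp (K * ‖z‖)) := by
  refine (norm_sum_le _ _).trans ?_
  rw [← nsmul_eq_mul, ← Finset.card_univ]
  refine Finset.sum_le_card_nsmul _ _ _ fun i _ => ?_
  have hP : 0 ≤ P := (abs_nonneg _).trans (hp i)
  have hE : 0 ≤ E := (abs_nonneg _).trans (hc i)
  rw [norm_mul, norm_mul, norm_mul, norm_pow, norm_pow, Complex.norm_intCast,
    Complex.norm_intCast, Complex.norm_intCast]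
  have h1 : ‖Complex.exp (((c i * l₁ + c' i * l₂ : ℝ) : ℂ) * z)‖ ≤ Real.exp (K * ‖z‖) := by
    refine (Complex.norm_exp_le_exp_norm _).trans (Real.exp_le_exp.2 ?_)
    rw [norm_mul, Complex.norm_real, Real.norm_eq_abs]
    have := hK i
    gcongr
  have := hp i
  have := hc i
  have := hc' i
  gcongr

/-- The data of an approximate multiplicative relation, arranged for the extrapolation argument. -/
structure BakerSystem (L : Type*) [Field L] [NumberField L] (ι : Type*) [Fintype ι] where
  X : ℕ
  φ₀ : L →+* ℂ
  B : ι → L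
  c : ι → ℤ
  c' : ι → ℤ
  l₁ : ℝ
  l₂ : ℝ
  κ : ℝ
  e : ι → ℝ
  finrank_le : Module.finrank ℚ L ≤ 6
  le_X : 100000 ≤ X
  card_eq : Fintype.card ι = X ^ 27
  isIntegral : ∀ i, IsIntegral ℤ (B i)
  norm_B_le : ∀ (φ : L →+* ℂ) i, ‖φ (B i)‖ ≤ Real.exp (3 * (X : ℝ) ^ 10)
  abs_c_le : ∀ i, |(c i : ℝ)| ≤ Real.exp (2 * X)
  abs_c'_le : ∀ i, |(c' i : ℝ)| ≤ Real.exp (2 * X)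
  abs_l₁_le : |l₁| ≤ X
  abs_l₂_le : |l₂| ≤ X
  abs_κ_le : |κ| ≤ 2 * (X : ℝ) ^ 10
  abs_e_le : ∀ i, |e i| ≤ Real.exp (-(X : ℝ) ^ 60)
  abs_freq_le : ∀ i, |c i * l₁ + c' i * l₂| ≤ 4 * (X : ℝ) ^ 10
  φ₀_B : ∀ i, φ₀ (B i) = Complex.exp ((κ + (c i * l₁ + c' i * l₂) + e i : ℝ) : ℂ)
  fiber : ∀ i, ∃ t : Finset ι, t.card ≤ X ^ 12 ∧ ∀ j, B j = B i → j ∈ t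
  inj : ∀ i j, B i = B j → c i = c j → c' i = c' j → i = j

namespace BakerSystem

variable {L : Type*} [Field L] [NumberField L] {ι : Type*} [Fintype ι] (D : BakerSystem L ι)

/-- Mixed power moments of the system. -/
def moment (p : ι → ℤ) (m₁ m₂ s : ℕ) : L :=
  ∑ i, (p i : L) * (D.c i : L) ^ m₁ * (D.c' i : L) ^ m₂ * D.B i ^ s

theorem isIntegral_moment (p : ι → ℤ) (m₁ m₂ s : ℕ) : IsIntegral ℤ (D.moment p m₁ m₂ s) := by
  refine IsIntegral.sum _ fun i _ => ?_
  have h : ∀ n : ℤ, IsIntegral ℤ (n : L) := fun n => by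
    simpa using isIntegral_algebraMap (R := ℤ) (A := L) (x := n)
  exact (((h _).mul ((h _).pow _)).mul ((h _).pow _)).mul ((D.isIntegral i).pow _)

theorem map_moment (p : ι → ℤ) (m₁ m₂ s : ℕ) (φ : L →+* ℂ) :
    φ (D.moment p m₁ m₂ s) =
      ∑ i, (p i : ℂ) * ((D.c i : ℂ) ^ m₁ * (D.c' i : ℂ) ^ m₂ * φ (D.B i) ^ s) := by
  simp [moment, map_sum, mul_assoc]

theorem X_real : (100000 : ℝ) ≤ D.X := by exact_mod_cast D.le_X

theorem pow_mul_pow_le {m₁ m₂ : ℕ} (h₁ : m₁ < 26 * D.X ^ 12) (h₂ : m₂ < 26 * D.X ^ 12) :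
    Real.exp (2 * D.X) ^ m₁ * Real.exp (2 * D.X) ^ m₂ ≤ Real.exp (104 * (D.X : ℝ) ^ 13) := by
  rw [← pow_add, ← Real.exp_nat_mul]
  refine Real.exp_le_exp.2 ?_
  have h : ((m₁ + m₂ : ℕ) : ℝ) ≤ 52 * (D.X : ℝ) ^ 12 := by exact_mod_cast (by omega)
  have hX := D.X_real
  calc _ ≤ 52 * (D.X : ℝ) ^ 12 * (2 * D.X) := by gcongr
    _ = _ := by ring

theorem term_le {m₁ m₂ s : ℕ} (h₁ : m₁ < 26 * D.X ^ 12) (h₂ : m₂ < 26 * D.X ^ 12)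
    (φ : L →+* ℂ) (i : ι) :
    ‖(D.c i : ℂ) ^ m₁ * (D.c' i : ℂ) ^ m₂ * φ (D.B i) ^ s‖ ≤
      Real.exp (104 * (D.X : ℝ) ^ 13 + 3 * (D.X : ℝ) ^ 10 * s) := by
  rw [Real.exp_add, norm_mul, norm_mul, norm_pow, norm_pow, norm_pow, Complex.norm_intCast,
    Complex.norm_intCast]
  refine mul_le_mul ?_ ?_ (by positivity) (by positivity)
  · refine le_trans ?_ (D.pow_mul_pow_le h₁ h₂)
    have := D.abs_c_le i
    have := D.abs_c'_le i
    gcongr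
  · rw [mul_comm _ (s : ℝ), Real.exp_nat_mul]
    have := D.norm_B_le φ i
    gcongr

theorem pow_27_le_exp : 9 * (D.X : ℝ) ^ 27 ≤ Real.exp ((D.X : ℝ) ^ 13 / 3) := by
  have hX := D.X_real
  have h1 : (D.X : ℝ) ≤ Real.exp D.X := by linarith [Real.add_one_le_exp (D.X : ℝ)]
  have h2 : 9 * (D.X : ℝ) ^ 27 ≤ Real.exp (28 * D.X) := by
    calc 9 * (D.X : ℝ) ^ 27 ≤ (D.X : ℝ) ^ 28 := by
          rw [pow_succ _ 27, mul_comm]; gcongr; linarith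
      _ ≤ Real.exp D.X ^ 28 := by gcongr
      _ = _ := by rw [← Real.exp_nat_mul]; norm_num
  refine h2.trans (Real.exp_le_exp.2 ?_)
  have h3 : (D.X : ℝ) ^ 2 ≤ (D.X : ℝ) ^ 13 := pow_le_pow_right₀ (by linarith) (by norm_num)
  nlinarith

theorem exists_weights : ∃ p : ι → ℤ, p ≠ 0 ∧
    (∀ i, |(p i : ℝ)| ≤ Real.exp (108 * (D.X : ℝ) ^ 13)) ∧
    ∀ m₁ < 26 * D.X ^ 12, ∀ m₂ < 26 * D.X ^ 12, ∀ s < D.X ^ 2, D.moment p m₁ m₂ s = 0 := by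
  have hX := D.X_real
  set x : ℝ := (D.X : ℝ) with hx
  set V : ℝ := Real.exp (107 * x ^ 13) with hV
  have hV1 : 1 ≤ V := Real.one_le_exp (by positivity)
  set N : ℝ := x ^ 27 with hN
  have hN1 : 1 ≤ N := one_le_pow₀ (by linarith)
  have hNV : 1 ≤ N * V := one_le_mul_of_one_le_of_one_le hN1 hV1
  set P : ℕ := ⌈8 * N * V⌉₊ with hP
  set Q : ℕ := ⌈2 * P * N * V + 1⌉₊ with hQ
  have hP1 : 8 * N * V ≤ P := Nat.le_ceil _
  have hP2 : (P : ℝ) < 8 * N * V + 1 := Nat.ceil_lt_add_one (by positivity)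
  have hQ2 : (Q : ℝ) < 2 * P * N * V + 1 + 1 := Nat.ceil_lt_add_one (by positivity)
  let R := Fin (26 * D.X ^ 12) × Fin (26 * D.X ^ 12) × Fin (D.X ^ 2) × (L →+* ℂ)
  have hR : 4 * Fintype.card R < D.X ^ 27 := by
    have h1 : Fintype.card (L →+* ℂ) ≤ 6 := by
      rw [NumberField.Embeddings.card]; exact D.finrank_le
    have h2 : Fintype.card R =
        26 * D.X ^ 12 * (26 * D.X ^ 12 * (D.X ^ 2 * Fintype.card (L →+* ℂ))) := by
      simp only [R, Fintype.card_prod, Fintype.card_fin]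
    rw [h2]
    calc _ = 2704 * Fintype.card (L →+* ℂ) * D.X ^ 26 := by ring
      _ ≤ 2704 * 6 * D.X ^ 26 := by gcongr
      _ < D.X * D.X ^ 26 := by
        have := D.le_X
        gcongr; omega
      _ = _ := by ring
  have hcard : (2 * Q + 1) ^ (2 * Fintype.card R) < (P + 1) ^ Fintype.card ι := by
    have h1 : 2 * Q + 1 ≤ (P + 1) ^ 2 := by
      have : (2 * Q + 1 : ℝ) ≤ (P + 1) ^ 2 := by
        have h8 : (8 : ℝ) ≤ P := by nlinarith
        have : 8 * (N * V) * P ≤ P * P := by nlinarith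
        nlinarith
      exact_mod_cast this
    calc _ ≤ ((P + 1) ^ 2) ^ (2 * Fintype.card R) := Nat.pow_le_pow_left h1 _
      _ = (P + 1) ^ (4 * Fintype.card R) := by rw [← pow_mul]; ring_nf
      _ < (P + 1) ^ Fintype.card ι := by
        rw [D.card_eq]
        refine Nat.pow_lt_pow_right ?_ hR
        have : (1 : ℝ) ≤ P := by nlinarith
        have : 1 ≤ P := by exact_mod_cast this
        omega
  let v : R → ι → ℂ := fun r i =>
    (D.c i : ℂ) ^ (r.1 : ℕ) * (D.c' i : ℂ) ^ (r.2.1 : ℕ) * r.2.2.2 (D.B i) ^ (r.2.2.1 : ℕ)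
  have hv : ∀ r i, ‖v r i‖ ≤ V := by
    intro r i
    refine (D.term_le r.1.2 r.2.1.2 r.2.2.2 i).trans (Real.exp_le_exp.2 ?_)
    have h1 : ((r.2.2.1 : ℕ) : ℝ) ≤ x ^ 2 := by
      have := r.2.2.1.2.le
      rw [hx]
      exact_mod_cast this
    have h2 : x ^ 12 ≤ x ^ 13 := pow_le_pow_right₀ (by linarith) (by norm_num)
    calc _ ≤ 104 * x ^ 13 + 3 * x ^ 10 * x ^ 2 := by gcongr
      _ = 104 * x ^ 13 + 3 * x ^ 12 := by ring
      _ ≤ _ := by linarith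
  obtain ⟨p, hp0, hpP, hsm⟩ := exists_int_vec_norm_sum_lt_one v hv P Q
    (by rw [D.card_eq]; push_cast; exact Nat.le_ceil _) hcard
  refine ⟨p, hp0, fun i => ?_, ?_⟩
  · have h1 : |(p i : ℝ)| ≤ P := by exact_mod_cast hpP i
    have h2 := D.pow_27_le_exp
    calc _ ≤ 8 * N * V + 1 := h1.trans hP2.le
      _ ≤ 9 * N * V := by linarith
      _ ≤ Real.exp (x ^ 13 / 3) * V := by gcongr
      _ ≤ _ := by
        rw [hV, ← Real.exp_add]
        refine Real.exp_le_exp.2 ?_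
        have : 0 ≤ x ^ 13 := by positivity
        linarith
  · intro m₁ h1 m₂ h2 s h3
    have h4 : ∀ φ : L →+* ℂ, ‖φ (D.moment p m₁ m₂ s)‖ < 1 := fun φ => by
      rw [map_moment]
      exact hsm (⟨m₁, h1⟩, ⟨m₂, h2⟩, ⟨s, h3⟩, φ)
    exact eq_zero_of_isIntegral_of_norm_lt (n := 5) D.finrank_le D.φ₀
      (D.isIntegral_moment p m₁ m₂ s) le_rfl le_rfl (fun φ => (h4 φ).le) (by simpa using h4 D.φ₀)

theorem φ₀_moment_sub {p : ι → ℤ} (hp : ∀ i, |(p i : ℝ)| ≤ Real.exp (108 * (D.X : ℝ) ^ 13))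
    {m₁ m₂ s : ℕ} (h₁ : m₁ < 26 * D.X ^ 12) (h₂ : m₂ < 26 * D.X ^ 12) (hs : s ≤ D.X ^ 27) :
    ∃ r : ℂ, ‖r‖ ≤ Real.exp (-(D.X : ℝ) ^ 60 / 2) ∧
      D.φ₀ (D.moment p m₁ m₂ s) =
        Complex.exp (D.κ * s) * (expSum p D.c D.c' D.l₁ D.l₂ m₁ m₂ s + r) := by
  have hX := D.X_real
  set x : ℝ := (D.X : ℝ) with hx
  refine ⟨∑ i, (p i : ℂ) * (D.c i : ℂ) ^ m₁ * (D.c' i : ℂ) ^ m₂ *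
    Complex.exp (((D.c i * D.l₁ + D.c' i * D.l₂ : ℝ) : ℂ) * s) *
      (Complex.exp (((D.e i * s : ℝ) : ℂ)) - 1), ?_, ?_⟩
  · have hsx : (s : ℝ) ≤ x ^ 27 := by rw [hx]; exact_mod_cast hs
    have hbig : x ^ 37 ≤ x ^ 60 / 100000 := by
      have : x ^ 38 ≤ x ^ 60 := pow_le_pow_right₀ (by linarith) (by norm_num)
      have h0 : 0 ≤ x ^ 37 := by positivity
      nlinarith [pow_succ x 37]
    have hbig2 : x ^ 13 ≤ x ^ 37 := pow_le_pow_right₀ (by linarith) (by norm_num)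
    have h27 : x ^ 27 ≤ Real.exp (x ^ 13 / 3) := by
      have := D.pow_27_le_exp
      have h0 : 0 ≤ x ^ 27 := by positivity
      linarith
    have h9 : 9 * x ^ 27 ≤ Real.exp (x ^ 13 / 3) := D.pow_27_le_exp
    have hes : ∀ i, |D.e i * s| ≤ Real.exp (x ^ 13 / 3) * Real.exp (-x ^ 60) := by
      intro i
      rw [abs_mul, Nat.abs_cast, mul_comm]
      exact mul_le_mul (hsx.trans h27) (D.abs_e_le i) (abs_nonneg _) (by positivity)
    have hes1 : ∀ i, |D.e i * s| ≤ 1 := fun i => (hes i).trans (by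
      rw [← Real.exp_add, Real.exp_le_one_iff]
      have : 0 ≤ x ^ 13 := by positivity
      linarith)
    have hterm : ∀ i ∈ (Finset.univ : Finset ι), ‖(p i : ℂ) * (D.c i : ℂ) ^ m₁ *
        (D.c' i : ℂ) ^ m₂ * Complex.exp (((D.c i * D.l₁ + D.c' i * D.l₂ : ℝ) : ℂ) * s) *
        (Complex.exp (((D.e i * s : ℝ) : ℂ)) - 1)‖ ≤
        Real.exp (108 * x ^ 13) * Real.exp (104 * x ^ 13) * Real.exp (4 * x ^ 37) *
          (2 * (Real.exp (x ^ 13 / 3) * Real.exp (-x ^ 60))) := by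
      intro i _
      rw [norm_mul, norm_mul, mul_assoc (p i : ℂ), norm_mul]
      have a1 : ‖(p i : ℂ)‖ ≤ Real.exp (108 * x ^ 13) := by
        rw [Complex.norm_intCast]; exact hp i
      have a2 : ‖(D.c i : ℂ) ^ m₁ * (D.c' i : ℂ) ^ m₂‖ ≤ Real.exp (104 * x ^ 13) := by
        simpa using D.term_le (s := 0) h₁ h₂ D.φ₀ i
      have a3 : ‖Complex.exp (((D.c i * D.l₁ + D.c' i * D.l₂ : ℝ) : ℂ) * s)‖ ≤
          Real.exp (4 * x ^ 37) := by
        refine (Complex.norm_exp_le_exp_norm _).trans (Real.exp_le_exp.2 ?_)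
        rw [norm_mul, Complex.norm_real, Real.norm_eq_abs, Complex.norm_natCast]
        calc _ ≤ (4 * x ^ 10) * x ^ 27 :=
              mul_le_mul (D.abs_freq_le i) hsx (Nat.cast_nonneg _) (by positivity)
          _ = _ := by ring
      have a4 : ‖Complex.exp (((D.e i * s : ℝ) : ℂ)) - 1‖ ≤
          2 * (Real.exp (x ^ 13 / 3) * Real.exp (-x ^ 60)) := by
        have hn : ‖((D.e i * s : ℝ) : ℂ)‖ = |D.e i * s| := by
          rw [Complex.norm_real, Real.norm_eq_abs]
        refine (Complex.norm_exp_sub_one_le (by rw [hn]; exact hes1 i)).trans ?_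
        rw [hn]
        linarith [hes i]
      gcongr
    refine (norm_sum_le _ _).trans ((Finset.sum_le_card_nsmul _ _ _ hterm).trans ?_)
    rw [nsmul_eq_mul, Finset.card_univ, D.card_eq]
    push_cast
    calc x ^ 27 * (Real.exp (108 * x ^ 13) * Real.exp (104 * x ^ 13) * Real.exp (4 * x ^ 37) *
          (2 * (Real.exp (x ^ 13 / 3) * Real.exp (-x ^ 60))))
        = (2 * x ^ 27) * (Real.exp (108 * x ^ 13) * Real.exp (104 * x ^ 13) *
          Real.exp (4 * x ^ 37) * (Real.exp (x ^ 13 / 3) * Real.exp (-x ^ 60))) := by ring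
      _ ≤ Real.exp (x ^ 13 / 3) * (Real.exp (108 * x ^ 13) * Real.exp (104 * x ^ 13) *
          Real.exp (4 * x ^ 37) * (Real.exp (x ^ 13 / 3) * Real.exp (-x ^ 60))) := by
        gcongr
        have h0 : 0 ≤ x ^ 27 := by positivity
        linarith
      _ = Real.exp (x ^ 13 / 3 + 108 * x ^ 13 + 104 * x ^ 13 + 4 * x ^ 37 + x ^ 13 / 3 -
          x ^ 60) := by
        simp only [sub_eq_add_neg, Real.exp_add]; ring
      _ ≤ _ := by
        refine Real.exp_le_exp.2 ?_
        have h0 : 0 ≤ x ^ 37 := by positivity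
        linarith
  · rw [map_moment, expSum, ← Finset.sum_add_distrib, Finset.mul_sum]
    refine Finset.sum_congr rfl fun i _ => ?_
    rw [D.φ₀_B, ← Complex.exp_nat_mul]
    have : Complex.exp ((s : ℂ) * ((D.κ + (D.c i * D.l₁ + D.c' i * D.l₂) + D.e i : ℝ) : ℂ)) =
        Complex.exp (D.κ * s) *
          Complex.exp (((D.c i * D.l₁ + D.c' i * D.l₂ : ℝ) : ℂ) * s) *
          Complex.exp (((D.e i * s : ℝ) : ℂ)) := by
      rw [← Complex.exp_add, ← Complex.exp_add]
      congr 1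
      push_cast
      ring
    rw [this]
    ring

end BakerSystem

namespace BakerSystem

variable {L : Type*} [Field L] [NumberField L] {ι : Type*} [Fintype ι] (D : BakerSystem L ι)

theorem norm_expSum_le_of_lt {p : ι → ℤ}
    (hp : ∀ i, |(p i : ℝ)| ≤ Real.exp (108 * (D.X : ℝ) ^ 13))
    {m₁ m₂ : ℕ} (h₁ : m₁ < 26 * D.X ^ 12) (h₂ : m₂ < 26 * D.X ^ 12) {Y : ℝ} (hY : 1 ≤ Y)
    {z : ℂ} (hz : ‖z‖ = 5 * ((D.X : ℝ) ^ 3 * Y)) :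
    ‖expSum p D.c D.c' D.l₁ D.l₂ m₁ m₂ z‖ ≤ Real.exp (240 * ((D.X : ℝ) ^ 13 * Y)) := by
  have hX := D.X_real
  refine (norm_expSum_le hp D.abs_c_le D.abs_c'_le D.abs_freq_le m₁ m₂ z).trans ?_
  rw [D.card_eq, hz]
  push_cast
  set x : ℝ := (D.X : ℝ) with hx
  have h27 : x ^ 27 ≤ Real.exp (x ^ 13) := by
    have h1 : 9 * x ^ 27 ≤ Real.exp (x ^ 13 / 3) := D.pow_27_le_exp
    have h0 : 0 ≤ x ^ 27 := by positivity
    have h2 : Real.exp (x ^ 13 / 3) ≤ Real.exp (x ^ 13) := by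
      refine Real.exp_le_exp.2 ?_
      have : 0 ≤ x ^ 13 := by positivity
      linarith
    linarith
  have hmm : Real.exp (2 * x) ^ m₁ * Real.exp (2 * x) ^ m₂ ≤ Real.exp (104 * x ^ 13) :=
    D.pow_mul_pow_le h₁ h₂
  calc x ^ 27 * (Real.exp (108 * x ^ 13) * Real.exp (2 * x) ^ m₁ * Real.exp (2 * x) ^ m₂ *
        Real.exp (4 * x ^ 10 * (5 * (x ^ 3 * Y))))
      = x ^ 27 * (Real.exp (108 * x ^ 13) * (Real.exp (2 * x) ^ m₁ * Real.exp (2 * x) ^ m₂) *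
        Real.exp (20 * (x ^ 13 * Y))) := by ring_nf
    _ ≤ Real.exp (x ^ 13) * (Real.exp (108 * x ^ 13) * Real.exp (104 * x ^ 13) *
        Real.exp (20 * (x ^ 13 * Y))) := by gcongr
    _ = Real.exp (213 * x ^ 13 + 20 * (x ^ 13 * Y)) := by
        rw [← Real.exp_add, ← Real.exp_add, ← Real.exp_add]; ring_nf
    _ ≤ _ := by
        refine Real.exp_le_exp.2 ?_
        have : 0 ≤ x ^ 13 := by positivity
        nlinarith

theorem norm_map_moment_le {p : ι → ℤ}
    (hp : ∀ i, |(p i : ℝ)| ≤ Real.exp (108 * (D.X : ℝ) ^ 13))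
    {m₁ m₂ s : ℕ} (h₁ : m₁ < 26 * D.X ^ 12) (h₂ : m₂ < 26 * D.X ^ 12) {Y : ℝ} (hY : 1 ≤ Y)
    (hs : (s : ℝ) ≤ (D.X : ℝ) ^ 3 * Y) (φ : L →+* ℂ) :
    ‖φ (D.moment p m₁ m₂ s)‖ ≤ Real.exp (216 * ((D.X : ℝ) ^ 13 * Y)) := by
  have hX := D.X_real
  rw [map_moment]
  set x : ℝ := (D.X : ℝ) with hx
  have h27 : x ^ 27 ≤ Real.exp (x ^ 13) := by
    have h1 : 9 * x ^ 27 ≤ Real.exp (x ^ 13 / 3) := D.pow_27_le_exp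
    have h0 : 0 ≤ x ^ 27 := by positivity
    have h2 : Real.exp (x ^ 13 / 3) ≤ Real.exp (x ^ 13) := by
      refine Real.exp_le_exp.2 ?_
      have : 0 ≤ x ^ 13 := by positivity
      linarith
    linarith
  have hterm : ∀ i ∈ (Finset.univ : Finset ι),
      ‖(p i : ℂ) * ((D.c i : ℂ) ^ m₁ * (D.c' i : ℂ) ^ m₂ * φ (D.B i) ^ s)‖ ≤
      Real.exp (108 * x ^ 13) * Real.exp (104 * x ^ 13 + 3 * x ^ 10 * s) := by
    intro i _
    rw [norm_mul, Complex.norm_intCast]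
    exact mul_le_mul (hp i) (D.term_le h₁ h₂ φ i) (norm_nonneg _) (by positivity)
  refine (norm_sum_le _ _).trans ((Finset.sum_le_card_nsmul _ _ _ hterm).trans ?_)
  rw [nsmul_eq_mul, Finset.card_univ, D.card_eq]
  push_cast
  calc x ^ 27 * (Real.exp (108 * x ^ 13) * Real.exp (104 * x ^ 13 + 3 * x ^ 10 * s))
      ≤ Real.exp (x ^ 13) *
        (Real.exp (108 * x ^ 13) * Real.exp (104 * x ^ 13 + 3 * x ^ 10 * (x ^ 3 * Y))) := by
        gcongr
    _ = Real.exp (213 * x ^ 13 + 3 * (x ^ 13 * Y)) := by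
        rw [← Real.exp_add, ← Real.exp_add]; ring_nf
    _ ≤ _ := by
        refine Real.exp_le_exp.2 ?_
        have : 0 ≤ x ^ 13 := by positivity
        nlinarith

theorem log_factor_le (j : ℕ) (hj : j ≤ 24) :
    (4 * (D.X : ℝ) ^ (3 + j) * (2 * (D.X ^ 12).factorial)) ^ (D.X ^ 2 * D.X ^ j * D.X ^ 12) *
      ((2 * (D.X : ℝ)) ^ (D.X ^ 12) * Real.exp (-(D.X : ℝ) ^ 60 / 2)) ≤
      Real.exp (-(D.X : ℝ) ^ 60 / 8) := by
  have hX := D.X_real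
  set x : ℝ := (D.X : ℝ) with hx
  have hxe : x ≤ Real.exp x := by linarith [Real.add_one_le_exp x]
  have hfac : ((D.X ^ 12).factorial : ℝ) ≤ Real.exp (12 * x ^ 13) := by
    calc ((D.X ^ 12).factorial : ℝ) ≤ ((D.X ^ 12 : ℕ) : ℝ) ^ (D.X ^ 12) := by
          exact_mod_cast Nat.factorial_le_pow _
      _ = x ^ (12 * D.X ^ 12) := by push_cast; rw [← pow_mul]
      _ ≤ Real.exp x ^ (12 * D.X ^ 12) := by gcongr
      _ = _ := by
        rw [← Real.exp_nat_mul]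
        push_cast
        rw [← hx]
        ring_nf
  have h8 : 8 * x ^ (3 + j) ≤ Real.exp (28 * x) := by
    calc 8 * x ^ (3 + j) ≤ x * x ^ 27 := by
          have : x ^ (3 + j) ≤ x ^ 27 := pow_le_pow_right₀ (by linarith) (by omega)
          gcongr
          linarith
      _ = x ^ 28 := by ring
      _ ≤ Real.exp x ^ 28 := by gcongr
      _ = _ := by rw [← Real.exp_nat_mul]; norm_num
  have hbase : 4 * x ^ (3 + j) * (2 * (D.X ^ 12).factorial) ≤ Real.exp (13 * x ^ 13) := by
    calc 4 * x ^ (3 + j) * (2 * (D.X ^ 12).factorial)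
        = 8 * x ^ (3 + j) * (D.X ^ 12).factorial := by ring
      _ ≤ Real.exp (28 * x) * Real.exp (12 * x ^ 13) := by gcongr
      _ = Real.exp (28 * x + 12 * x ^ 13) := by rw [Real.exp_add]
      _ ≤ _ := by
        refine Real.exp_le_exp.2 ?_
        have : x ^ 2 ≤ x ^ 13 := pow_le_pow_right₀ (by linarith) (by norm_num)
        nlinarith
  have h2x : 2 * x ≤ Real.exp (2 * x) := by linarith [Real.add_one_le_exp (2 * x)]
  calc _ ≤ Real.exp (13 * x ^ 13) ^ (D.X ^ 2 * D.X ^ j * D.X ^ 12) *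
        (Real.exp (2 * x) ^ (D.X ^ 12) * Real.exp (-x ^ 60 / 2)) := by gcongr
    _ = Real.exp (13 * x ^ (27 + j) + 2 * x ^ 13 - x ^ 60 / 2) := by
        rw [← Real.exp_nat_mul, ← Real.exp_nat_mul, ← Real.exp_add, ← Real.exp_add]
        push_cast
        congr 1
        rw [← hx]
        ring
    _ ≤ _ := by
        refine Real.exp_le_exp.2 ?_
        have h1 : x ^ (27 + j) ≤ x ^ 51 := pow_le_pow_right₀ (by linarith) (by omega)
        have h2 : x ^ 13 ≤ x ^ 51 := pow_le_pow_right₀ (by linarith) (by omega)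
        have h3 : x ^ 52 ≤ x ^ 60 := pow_le_pow_right₀ (by linarith) (by omega)
        have h4 : 0 ≤ x ^ 51 := by positivity
        nlinarith [pow_succ x 51]

theorem moment_eq_zero_of_wider_range {p : ι → ℤ}
    (hp : ∀ i, |(p i : ℝ)| ≤ Real.exp (108 * (D.X : ℝ) ^ 13)) (j : ℕ) (hj : j ≤ 24)
    (h : ∀ m₁ < (26 - j) * D.X ^ 12, ∀ m₂ < (26 - j) * D.X ^ 12, ∀ s < D.X ^ (2 + j),
      D.moment p m₁ m₂ s = 0) :
    ∀ m₁ < (26 - (j + 1)) * D.X ^ 12, ∀ m₂ < (26 - (j + 1)) * D.X ^ 12, ∀ s < D.X ^ (3 + j),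
      D.moment p m₁ m₂ s = 0 := by
  intro m₁ h1 m₂ h2 s hs
  have hX := D.X_real
  have hXn := D.le_X
  have hsplit : (26 - j) * D.X ^ 12 = (26 - (j + 1)) * D.X ^ 12 + D.X ^ 12 := by
    rw [show 26 - j = 26 - (j + 1) + 1 by omega]; ring
  have h26 : (26 - j) * D.X ^ 12 ≤ 26 * D.X ^ 12 := by gcongr; omega
  have hs27 : D.X ^ (3 + j) ≤ D.X ^ 27 := Nat.pow_le_pow_right (by omega) (by omega)
  have hs23 : D.X ^ (2 + j) ≤ D.X ^ (3 + j) := Nat.pow_le_pow_right (by omega) (by omega)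
  set x : ℝ := (D.X : ℝ) with hx
  set Y : ℝ := x ^ j with hY
  have hY1 : 1 ≤ Y := one_le_pow₀ (by linarith)
  have hxY : x ^ (3 + j) = x ^ 3 * Y := by rw [hY, pow_add]
  have hsY : (s : ℝ) ≤ x ^ 3 * Y := by
    rw [← hxY, hx]; exact_mod_cast hs.le
  obtain ⟨r, hr, hφr⟩ := D.φ₀_moment_sub hp (m₁ := m₁) (m₂ := m₂) (s := s) (by omega)
    (by omega) (by omega)
  -- derivatives at the known zeros
  have hzero : ∀ t < D.X ^ (2 + j), ∀ i < D.X ^ 12,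
      ‖iteratedDeriv i (expSum p D.c D.c' D.l₁ D.l₂ m₁ m₂) t‖ ≤
        (2 * x) ^ (D.X ^ 12) * Real.exp (-x ^ 60 / 2) := by
    intro t ht i hi
    refine (norm_iteratedDeriv_expSum_le p D.c D.c' D.abs_l₁_le D.abs_l₂_le (t : ℂ) i m₁ m₂
      (η := Real.exp (-x ^ 60 / 2)) ?_).trans ?_
    · intro u v huv
      obtain ⟨r', hr', hφr'⟩ := D.φ₀_moment_sub hp (m₁ := m₁ + u) (m₂ := m₂ + v) (s := t)
        (by omega) (by omega) (by omega)
      rw [h (m₁ + u) (by omega) (m₂ + v) (by omega) t ht, map_zero] at hφr'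
      have h0 := (mul_eq_zero.1 hφr'.symm).resolve_left (Complex.exp_ne_zero _)
      rw [eq_neg_of_add_eq_zero_left h0, norm_neg]
      exact hr'
    · gcongr
      · linarith
  have hf := norm_le_of_approx_zeros (S := D.X ^ (2 + j)) (M := D.X ^ 12) (ρ := x ^ (3 + j))
    (one_le_pow₀ (by linarith)) (by rw [hx]; exact_mod_cast hs23)
    (D.X ^ 2 * D.X ^ j * D.X ^ 12) (fun _ => D.X ^ 12) (fun _ => le_rfl)
    (by rw [Finset.sum_const, Finset.card_range, smul_eq_mul, pow_add])
    (differentiable_expSum p D.c D.c' D.l₁ D.l₂ m₁ m₂)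
    (η := (2 * x) ^ (D.X ^ 12) * Real.exp (-x ^ 60 / 2)) (by positivity) hzero
    (B := Real.exp (240 * (x ^ 13 * Y)))
    (fun z hz => D.norm_expSum_le_of_lt hp (by omega) (by omega) hY1 (by rw [hz, hxY]))
    (x := (s : ℂ)) (by rw [Complex.norm_natCast, hxY]; exact hsY)
  have hlog := D.log_factor_le j hj
  rw [← hx] at hlog
  set W : ℝ := x ^ 13 * Y with hW
  have hW0 : 1 ≤ W := one_le_mul_of_one_le_of_one_le (one_le_pow₀ (by linarith)) hY1
  have hW60 : x * W ≤ x ^ 60 / 8 := by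
    have h3 : x * W = x ^ (14 + j) := by rw [hW, hY]; ring
    have h4 : x ^ (14 + j) ≤ x ^ 59 := pow_le_pow_right₀ (by linarith) (by omega)
    have h5 : 0 ≤ x ^ 59 := by positivity
    rw [h3]
    nlinarith [pow_succ x 59]
  have htwo : Real.exp (240 * W) / 2 ^ (D.X ^ 2 * D.X ^ j * D.X ^ 12) ≤
      Real.exp (-(x * W) / 2) := by
    have h3 : (2 : ℝ) ^ (D.X ^ 2 * D.X ^ j * D.X ^ 12) = Real.exp (Real.log 2 * (x * W)) := by
      rw [← Real.rpow_natCast, Real.rpow_def_of_pos (by norm_num)]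
      push_cast
      congr 2
      rw [hW, hY, ← hx]
      ring
    rw [h3, ← Real.exp_sub]
    refine Real.exp_le_exp.2 ?_
    have h4 := Real.log_two_gt_d9
    have h5 : 100000 * W ≤ x * W := by gcongr
    have h6 : 0.69 * (x * W) ≤ Real.log 2 * (x * W) := by gcongr; linarith
    linarith
  have hsum : ‖expSum p D.c D.c' D.l₁ D.l₂ m₁ m₂ s + r‖ ≤ 3 * Real.exp (-(x * W) / 2) := by
    have e1 : Real.exp (-x ^ 60 / 8) ≤ Real.exp (-(x * W) / 2) := Real.exp_le_exp.2 (by nlinarith)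
    have e2 : Real.exp (-x ^ 60 / 2) ≤ Real.exp (-(x * W) / 2) := Real.exp_le_exp.2 (by nlinarith)
    refine (norm_add_le _ _).trans ?_
    linarith
  have hε : ‖D.φ₀ (D.moment p m₁ m₂ s)‖ ≤ Real.exp (2 * W) * (3 * Real.exp (-(x * W) / 2)) := by
    rw [hφr, norm_mul]
    refine mul_le_mul ?_ hsum (norm_nonneg _) (by positivity)
    refine (Complex.norm_exp_le_exp_norm _).trans (Real.exp_le_exp.2 ?_)
    rw [norm_mul, Complex.norm_real, Real.norm_eq_abs, Complex.norm_natCast]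
    calc _ ≤ (2 * x ^ 10) * (x ^ 3 * Y) :=
          mul_le_mul D.abs_κ_le hsY (Nat.cast_nonneg _) (by positivity)
      _ = _ := by rw [hW]; ring
  refine eq_zero_of_isIntegral_of_norm_lt (n := 5) D.finrank_le D.φ₀
    (D.isIntegral_moment p m₁ m₂ s) (V := Real.exp (216 * W)) (Real.one_le_exp (by positivity)) hε
    (fun φ => D.norm_map_moment_le hp (by omega) (by omega) hY1 hsY φ) ?_
  rw [← Real.exp_nat_mul]
  have h3 : (3 : ℝ) ≤ Real.exp 2 := by
    have := Real.add_one_le_exp (2 : ℝ); linarith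
  calc Real.exp (2 * W) * (3 * Real.exp (-(x * W) / 2)) * Real.exp ((5 : ℕ) * (216 * W))
      ≤ Real.exp (2 * W) * (Real.exp 2 * Real.exp (-(x * W) / 2)) *
        Real.exp ((5 : ℕ) * (216 * W)) := by gcongr
    _ = Real.exp (2 * W + 2 - (x * W) / 2 + 1080 * W) := by
        rw [← Real.exp_add, ← Real.exp_add, ← Real.exp_add]; push_cast; ring_nf
    _ < 1 := by
        rw [Real.exp_lt_one_iff]
        nlinarith

theorem elim (D : BakerSystem L ι) : False := by
  obtain ⟨p, hp0, hp, h⟩ := D.exists_weights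
  have hinv : ∀ j ≤ 25, ∀ m₁ < (26 - j) * D.X ^ 12, ∀ m₂ < (26 - j) * D.X ^ 12,
      ∀ s < D.X ^ (2 + j), D.moment p m₁ m₂ s = 0 := by
    intro j
    induction j with
    | zero => intro _; simpa using h
    | succ j ih =>
      intro hj
      have := D.moment_eq_zero_of_wider_range hp j (by omega) (ih (by omega))
      rwa [show 3 + j = 2 + (j + 1) by omega] at this
  have h25 := hinv 25 le_rfl
  refine hp0 (eq_zero_of_sum_pow_mul_pow_mul_pow_eq_zero p D.B D.c D.c' (n₁ := D.X ^ 12)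
    (n₂ := D.X ^ 27) ?_ D.card_eq.le D.fiber D.inj)
  simpa [moment] using h25

end BakerSystem

theorem factorial_dvd_three_pow_mul_prod (r : ℕ) (m : ℤ) :
    (r.factorial : ℤ) ∣ 3 ^ r * ∏ i ∈ Finset.range r, (m - 3 * i) := by
  obtain ⟨v, M, hM, hr⟩ : ∃ v M, ¬ 3 ∣ M ∧ r.factorial = 3 ^ v * M :=
    Nat.exists_eq_pow_mul_and_not_dvd (Nat.factorial_ne_zero r) 3 (by norm_num)
  have hv : v ≤ r := by
    have h1 : padicValNat 3 r.factorial = v := by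
      have hM0 : M ≠ 0 := fun h => hM (h ▸ dvd_zero 3)
      rw [hr, padicValNat.mul (by positivity) hM0, padicValNat.prime_pow,
        padicValNat.eq_zero_of_not_dvd hM, add_zero]
    have h2 := sub_one_mul_padicValNat_factorial (p := 3) r
    omega
  have hco : IsCoprime (3 : ℤ) M := by
    rw [← Nat.cast_ofNat, Nat.isCoprime_iff_coprime]
    exact (Nat.Prime.coprime_iff_not_dvd Nat.prime_three).2 hM
  have hMr : (M : ℤ) ∣ ∏ i ∈ Finset.range r, (m - 3 * i) := by
    obtain ⟨t, w, htw⟩ := hco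
    have hM0 : (M : ℤ) ≠ 0 := fun h => hM (by
      have : M = 0 := by exact_mod_cast h
      simp [this])
    set q : ℤ := (t * m) % M + M * r with hq
    have hq0 : (r : ℤ) ≤ q := by
      have h1 := Int.emod_nonneg (t * m) hM0
      have h2 : (1 : ℤ) ≤ M := by omega
      nlinarith
    obtain ⟨z, hz⟩ : ∃ z : ℕ, q = z := ⟨q.toNat, by omega⟩
    have h3 : (M : ℤ) ∣ ∏ i ∈ Finset.range r, (q - i) := by
      have h4 : ∏ i ∈ Finset.range r, (q - i) = (z.descFactorial r : ℤ) := by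
        rw [Nat.descFactorial_eq_prod_range]
        push_cast
        refine Finset.prod_congr rfl fun i hi => ?_
        have := Finset.mem_range.1 hi
        rw [hz, Nat.cast_sub (by omega)]
      rw [h4]
      have h5 : M ∣ z.descFactorial r :=
        (Dvd.intro_left (3 ^ v) hr.symm).trans (Nat.factorial_dvd_descFactorial z r)
      exact_mod_cast h5
    have h6 : ∏ i ∈ Finset.range r, (m - 3 * i) ≡ ∏ i ∈ Finset.range r, 3 * (q - i) [ZMOD M] := by
      refine Int.ModEq.prod fun i _ => ?_
      have h7 : 3 * q ≡ m [ZMOD M] := by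
        have h8 : q ≡ t * m [ZMOD M] := by
          have := (Int.mod_modEq (t * m) M).add_right (M * r)
          rw [← hq] at this
          exact this.trans (by simp [Int.ModEq])
        have h9 : 3 * (t * m) ≡ m [ZMOD M] := by
          rw [Int.modEq_iff_dvd]
          exact ⟨w * m, by linear_combination (-m) * htw⟩
        exact (h8.mul_left 3).trans h9
      have := (h7.sub_right (3 * i)).symm
      rwa [← mul_sub] at this
    rw [Finset.prod_mul_distrib] at h6
    exact h6.dvd_iff.2 (h3.mul_left _)
  rw [hr]
  push_cast
  exact mul_dvd_mul (pow_dvd_pow 3 hv) hMr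

/-- The weights of the binomial form whose cube-root Padé remainder vanishes to high order. -/
def padeWeight (r : ℕ) (e : ℤ) : ℤ :=
  3 ^ r * (∏ i ∈ Finset.range r, (e - 2 - 3 * i)) / r.factorial

theorem factorial_mul_padeWeight (r : ℕ) (e : ℤ) :
    (r.factorial : ℤ) * padeWeight r e = 3 ^ r * ∏ i ∈ Finset.range r, (e - 2 - 3 * i) :=
  Int.mul_ediv_cancel' (factorial_dvd_three_pow_mul_prod r (e - 2))

theorem pow_self_le_three_pow_mul_factorial (r : ℕ) : r ^ r ≤ 3 ^ r * r.factorial := by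
  have h := Real.pow_div_factorial_le_exp (x := r) (by positivity) r
  rw [div_le_iff₀ (by positivity)] at h
  have h2 : Real.exp r ≤ 3 ^ r := by
    rw [← mul_one (r : ℝ), Real.exp_nat_mul]
    gcongr
    exact (Real.exp_one_lt_d9.trans (by norm_num)).le
  have : (r : ℝ) ^ r ≤ 3 ^ r * r.factorial := h.trans (by gcongr)
  exact_mod_cast this

theorem abs_padeWeight_le (r : ℕ) (e : ℤ) (h0 : 0 ≤ e) (h1 : e ≤ 3 * r + 1) :
    |padeWeight r e| ≤ 27 ^ r := by
  have hf : (0 : ℤ) < r.factorial := by exact_mod_cast Nat.factorial_pos r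
  have h2 : (r.factorial : ℤ) * |padeWeight r e| ≤ r.factorial * 27 ^ r := by
    rw [← abs_of_pos hf, ← abs_mul, factorial_mul_padeWeight, abs_of_pos hf, abs_mul,
      Finset.abs_prod, abs_of_pos (by positivity : (0 : ℤ) < 3 ^ r)]
    have h3 : ∏ i ∈ Finset.range r, |e - 2 - 3 * (i : ℤ)| ≤ (3 * r) ^ r := by
      calc _ ≤ ∏ i ∈ Finset.range r, (3 * r : ℤ) := by
            refine Finset.prod_le_prod (fun _ _ => abs_nonneg _) fun i hi => ?_
            have := Finset.mem_range.1 hi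
            rw [abs_le]; constructor <;> omega
        _ = _ := by simp
    have h4 : (r : ℤ) ^ r ≤ 3 ^ r * r.factorial := by
      exact_mod_cast pow_self_le_three_pow_mul_factorial r
    calc (3 : ℤ) ^ r * ∏ i ∈ Finset.range r, |e - 2 - 3 * (i : ℤ)| ≤ 3 ^ r * (3 * r) ^ r := by
          gcongr
      _ = 3 ^ r * 3 ^ r * r ^ r := by rw [mul_pow]; ring
      _ ≤ 3 ^ r * 3 ^ r * (3 ^ r * r.factorial) := by gcongr
      _ = r.factorial * 27 ^ r := by
        rw [show (27 : ℤ) = 3 * 3 * 3 by norm_num, mul_pow, mul_pow]; ring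
  exact le_of_mul_le_mul_left h2 hf

theorem padeWeight_reflect (r : ℕ) (e : ℤ) :
    padeWeight r (3 * r + 1 - e) = (-1) ^ r * padeWeight r e := by
  have hf : (r.factorial : ℤ) ≠ 0 := by exact_mod_cast Nat.factorial_ne_zero r
  apply mul_left_cancel₀ hf
  rw [mul_left_comm, factorial_mul_padeWeight, factorial_mul_padeWeight,
    ← Finset.prod_range_reflect, mul_left_comm]
  congr 1
  rw [← Finset.card_range r, ← Finset.prod_const, Finset.card_range, ← Finset.prod_mul_distrib]
  refine Finset.prod_congr rfl fun i hi => ?_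
  have := Finset.mem_range.1 hi
  have h : ((r - 1 - i : ℕ) : ℤ) = r - 1 - i := by omega
  rw [h]
  ring

theorem padeWeight_eq_zero (r f : ℕ) (h : f < r) : padeWeight r (3 * f + 2 : ℕ) = 0 := by
  have hf : (r.factorial : ℤ) ≠ 0 := by exact_mod_cast Nat.factorial_ne_zero r
  apply mul_left_cancel₀ hf
  rw [factorial_mul_padeWeight, Finset.prod_eq_zero (Finset.mem_range.2 h) (by push_cast; ring)]
  simp

theorem succ_mul_padeWeight_succ (r : ℕ) (e : ℤ) :
    (r + 1) * padeWeight (r + 1) e = 3 * (e - 2 - 3 * r) * padeWeight r e := by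
  have hf : (r.factorial : ℤ) ≠ 0 := by exact_mod_cast Nat.factorial_ne_zero r
  apply mul_left_cancel₀ hf
  have h := factorial_mul_padeWeight (r + 1) e
  rw [Nat.factorial_succ, Finset.prod_range_succ] at h
  push_cast at h
  linear_combination h - 3 * (e - 2 - 3 * r) * factorial_mul_padeWeight r e

theorem padeWeight_ne_zero (r : ℕ) (e : ℤ) (h : e = 0 ∨ e = 1) : padeWeight r e ≠ 0 := by
  intro h0
  have h1 := factorial_mul_padeWeight r e
  rw [h0, mul_zero] at h1
  have h2 := (mul_eq_zero.1 h1.symm).resolve_left (by positivity)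
  obtain ⟨i, _, hi⟩ := Finset.prod_eq_zero_iff.1 h2
  omega

theorem exists_newton_coeff (r : ℕ) : ∃ d : ℕ → ℤ, (∀ k ≤ r, |d k| ≤ 54 ^ r) ∧
    ∀ e : ℕ, padeWeight r e = ∑ k ∈ Finset.range (r + 1), d k * e.choose k := by
  refine ⟨fun k => (fwdDiff (1 : ℕ))^[k] (fun e : ℕ => padeWeight r e) 0, ?_, ?_⟩
  · intro k hk
    beta_reduce
    rw [fwdDiff_iter_eq_sum_shift]
    refine (Finset.abs_sum_le_sum_abs _ _).trans ?_
    have h1 : ∀ j ∈ Finset.range (k + 1),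
        |((-1 : ℤ) ^ (k - j) * k.choose j) • padeWeight r ((0 + j • 1 : ℕ) : ℤ)| ≤
          k.choose j * 27 ^ r := by
      intro j hj
      have := Finset.mem_range.1 hj
      rw [smul_eq_mul, abs_mul, abs_mul, abs_pow, abs_neg, abs_one, one_pow, one_mul, Nat.abs_cast]
      gcongr
      exact abs_padeWeight_le r _ (by positivity) (by simp; omega)
    refine (Finset.sum_le_sum h1).trans ?_
    rw [← Finset.sum_mul]
    have h2 : ∑ i ∈ Finset.range (k + 1), (k.choose i : ℤ) = 2 ^ k := by
      exact_mod_cast Nat.sum_range_choose k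
    rw [h2]
    calc (2 : ℤ) ^ k * 27 ^ r ≤ 2 ^ r * 27 ^ r := by gcongr; norm_num
      _ = 54 ^ r := by rw [← mul_pow]; norm_num
  · intro e
    have hz : ∀ k, r < k → (fwdDiff (1 : ℕ))^[k] (fun e : ℕ => padeWeight r e) 0 = 0 := by
      intro k hk
      have hf : (r.factorial : ℤ) ≠ 0 := by exact_mod_cast Nat.factorial_ne_zero r
      apply mul_left_cancel₀ hf
      rw [mul_zero]
      set Q : Polynomial ℤ := Polynomial.C (3 ^ r) *
        ∏ i ∈ Finset.range r, (Polynomial.X - Polynomial.C (2 + 3 * i : ℤ)) with hQ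
      have hdeg : Q.natDegree < k := by
        refine (Polynomial.natDegree_C_mul_le _ _).trans_lt ?_
        rw [Polynomial.natDegree_finsetProd_X_sub_C_eq_card]
        simpa using hk
      have h1 := congrFun (Polynomial.fwdDiff_iter_eq_zero_of_degree_lt hdeg) 0
      rw [fwdDiff_iter_eq_sum_shift] at h1 ⊢
      rw [Pi.zero_apply] at h1
      rw [← h1, Finset.mul_sum]
      refine Finset.sum_congr rfl fun j _ => ?_
      have h2 : Q.eval (j : ℤ) = r.factorial * padeWeight r j := by
        rw [factorial_mul_padeWeight, hQ, Polynomial.eval_mul, Polynomial.eval_C,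
          Polynomial.eval_prod]
        congr 1
        refine Finset.prod_congr rfl fun i _ => ?_
        simp only [Polynomial.eval_sub, Polynomial.eval_X, Polynomial.eval_C]
        ring
      simp only [zero_add, smul_eq_mul, nsmul_eq_mul, mul_one]
      rw [h2]
      ring
    have h := shift_eq_sum_fwdDiff_iter (1 : ℕ) (fun e : ℕ => padeWeight r e) e 0
    simp only [zero_add, smul_eq_mul, mul_one] at h
    rw [h]
    have h1 : ∀ n, ∀ N ≥ n, (∀ k ∈ Finset.range N, k ∉ Finset.range n →
        e.choose k • (fwdDiff (1 : ℕ))^[k] (fun e : ℕ => padeWeight r e) 0 = 0) →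
        ∑ k ∈ Finset.range n, e.choose k • (fwdDiff (1 : ℕ))^[k] (fun e : ℕ => padeWeight r e) 0 =
        ∑ k ∈ Finset.range N, e.choose k • (fwdDiff (1 : ℕ))^[k]
          (fun e : ℕ => padeWeight r e) 0 := fun n N hN hk =>
      Finset.sum_subset (Finset.range_subset_range.2 hN) hk
    rw [h1 (e + 1) (e + r + 1) (by omega) ?_, ← h1 (r + 1) (e + r + 1) (by omega) ?_]
    · exact Finset.sum_congr rfl fun k _ => by rw [nsmul_eq_mul, mul_comm]
    · intro k _ hk
      rw [hz k (by simpa using hk), smul_zero]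
    · intro k _ hk
      rw [Nat.choose_eq_zero_of_lt (by simpa using hk), zero_smul]

/-- Coefficients of the Padé numerators. -/
def padeCoeff (r f : ℕ) : ℤ := (-1) ^ f * (3 * r + 1).choose (3 * f) * padeWeight r (3 * f : ℕ)

/-- The homogeneous Padé numerator of degree `r` for the cube root. -/
def padeNum {R : Type*} [CommRing R] (r : ℕ) (X Y : R) : R :=
  ∑ f ∈ Finset.range (r + 1), (padeCoeff r f : R) * X ^ (r - f) * Y ^ f

/-- The binomial form of degree `3r+1` weighted by `padeWeight`. -/
def padeForm {R : Type*} [CommRing R] (r : ℕ) (ξ η : R) : R :=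
  ∑ e ∈ Finset.range (3 * r + 2),
    (-1) ^ e * ((3 * r + 1).choose e : R) * (padeWeight r e : R) * η ^ e * ξ ^ (3 * r + 1 - e)

theorem sum_range_three_mul_add_two {M : Type*} [AddCommMonoid M] (g : ℕ → M) (r : ℕ) :
    ∑ e ∈ Finset.range (3 * r + 2), g e = ∑ f ∈ Finset.range (r + 1), g (3 * f) +
      ∑ f ∈ Finset.range (r + 1), g (3 * f + 1) + ∑ f ∈ Finset.range r, g (3 * f + 2) := by
  induction r with
  | zero => simp [Finset.sum_range_succ]
  | succ r ih =>
    rw [show 3 * (r + 1) + 2 = 3 * r + 2 + 1 + 1 + 1 by ring, Finset.sum_range_succ,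
      Finset.sum_range_succ, Finset.sum_range_succ, ih,
      Finset.sum_range_succ (fun f => g (3 * f)) (r + 1),
      Finset.sum_range_succ (fun f => g (3 * f + 1)) (r + 1),
      Finset.sum_range_succ (fun f => g (3 * f + 2)) r]
    rw [show 3 * r + 2 + 1 + 1 = 3 * (r + 1) + 1 by ring, show 3 * r + 2 + 1 = 3 * (r + 1) by ring]
    abel

theorem padeForm_eq {R : Type*} [CommRing R] (r : ℕ) (ξ η : R) :
    padeForm r ξ η = ξ * padeNum r (ξ ^ 3) (η ^ 3) - η * padeNum r (η ^ 3) (ξ ^ 3) := by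
  rw [padeForm, sum_range_three_mul_add_two]
  have h2 : ∑ f ∈ Finset.range r, (-1) ^ (3 * f + 2) * ((3 * r + 1).choose (3 * f + 2) : R) *
      (padeWeight r (3 * f + 2 : ℕ) : R) * η ^ (3 * f + 2) * ξ ^ (3 * r + 1 - (3 * f + 2)) = 0 := by
    refine Finset.sum_eq_zero fun f hf => ?_
    rw [padeWeight_eq_zero r f (Finset.mem_range.1 hf)]
    simp
  have h0 : ∑ f ∈ Finset.range (r + 1), (-1) ^ (3 * f) * ((3 * r + 1).choose (3 * f) : R) *
      (padeWeight r (3 * f : ℕ) : R) * η ^ (3 * f) * ξ ^ (3 * r + 1 - 3 * f) =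
      ξ * padeNum r (ξ ^ 3) (η ^ 3) := by
    rw [padeNum, Finset.mul_sum]
    refine Finset.sum_congr rfl fun f hf => ?_
    have hf := Finset.mem_range.1 hf
    rw [show 3 * r + 1 - 3 * f = 3 * (r - f) + 1 by omega, pow_mul (-1 : R), pow_mul η,
      pow_succ ξ, pow_mul ξ, padeCoeff, (by norm_num : (-1 : R) ^ 3 = -1)]
    push_cast
    ring
  have h1 : ∑ f ∈ Finset.range (r + 1), (-1) ^ (3 * f + 1) *
      ((3 * r + 1).choose (3 * f + 1) : R) * (padeWeight r (3 * f + 1 : ℕ) : R) * η ^ (3 * f + 1) *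
      ξ ^ (3 * r + 1 - (3 * f + 1)) = - (η * padeNum r (η ^ 3) (ξ ^ 3)) := by
    rw [padeNum, Finset.mul_sum, ← Finset.sum_neg_distrib, ← Finset.sum_range_reflect]
    refine Finset.sum_congr rfl fun f hf => ?_
    have hf := Finset.mem_range.1 hf
    rw [show r + 1 - 1 - f = r - f by omega, padeCoeff]
    have e1 : (3 * r + 1).choose (3 * (r - f) + 1) = (3 * r + 1).choose (3 * f) := by
      rw [← Nat.choose_symm (by omega : 3 * f ≤ 3 * r + 1)]
      congr 1; omega
    have e2 : padeWeight r (3 * (r - f) + 1 : ℕ) = (-1) ^ r * padeWeight r (3 * f : ℕ) := by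
      rw [← padeWeight_reflect]
      congr 1
      push_cast [Nat.cast_sub (by omega : f ≤ r)]
      ring
    rw [e1, e2, show 3 * r + 1 - (3 * (r - f) + 1) = 3 * f by omega, pow_succ η, pow_mul η,
      pow_mul ξ, pow_succ (-1 : R), pow_mul (-1 : R), (by norm_num : (-1 : R) ^ 3 = -1)]
    have e3 : (-1 : R) ^ r = (-1) ^ (r - f) * (-1) ^ f := by
      rw [← pow_add]; congr 1; omega
    have e4 : (-1 : R) ^ (r - f) * (-1) ^ (r - f) = 1 := by
      rw [← mul_pow]; simp
    push_cast
    rw [e3]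
    linear_combination (-(-1 : R) ^ f * ((3 * r + 1).choose (3 * f) : R) *
      (padeWeight r (3 * (f : ℤ)) : R) * (η ^ 3) ^ (r - f) * η * (ξ ^ 3) ^ f) * e4
  rw [h0, h1, h2]
  ring

theorem sum_choose_mul_choose_mul_pow {R : Type*} [CommRing R] (n k : ℕ) (hk : k ≤ n) (x y : R) :
    ∑ e ∈ Finset.range (n + 1), (n.choose e : R) * (e.choose k : R) * y ^ e * x ^ (n - e) =
      n.choose k * y ^ k * (x + y) ^ (n - k) := by
  have h1 : ∑ e ∈ Finset.range (n + 1),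
      (n.choose e : R) * (e.choose k : R) * y ^ e * x ^ (n - e) =
      ∑ e ∈ Finset.Ico k (n + 1), (n.choose e : R) * (e.choose k : R) * y ^ e * x ^ (n - e) := by
    symm
    refine Finset.sum_subset (fun e he => ?_) fun e _ he => ?_
    · rw [Finset.mem_Ico] at he; rw [Finset.mem_range]; omega
    · have : e < k := by
        rw [Finset.mem_Ico] at he
        rw [Finset.mem_range] at *
        omega
      rw [Nat.choose_eq_zero_of_lt this]; simp
  rw [h1, Finset.sum_Ico_eq_sum_range, add_comm x y, add_pow, Finset.mul_sum,
    show n + 1 - k = n - k + 1 by omega]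
  refine Finset.sum_congr rfl fun e he => ?_
  have he := Finset.mem_range.1 he
  have h2 := Nat.choose_mul (n := n) (k := k + e) (s := k) (by omega)
  rw [show k + e - k = e by omega] at h2
  have h3 : (n.choose (k + e) : R) * ((k + e).choose k : R) = n.choose k * (n - k).choose e := by
    exact_mod_cast congrArg (Nat.cast : ℕ → R) h2
  rw [h3, show n - (k + e) = n - k - e by omega, pow_add]
  ring

theorem exists_padeForm_expansion (r : ℕ) : ∃ d : ℕ → ℤ, (∀ k ≤ r, |d k| ≤ 54 ^ r) ∧
    ∀ {R : Type} [CommRing R] (ξ η : R), padeForm r ξ η = ∑ k ∈ Finset.range (r + 1),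
      (d k : R) * ((3 * r + 1).choose k * (-η) ^ k * (ξ - η) ^ (3 * r + 1 - k)) := by
  obtain ⟨d, hd, h⟩ := exists_newton_coeff r
  refine ⟨d, hd, fun {R} _ ξ η => ?_⟩
  have h1 : ∀ k ∈ Finset.range (r + 1),
      (d k : R) * ((3 * r + 1).choose k * (-η) ^ k * (ξ - η) ^ (3 * r + 1 - k)) =
      ∑ e ∈ Finset.range (3 * r + 2), (d k : R) * (((3 * r + 1).choose e : R) * (e.choose k : R) *
        (-η) ^ e * ξ ^ (3 * r + 1 - e)) := by
    intro k hk
    have := Finset.mem_range.1 hk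
    rw [← Finset.mul_sum, sum_choose_mul_choose_mul_pow _ _ (by omega), ← sub_eq_add_neg]
  rw [Finset.sum_congr rfl h1, Finset.sum_comm, padeForm]
  refine Finset.sum_congr rfl fun e _ => ?_
  rw [h e, neg_pow η]
  push_cast
  rw [Finset.mul_sum, Finset.sum_mul, Finset.sum_mul]
  refine Finset.sum_congr rfl fun k _ => ?_
  ring

theorem succ_le_two_pow (r : ℕ) : r + 1 ≤ 2 ^ r := Nat.lt_two_pow_self

theorem norm_padeForm_le (r : ℕ) {ξ η : ℂ} {a ρ : ℝ} (hη : ‖η‖ ≤ a) (hρ : ‖ξ - η‖ ≤ ρ)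
    (hρa : ρ ≤ a) : ‖padeForm r ξ η‖ ≤ 2 * 864 ^ r * (a ^ r * ρ ^ (2 * r + 1)) := by
  obtain ⟨d, hd, h⟩ := exists_padeForm_expansion r
  have hρ0 : 0 ≤ ρ := (norm_nonneg _).trans hρ
  have ha0 : 0 ≤ a := (norm_nonneg _).trans hη
  rw [h]
  have ht : ∀ k ∈ Finset.range (r + 1),
      ‖(d k : ℂ) * ((3 * r + 1).choose k * (-η) ^ k * (ξ - η) ^ (3 * r + 1 - k))‖ ≤
        54 ^ r * (2 ^ (3 * r + 1) * (a ^ r * ρ ^ (2 * r + 1))) := by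
    intro k hk
    have hk := Finset.mem_range.1 hk
    rw [norm_mul, norm_mul, norm_mul, norm_pow, norm_pow, norm_neg, Complex.norm_intCast,
      Complex.norm_natCast]
    have h1 : |(d k : ℝ)| ≤ 54 ^ r := by exact_mod_cast hd k (by omega)
    have h2 : ((3 * r + 1).choose k : ℝ) ≤ 2 ^ (3 * r + 1) := by
      exact_mod_cast Nat.choose_le_two_pow _ _
    have h3 : ‖η‖ ^ k * ‖ξ - η‖ ^ (3 * r + 1 - k) ≤ a ^ r * ρ ^ (2 * r + 1) := by
      calc _ ≤ a ^ k * ρ ^ (3 * r + 1 - k) := by gcongr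
        _ = a ^ k * (ρ ^ (r - k) * ρ ^ (2 * r + 1)) := by
          rw [← pow_add, show r - k + (2 * r + 1) = 3 * r + 1 - k by omega]
        _ ≤ a ^ k * (a ^ (r - k) * ρ ^ (2 * r + 1)) := by gcongr
        _ = _ := by rw [← mul_assoc, ← pow_add, show k + (r - k) = r by omega]
    rw [mul_assoc ((3 * r + 1).choose k : ℝ)]
    gcongr
  refine (norm_sum_le _ _).trans ((Finset.sum_le_card_nsmul _ _ _ ht).trans ?_)
  rw [Finset.card_range, nsmul_eq_mul]
  have h4 : ((r + 1 : ℕ) : ℝ) ≤ 2 ^ r := by exact_mod_cast succ_le_two_pow r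
  calc _ ≤ 2 ^ r * (54 ^ r * (2 ^ (3 * r + 1) * (a ^ r * ρ ^ (2 * r + 1)))) := by gcongr
    _ = _ := by
      rw [show (864 : ℝ) = 2 * 54 * 2 ^ 3 by norm_num, mul_pow, mul_pow, pow_succ, pow_mul]
      ring

theorem abs_padeCoeff_le (r f : ℕ) (hf : f ≤ r) : |padeCoeff r f| ≤ 2 * 216 ^ r := by
  rw [padeCoeff, abs_mul, abs_mul, abs_pow, abs_neg, abs_one, one_pow, one_mul, Nat.abs_cast]
  have h1 : ((3 * r + 1).choose (3 * f) : ℤ) ≤ 2 ^ (3 * r + 1) := by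
    exact_mod_cast Nat.choose_le_two_pow _ _
  have h2 := abs_padeWeight_le r (3 * f : ℕ) (by positivity) (by push_cast; omega)
  calc _ ≤ (2 : ℤ) ^ (3 * r + 1) * 27 ^ r := by gcongr
    _ = _ := by
      rw [show (216 : ℤ) = 2 ^ 3 * 27 by norm_num, mul_pow, pow_succ, pow_mul]; ring

theorem norm_padeNum_le (r : ℕ) {X Y : ℂ} {Z : ℝ} (hX : ‖X‖ ≤ Z) (hY : ‖Y‖ ≤ Z) :
    ‖padeNum r X Y‖ ≤ 2 * 432 ^ r * Z ^ r := by
  have hZ : 0 ≤ Z := (norm_nonneg _).trans hX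
  have ht : ∀ f ∈ Finset.range (r + 1), ‖(padeCoeff r f : ℂ) * X ^ (r - f) * Y ^ f‖ ≤
      2 * 216 ^ r * Z ^ r := by
    intro f hf
    have hf := Finset.mem_range.1 hf
    rw [norm_mul, norm_mul, norm_pow, norm_pow, Complex.norm_intCast, mul_assoc]
    have h1 : |(padeCoeff r f : ℝ)| ≤ 2 * 216 ^ r := by
      exact_mod_cast abs_padeCoeff_le r f (by omega)
    have h2 : ‖X‖ ^ (r - f) * ‖Y‖ ^ f ≤ Z ^ r := by
      calc _ ≤ Z ^ (r - f) * Z ^ f := by gcongr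
        _ = _ := by rw [← pow_add, show r - f + f = r by omega]
    gcongr
  refine (norm_sum_le _ _).trans ((Finset.sum_le_card_nsmul _ _ _ ht).trans ?_)
  rw [Finset.card_range, nsmul_eq_mul]
  have h4 : ((r + 1 : ℕ) : ℝ) ≤ 2 ^ r := by exact_mod_cast succ_le_two_pow r
  calc _ ≤ 2 ^ r * (2 * 216 ^ r * Z ^ r) := by gcongr
    _ = _ := by
      rw [show (432 : ℝ) = 2 * 216 by norm_num, mul_pow]
      ring

theorem pow_dvd_of_pow_dvd_expand {n : ℕ} {Q : Polynomial ℂ} (hQ : Q ≠ 0)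
    (h : (Polynomial.X - Polynomial.C 1) ^ n ∣ Polynomial.expand ℂ 3 Q) :
    (Polynomial.X - Polynomial.C 1) ^ n ∣ Q := by
  obtain ⟨g, hg, hnd⟩ := Polynomial.exists_eq_pow_rootMultiplicity_mul_and_not_dvd Q hQ 1
  set m := Q.rootMultiplicity 1 with hm
  by_cases hnm : n ≤ m
  · rw [hg]
    exact (pow_dvd_pow _ hnm).mul_right _
  · exfalso
    have hne : (Polynomial.X - Polynomial.C (1 : ℂ)) ≠ 0 := Polynomial.X_sub_C_ne_zero 1
    have he : Polynomial.expand ℂ 3 Q = (Polynomial.X - Polynomial.C 1) ^ m *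
        ((Polynomial.X ^ 2 + Polynomial.X + 1) ^ m * Polynomial.expand ℂ 3 g) := by
      rw [hg, map_mul, map_pow, map_sub, Polynomial.expand_X, Polynomial.expand_C, ← mul_assoc,
        ← mul_pow]
      congr 2
      simp only [map_one]
      ring
    rw [he, show n = m + (n - m) by omega, pow_add] at h
    have h1 := (mul_dvd_mul_iff_left (pow_ne_zero m hne)).1 h
    have h2 : Polynomial.X - Polynomial.C (1 : ℂ) ∣
        (Polynomial.X ^ 2 + Polynomial.X + 1) ^ m * Polynomial.expand ℂ 3 g :=
      (dvd_pow_self _ (by omega)).trans h1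
    rw [Polynomial.dvd_iff_isRoot, Polynomial.IsRoot, Polynomial.eval_mul, Polynomial.expand_eval]
      at h2
    have h3 : (Polynomial.X ^ 2 + Polynomial.X + 1 : Polynomial ℂ).eval 1 = 3 := by
      simp; norm_num
    rw [Polynomial.eval_pow, h3, one_pow] at h2
    rw [Polynomial.dvd_iff_isRoot, Polynomial.IsRoot] at hnd
    rcases mul_eq_zero.1 h2 with h4 | h4
    · exact pow_ne_zero _ (by norm_num) h4
    · exact hnd h4

theorem map_padeNum {R S : Type*} [CommRing R] [CommRing S] (φ : R →+* S) (r : ℕ) (X Y : R) :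
    φ (padeNum r X Y) = padeNum r (φ X) (φ Y) := by
  simp [padeNum, map_sum]

theorem padeNum_eq_pow_mul (r : ℕ) {X Y : ℂ} (t : ℂ) :
    padeNum r (t * X) (t * Y) = t ^ r * padeNum r X Y := by
  rw [padeNum, padeNum, Finset.mul_sum]
  refine Finset.sum_congr rfl fun f hf => ?_
  have hf := Finset.mem_range.1 hf
  have : t ^ r = t ^ (r - f) * t ^ f := by rw [← pow_add]; congr 1; omega
  rw [this, mul_pow, mul_pow]
  ring

theorem natDegree_padeNum_le (r : ℕ) (X Y : Polynomial ℂ) (hX : X.natDegree ≤ 1)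
    (hY : Y.natDegree ≤ 1) : (padeNum r X Y).natDegree ≤ r := by
  refine Polynomial.natDegree_sum_le_of_forall_le _ _ fun f hf => ?_
  have hf := Finset.mem_range.1 hf
  refine Polynomial.natDegree_mul_le.trans ?_
  have h1 : ((padeCoeff r f : Polynomial ℂ) * X ^ (r - f)).natDegree ≤ r - f := by
    refine Polynomial.natDegree_mul_le.trans ?_
    rw [Polynomial.natDegree_intCast, zero_add]
    exact Polynomial.natDegree_pow_le.trans (by nlinarith)
  have h2 : (Y ^ f).natDegree ≤ f := Polynomial.natDegree_pow_le.trans (by nlinarith)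
  omega

theorem padeNum_one_zero (r : ℕ) : padeNum r (1 : ℂ) 0 = padeWeight r 0 := by
  rw [padeNum, Finset.sum_eq_single 0]
  · simp [padeCoeff]
  · intro f _ hf; simp [hf]
  · simp

theorem padeNum_zero_one (r : ℕ) : padeNum r (0 : ℂ) 1 = (3 * r + 1) * padeWeight r 1 := by
  rw [padeNum, Finset.sum_eq_single r]
  · have h1 : padeWeight r (3 * r : ℕ) = (-1) ^ r * padeWeight r 1 := by
      rw [← padeWeight_reflect]; congr 1; push_cast; ring
    rw [padeCoeff, h1]
    have : (3 * r + 1).choose (3 * r) = 3 * r + 1 := by simp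
    rw [this]
    push_cast
    have h2 : (-1 : ℂ) ^ r * (-1) ^ r = 1 := by rw [← mul_pow]; simp
    simp only [Nat.sub_self, pow_zero, one_pow, mul_one]
    linear_combination ((3 * r + 1 : ℂ) * padeWeight r 1) * h2
  · intro f hf hfr
    have hf := Finset.mem_range.1 hf
    rw [zero_pow (by omega)]; simp
  · simp

theorem padeNum_det_ne_zero (r : ℕ) {X Y : ℂ} (hX : X ≠ 0) (hXY : X ≠ Y) :
    padeNum r X Y * padeNum (r + 1) Y X - padeNum (r + 1) X Y * padeNum r Y X ≠ 0 := by
  let T : Polynomial ℂ := Polynomial.X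
  set Q : Polynomial ℂ :=
    padeNum r 1 T * padeNum (r + 1) T 1 - padeNum (r + 1) 1 T * padeNum r T 1 with hQ
  have heval : ∀ q : ℂ, Q.eval q =
      padeNum r 1 q * padeNum (r + 1) q 1 - padeNum (r + 1) 1 q * padeNum r q 1 := by
    intro q
    have h : ∀ n (A B : Polynomial ℂ), (padeNum n A B).eval q = padeNum n (A.eval q) (B.eval q) :=
      fun n A B => map_padeNum (Polynomial.evalRingHom q) n A B
    simp [hQ, h, T]
  have hQ0 : Q.eval 0 ≠ 0 := by
    rw [heval, padeNum_one_zero, padeNum_one_zero, padeNum_zero_one, padeNum_zero_one]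
    have h0 := succ_mul_padeWeight_succ r 0
    have h1 := succ_mul_padeWeight_succ r 1
    have h0' : ((r : ℂ) + 1) * padeWeight (r + 1) 0 = 3 * (0 - 2 - 3 * r) * padeWeight r 0 := by
      exact_mod_cast congrArg (Int.cast : ℤ → ℂ) h0
    have h1' : ((r : ℂ) + 1) * padeWeight (r + 1) 1 = 3 * (1 - 2 - 3 * r) * padeWeight r 1 := by
      exact_mod_cast congrArg (Int.cast : ℤ → ℂ) h1
    intro hz
    have hmul : (-6 * (3 * (r : ℂ) + 1)) * padeWeight r 0 * padeWeight r 1 = 0 := by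
      push_cast at hz
      linear_combination ((r : ℂ) + 1) * hz - (3 * (r + 1) + 1) * padeWeight r 0 * h1' +
        (3 * r + 1) * padeWeight r 1 * h0'
    have a0 : (padeWeight r 0 : ℂ) ≠ 0 := by exact_mod_cast padeWeight_ne_zero r 0 (Or.inl rfl)
    have a1 : (padeWeight r 1 : ℂ) ≠ 0 := by exact_mod_cast padeWeight_ne_zero r 1 (Or.inr rfl)
    have a2 : (3 * (r : ℂ) + 1) ≠ 0 := by exact_mod_cast Nat.succ_ne_zero (3 * r)
    simp_all
  have hQne : Q ≠ 0 := fun h => hQ0 (by rw [h]; simp)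
  have hform : ∀ n, 2 * r + 1 ≤ 2 * n + 1 →
      (Polynomial.X - Polynomial.C (1 : ℂ)) ^ (2 * r + 1) ∣ padeForm n 1 T := by
    intro n hn
    obtain ⟨d, _, h⟩ := exists_padeForm_expansion n
    rw [h]
    refine Finset.dvd_sum fun k hk => ?_
    have hk := Finset.mem_range.1 hk
    refine Dvd.dvd.mul_left (Dvd.dvd.mul_left ?_ _) _
    have : (1 - T) = - (Polynomial.X - Polynomial.C (1 : ℂ)) := by simp [T]
    rw [this, neg_pow]
    exact Dvd.dvd.mul_left (pow_dvd_pow _ (by omega)) _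
  have hexp : Polynomial.expand ℂ 3 Q = padeForm (r + 1) 1 T * padeNum r (T ^ 3) 1 -
      padeForm r 1 T * padeNum (r + 1) (T ^ 3) 1 + 2 * (padeForm r 1 T * padeNum (r + 1) (T ^ 3) 1 -
        padeForm (r + 1) 1 T * padeNum r (T ^ 3) 1) := by
    have h : ∀ n (A B : Polynomial ℂ), Polynomial.expand ℂ 3 (padeNum n A B) =
        padeNum n (Polynomial.expand ℂ 3 A) (Polynomial.expand ℂ 3 B) :=
      fun n A B => map_padeNum (Polynomial.expand ℂ 3).toRingHom n A B
    rw [hQ]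
    simp only [map_sub, map_mul, h, padeForm_eq, map_one, T, Polynomial.expand_X, one_pow]
    ring
  have hdvd : (Polynomial.X - Polynomial.C 1) ^ (2 * r + 1) ∣ Q := by
    refine pow_dvd_of_pow_dvd_expand hQne ?_
    rw [hexp]
    have d1 := hform r le_rfl
    have d2 := hform (r + 1) (by omega)
    exact dvd_add (dvd_sub (d2.mul_right _) (d1.mul_right _))
      (Dvd.dvd.mul_left (dvd_sub (d1.mul_right _) (d2.mul_right _)) _)
  obtain ⟨g, hg⟩ := hdvd
  have hg0 : g ≠ 0 := fun h => hQne (by rw [hg, h, mul_zero])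
  have hT : T.natDegree ≤ 1 := by simp [T]
  have h1 : (1 : Polynomial ℂ).natDegree ≤ 1 := by simp
  have hdeg : Q.natDegree ≤ 2 * r + 1 := by
    refine (Polynomial.natDegree_sub_le _ _).trans (max_le ?_ ?_)
    · refine Polynomial.natDegree_mul_le.trans ?_
      have a := natDegree_padeNum_le r 1 T h1 hT
      have b := natDegree_padeNum_le (r + 1) T 1 hT h1
      omega
    · refine Polynomial.natDegree_mul_le.trans ?_
      have a := natDegree_padeNum_le (r + 1) 1 T h1 hT
      have b := natDegree_padeNum_le r T 1 hT h1
      omega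
  have hmon : ((Polynomial.X - Polynomial.C (1 : ℂ)) ^ (2 * r + 1)).natDegree = 2 * r + 1 := by
    rw [Polynomial.natDegree_pow, Polynomial.natDegree_X_sub_C, mul_one]
  rw [hg, Polynomial.natDegree_mul (pow_ne_zero _ (Polynomial.X_sub_C_ne_zero 1)) hg0, hmon]
    at hdeg
  obtain ⟨c, hc⟩ := Polynomial.natDegree_eq_zero.1 (by omega : g.natDegree = 0)
  have hc0 : c ≠ 0 := fun h => hg0 (by rw [← hc, h, map_zero])
  have hq : ∀ q, q ≠ 1 → Q.eval q ≠ 0 := by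
    intro q hq
    rw [hg, ← hc]
    simp [hc0, sub_ne_zero.2 hq]
  have key := hq (Y / X) (fun h => hXY ((div_eq_one_iff_eq hX).1 h).symm)
  rw [heval] at key
  intro hz
  apply key
  have e1 : ∀ n, padeNum n X Y = X ^ n * padeNum n 1 (Y / X) := fun n => by
    rw [← padeNum_eq_pow_mul, mul_one, mul_div_cancel₀ _ hX]
  have e2 : ∀ n, padeNum n Y X = X ^ n * padeNum n (Y / X) 1 := fun n => by
    rw [← padeNum_eq_pow_mul, mul_one, mul_div_cancel₀ _ hX]
  rw [e1, e1, e2, e2] at hz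
  have : X ^ r * X ^ (r + 1) * (padeNum r 1 (Y / X) * padeNum (r + 1) (Y / X) 1 -
      padeNum (r + 1) 1 (Y / X) * padeNum r (Y / X) 1) = 0 := by
    linear_combination hz
  exact (mul_eq_zero.1 this).resolve_left (mul_ne_zero (pow_ne_zero _ hX) (pow_ne_zero _ hX))

/-- Two values of the resolvent pair of cubic forms `ξ`, `η` attached to a binary cubic form of
discriminant `D`, both taken at points close to the same root of the form. -/
structure ResolventPair where
  (ξ η ξ' η' δ : ℂ)
  (G H D k m : ℤ)
  (a b : ℝ)
  mul_eq : ξ * η = H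
  sub_eq : ξ ^ 3 - η ^ 3 = 3 * δ
  add_eq : ξ ^ 3 + η ^ 3 = G
  sub_eq' : ξ' ^ 3 - η' ^ 3 = 3 * δ
  sq_eq : δ ^ 2 = -3 * D
  polar_sub : ξ * η' - η * ξ' = -(δ * k)
  polar_add : ξ * η' + η * ξ' = m
  disc_ne : D ≠ 0
  k_ne : k ≠ 0
  le_a : 10 ^ 40 * |(D : ℝ)| ^ 5 ≤ a
  a_le : a ≤ b
  norm_ξ : ‖ξ‖ ≤ 2 * a
  norm_η : ‖η‖ ≤ 2 * a
  norm_ξ' : ‖ξ'‖ ≤ 2 * b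
  norm_η' : ‖η'‖ ≤ 2 * b
  near : ‖ξ - η‖ ≤ 4 * ‖δ‖ / a ^ 2
  near' : ‖ξ' - η'‖ ≤ 4 * ‖δ‖ / b ^ 2
  le_G : a ^ 3 / 2 ≤ |(G : ℝ)|

namespace ResolventPair

variable (P : ResolventPair)

theorem one_le_abs_D : 1 ≤ |(P.D : ℝ)| := by
  exact_mod_cast Int.one_le_abs P.disc_ne

theorem big_le_a : 10 ^ 40 ≤ P.a := by
  refine le_trans ?_ P.le_a
  nlinarith [one_le_pow₀ P.one_le_abs_D (n := 5)]

theorem big_mul_le_a : 10 ^ 40 * |(P.D : ℝ)| ≤ P.a := by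
  refine le_trans ?_ P.le_a
  have := P.one_le_abs_D
  have h : |(P.D : ℝ)| ≤ |(P.D : ℝ)| ^ 5 := le_self_pow₀ this (by norm_num)
  linarith

theorem big_mul_sq_le_a : 10 ^ 40 * |(P.D : ℝ)| ^ 2 ≤ P.a := by
  refine le_trans ?_ P.le_a
  have := P.one_le_abs_D
  have h : |(P.D : ℝ)| ^ 2 ≤ |(P.D : ℝ)| ^ 5 := pow_le_pow_right₀ this (by norm_num)
  linarith

theorem a_pos : 0 < P.a := lt_of_lt_of_le (by norm_num) P.big_le_a

theorem b_pos : 0 < P.b := P.a_pos.trans_le P.a_le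

theorem norm_δ_sq : ‖P.δ‖ ^ 2 = 3 * |(P.D : ℝ)| := by
  rw [← norm_pow, P.sq_eq, norm_mul, Complex.norm_intCast]
  norm_num

theorem δ_ne : P.δ ≠ 0 := by
  intro h
  have := P.norm_δ_sq
  rw [h] at this
  simp [P.disc_ne] at this

theorem norm_δ_pos : 0 < ‖P.δ‖ := norm_pos_iff.2 P.δ_ne

theorem two_mul_cube : 2 * P.ξ ^ 3 = P.G + 3 * P.δ := by
  linear_combination P.add_eq + P.sub_eq

theorem two_mul_cube' : 2 * P.η ^ 3 = P.G - 3 * P.δ := by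
  linear_combination P.add_eq - P.sub_eq

theorem four_mul_H_cube : 4 * P.H ^ 3 = P.G ^ 2 + 27 * P.D := by
  have h : (4 * P.H ^ 3 : ℂ) = P.G ^ 2 + 27 * P.D := by
    rw [← P.mul_eq]
    linear_combination 2 * P.η ^ 3 * P.two_mul_cube + (P.G + 3 * P.δ) * P.two_mul_cube' -
      9 * P.sq_eq
  exact_mod_cast h

theorem norm_small_le : ‖P.δ‖ ≤ P.a := by
  have h1 := P.norm_δ_sq
  have h2 := P.big_mul_le_a
  have h3 := P.a_pos
  have h4 := P.big_le_a
  have h5 := P.norm_δ_pos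
  by_contra! h
  nlinarith

theorem norm_near_le : 4 * ‖P.δ‖ / P.a ^ 2 ≤ 2 * P.a := by
  have h3 := P.a_pos
  have h4 := P.big_le_a
  rw [div_le_iff₀ (by positivity)]
  have := P.norm_small_le
  have : P.a ≤ P.a ^ 3 := le_self_pow₀ (by linarith) (by norm_num)
  nlinarith

/-- The polarised Padé approximation. -/
noncomputable def padeDet (r : ℕ) : ℂ :=
  P.ξ * P.η' * padeNum r (P.ξ ^ 3) (P.η ^ 3) - P.η * P.ξ' * padeNum r (P.η ^ 3) (P.ξ ^ 3)

theorem exists_two_pow_mul_padeDet (r : ℕ) :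
    ∃ n : ℤ, 2 ^ r * P.padeDet r = P.δ * n := by
  let φ : ℤ√(-3 * P.D) →+* ℂ := Zsqrtd.lift ⟨P.δ, by rw [← sq, P.sq_eq]; push_cast; ring⟩
  have hφ : ∀ z, φ z = z.re + z.im * P.δ := fun z => rfl
  let g : ℤ√(-3 * P.D) := ⟨P.G, 3⟩
  have hg : φ g = 2 * P.ξ ^ 3 := by rw [hφ, P.two_mul_cube]; simp [g]
  have hg' : φ (star g) = 2 * P.η ^ 3 := by
    rw [hφ, P.two_mul_cube']; simp [g]; ring
  set A := padeNum r g (star g) with hA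
  have h1 : padeNum r (star g) g = star A := by
    have := map_padeNum (starRingEnd (ℤ√(-3 * P.D))) r g (star g)
    simp only [starRingEnd_apply, star_star] at this
    rw [hA, this]
  have h2 : 2 ^ r * padeNum r (P.ξ ^ 3) (P.η ^ 3) = A.re + A.im * P.δ := by
    rw [← padeNum_eq_pow_mul, ← hg, ← hg', ← map_padeNum, ← hφ]
  have h3 : 2 ^ r * padeNum r (P.η ^ 3) (P.ξ ^ 3) = A.re - A.im * P.δ := by
    rw [← padeNum_eq_pow_mul, ← hg, ← hg', ← map_padeNum, h1, hφ]
    simp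
    ring
  refine ⟨P.m * A.im - P.k * A.re, ?_⟩
  rw [padeDet]
  push_cast
  linear_combination P.ξ * P.η' * h2 - P.η * P.ξ' * h3 + A.re * P.polar_sub +
    P.δ * A.im * P.polar_add

theorem norm_δ_le_of_padeDet_ne_zero {r : ℕ} (h : P.padeDet r ≠ 0) :
    ‖P.δ‖ ≤ 2 ^ r * ‖P.padeDet r‖ := by
  obtain ⟨n, hn⟩ := P.exists_two_pow_mul_padeDet r
  have h1 : n ≠ 0 := by
    rintro rfl
    simp [h] at hn
  have h2 : (1 : ℝ) ≤ |(n : ℝ)| := by exact_mod_cast Int.one_le_abs h1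
  have h3 := congrArg norm hn
  rw [norm_mul, norm_mul, norm_pow, Complex.norm_intCast, Complex.norm_ofNat] at h3
  rw [h3]
  nlinarith [norm_nonneg P.δ]

theorem norm_padeDet_le (r : ℕ) : 2 ^ r * ‖P.padeDet r‖ ≤
    ‖P.δ‖ * (16 * 55296 ^ r * (P.b * ‖P.δ‖ ^ (2 * r) / P.a ^ (3 * r + 2)) +
      16 * 6912 ^ r * (P.a ^ (3 * r + 1) / P.b ^ 2)) := by
  have ha := P.a_pos
  have hb := P.b_pos
  have h1 : P.padeDet r = P.η' * padeForm r P.ξ P.η +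
      P.η * padeNum r (P.η ^ 3) (P.ξ ^ 3) * (P.η' - P.ξ') := by
    rw [padeForm_eq, padeDet]; ring
  have h2 := norm_padeForm_le r P.norm_η P.near P.norm_near_le
  have hc : ∀ z : ℂ, ‖z‖ ≤ 2 * P.a → ‖z ^ 3‖ ≤ 8 * P.a ^ 3 := fun z hz => by
    rw [norm_pow]
    calc _ ≤ (2 * P.a) ^ 3 := by gcongr
      _ = _ := by ring
  have h3 := norm_padeNum_le r (hc _ P.norm_η) (hc _ P.norm_ξ)
  have h4 : ‖P.η' - P.ξ'‖ ≤ 4 * ‖P.δ‖ / P.b ^ 2 := by rw [norm_sub_rev]; exact P.near'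
  calc 2 ^ r * ‖P.padeDet r‖ ≤ 2 ^ r * ((2 * P.b) * (2 * 864 ^ r * ((2 * P.a) ^ r *
        (4 * ‖P.δ‖ / P.a ^ 2) ^ (2 * r + 1))) +
        2 * P.a * (2 * 432 ^ r * (8 * P.a ^ 3) ^ r) * (4 * ‖P.δ‖ / P.b ^ 2)) := by
        rw [h1]
        refine mul_le_mul_of_nonneg_left ((norm_add_le _ _).trans ?_) (by positivity)
        rw [norm_mul, norm_mul, norm_mul]
        have := P.norm_η
        have := P.norm_η'
        gcongr
    _ = _ := by
      rw [show (55296 : ℝ) = 2 * 864 * 2 * 4 ^ 2 by norm_num,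
        show (6912 : ℝ) = 2 * 432 * 8 by norm_num, div_pow]
      simp only [mul_pow, ← pow_mul]
      have e : P.a ^ (2 * (2 * r + 1)) = P.a ^ (3 * r + 2) * P.a ^ r := by
        rw [← pow_add]; congr 1; ring
      rw [e]
      field_simp
      ring

theorem padeDet_eq_zero {r : ℕ} (hr : 1 ≤ r) (h1 : P.a ^ (16 * r + 5) ≤ P.b ^ 10)
    (h2 : P.b ^ 2 ≤ P.a ^ (5 * r + 4)) : P.padeDet r = 0 := by
  by_contra h
  have ha := P.a_pos
  have hb := P.b_pos
  have hδ := P.norm_δ_pos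
  have h3 := (P.norm_δ_le_of_padeDet_ne_zero h).trans (P.norm_padeDet_le r)
  rw [le_mul_iff_one_le_right hδ] at h3
  have hpow : ∀ c : ℝ, 0 ≤ c → 16 * c ^ r ≤ (16 * c) ^ r := fun c hc => by
    rw [mul_pow]
    have : (16 : ℝ) ≤ 16 ^ r := le_self_pow₀ (by norm_num) (by omega)
    gcongr
  set s := 16 * 55296 ^ r * (P.b * ‖P.δ‖ ^ (2 * r) / P.a ^ (3 * r + 2)) with hs
  set t := 16 * 6912 ^ r * (P.a ^ (3 * r + 1) / P.b ^ 2) with ht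
  have hs0 : 0 ≤ s := by positivity
  have ht0 : 0 ≤ t := by positivity
  have hs2 : s ^ 2 ≤ (10 ^ 13 * |(P.D : ℝ)| ^ 2 / P.a) ^ r := by
    have e : ‖P.δ‖ ^ (2 * r) = (3 * |(P.D : ℝ)|) ^ r := by rw [pow_mul, P.norm_δ_sq]
    calc s ^ 2 ≤ ((16 * 55296) ^ r * (P.b * ‖P.δ‖ ^ (2 * r) / P.a ^ (3 * r + 2))) ^ 2 := by
          rw [hs]; gcongr; exact hpow _ (by norm_num)
      _ = ((16 * 55296) ^ 2 * (3 * |(P.D : ℝ)|) ^ 2) ^ r * (P.b ^ 2 / P.a ^ (6 * r + 4)) := by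
          rw [e, show 6 * r + 4 = (3 * r + 2) * 2 by ring, pow_mul P.a]
          simp only [mul_pow, div_pow, ← pow_mul, mul_comm 2 r]
          ring
      _ ≤ ((16 * 55296) ^ 2 * (3 * |(P.D : ℝ)|) ^ 2) ^ r *
          (P.a ^ (5 * r + 4) / P.a ^ (6 * r + 4)) := by gcongr
      _ = ((16 * 55296) ^ 2 * (3 * |(P.D : ℝ)|) ^ 2 / P.a) ^ r := by
          rw [div_pow, show 6 * r + 4 = 5 * r + 4 + r by ring, pow_add P.a (5 * r + 4)]
          field_simp
      _ ≤ _ := by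
          gcongr ?_ ^ _
          gcongr ?_ / _
          nlinarith [sq_nonneg |(P.D : ℝ)|]
  have ht5 : t ^ 5 ≤ (10 ^ 30 / P.a) ^ r := by
    calc t ^ 5 ≤ ((16 * 6912) ^ r * (P.a ^ (3 * r + 1) / P.b ^ 2)) ^ 5 := by
          rw [ht]; gcongr; exact hpow _ (by norm_num)
      _ = ((16 * 6912) ^ 5) ^ r * (P.a ^ (15 * r + 5) / P.b ^ 10) := by
          rw [mul_pow, div_pow, ← pow_mul P.a, ← pow_mul P.b, pow_right_comm]
          congr 3
          ring
      _ ≤ ((16 * 6912) ^ 5) ^ r * (P.a ^ (15 * r + 5) / P.a ^ (16 * r + 5)) := by gcongr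
      _ = ((16 * 6912) ^ 5 / P.a) ^ r := by
          rw [div_pow, show 16 * r + 5 = 15 * r + 5 + r by ring, pow_add P.a (15 * r + 5)]
          field_simp
      _ ≤ _ := by
          gcongr ?_ ^ _
          gcongr ?_ / _
          norm_num
  have hpow1 : ∀ c : ℝ, 0 ≤ c → c ≤ 1 / 10 ^ 5 → c ^ r ≤ 1 / 10 ^ 5 := fun c h0 h1 =>
    (pow_le_of_le_one h0 (h1.trans (by norm_num)) (by omega)).trans h1
  have hs3 : s ^ 2 ≤ 1 / 10 ^ 5 := hs2.trans (hpow1 _ (by positivity) (by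
    rw [div_le_iff₀ ha]
    nlinarith [P.big_mul_sq_le_a, sq_nonneg |(P.D : ℝ)|]))
  have ht3 : t ^ 5 ≤ 1 / 10 ^ 5 := ht5.trans (hpow1 _ (by positivity) (by
    rw [div_le_iff₀ ha]
    nlinarith [P.big_le_a]))
  have hs4 : s ≤ 1 / 10 := by
    by_contra! hh
    nlinarith
  have ht4 : t ≤ 1 / 10 := by
    refine le_of_pow_le_pow_left₀ (n := 5) (by norm_num) (by norm_num) (ht3.trans ?_)
    norm_num
  linarith

theorem G_sq_gt : 10 ^ 20 * |(P.D : ℝ)| < |(P.G : ℝ)| := by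
  have h1 := P.le_G
  have h2 := P.big_mul_le_a
  have h3 := P.big_le_a
  have h4 := P.one_le_abs_D
  have h5 : P.a ≤ P.a ^ 3 := le_self_pow₀ (by linarith) (by norm_num)
  linarith

theorem ξ_ne : P.ξ ≠ 0 := by
  intro h
  have h1 := P.mul_eq
  rw [h, zero_mul] at h1
  have h2 : P.H = 0 := by exact_mod_cast h1.symm
  have h3 := P.four_mul_H_cube
  rw [h2] at h3
  have h4 : (P.G : ℝ) ^ 2 = -27 * P.D := by
    have : (P.G) ^ 2 = -27 * P.D := by linarith
    exact_mod_cast this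
  have h5 := P.G_sq_gt
  have h6 := P.one_le_abs_D
  have h7 := neg_abs_le (P.D : ℝ)
  rw [← sq_abs] at h4
  nlinarith

theorem η'_ne : P.η' ≠ 0 := by
  intro h
  have h1 := P.sub_eq'
  have h2 := P.near'
  rw [h, sub_zero] at h2
  have h3 : ‖P.ξ'‖ ^ 3 = 3 * ‖P.δ‖ := by
    rw [h] at h1
    have := congrArg norm h1
    simpa using this
  have hb := P.b_pos
  have h4 := P.big_le_a.trans P.a_le
  have h5 : ‖P.ξ'‖ ≤ 1 := by
    refine h2.trans ?_
    rw [div_le_one (by positivity)]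
    have := P.norm_small_le.trans P.a_le
    nlinarith
  have h6 : (1 : ℝ) ≤ ‖P.δ‖ := by
    have := P.norm_δ_sq
    have := P.one_le_abs_D
    have := P.norm_δ_pos
    by_contra! h
    nlinarith
  have h7 : ‖P.ξ'‖ ^ 3 ≤ 1 := pow_le_one₀ (norm_nonneg _) h5
  linarith

theorem ξ_cube_ne : P.ξ ^ 3 ≠ P.η ^ 3 := by
  rw [← sub_ne_zero, P.sub_eq]
  exact mul_ne_zero (by norm_num) P.δ_ne

theorem not_consecutive {r : ℕ} (h1 : P.padeDet r = 0) (h2 : P.padeDet (r + 1) = 0) : False := by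
  refine padeNum_det_ne_zero r (pow_ne_zero 3 P.ξ_ne) P.ξ_cube_ne ?_
  refine (mul_eq_zero.1 ?_).resolve_left (mul_ne_zero P.ξ_ne P.η'_ne)
  rw [padeDet] at h1 h2
  linear_combination padeNum (r + 1) (P.η ^ 3) (P.ξ ^ 3) * h1 - padeNum r (P.η ^ 3) (P.ξ ^ 3) * h2

theorem b_lt_a_pow_seven : P.b < P.a ^ 7 := by
  by_contra! hb
  have ha := P.a_pos
  have ha1 : 1 < P.a := lt_of_lt_of_le (by norm_num) P.big_le_a
  have hex : ∃ r : ℕ, P.b ^ 10 < P.a ^ (16 * (r + 4) + 21) := by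
    obtain ⟨n, hn⟩ := pow_unbounded_of_one_lt (P.b ^ 10) ha1
    exact ⟨n, hn.trans_le (pow_le_pow_right₀ ha1.le (by omega))⟩
  classical
  obtain ⟨r, hr, hmin⟩ : ∃ r : ℕ, P.b ^ 10 < P.a ^ (16 * (r + 4) + 21) ∧
      ∀ s < r, ¬ P.b ^ 10 < P.a ^ (16 * (s + 4) + 21) :=
    ⟨Nat.find hex, Nat.find_spec hex, fun s hs => Nat.find_min hex hs⟩
  have hlow : P.a ^ (16 * (r + 4) + 5) ≤ P.b ^ 10 := by
    rcases r with _ | r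
    · calc _ ≤ P.a ^ 70 := pow_le_pow_right₀ ha1.le (by norm_num)
        _ = (P.a ^ 7) ^ 10 := by rw [← pow_mul]
        _ ≤ _ := by gcongr
    · exact le_of_not_gt (hmin r (by omega))
  have hup : P.b ^ 2 ≤ P.a ^ (5 * (r + 3) + 4) := by
    refine le_of_pow_le_pow_left₀ (n := 5) (by norm_num) (by positivity) ?_
    rw [← pow_mul, ← pow_mul]
    exact hr.le.trans (pow_le_pow_right₀ ha1.le (by omega))
  refine P.not_consecutive (r := r + 3) (P.padeDet_eq_zero (by omega) ?_ hup)
    (P.padeDet_eq_zero (by omega) hlow ?_)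
  · exact (pow_le_pow_right₀ ha1.le (by omega)).trans hlow
  · exact hup.trans (pow_le_pow_right₀ ha1.le (by omega))

theorem covariant_identity :
    P.m ^ 3 + P.G * P.m ^ 2 * P.k - 9 * P.m * P.k ^ 2 * P.D - P.G * P.k ^ 3 * P.D =
      2 * P.G ^ 2 + 54 * P.D := by
  have e1 : 2 * (P.ξ * P.η') = P.m - P.δ * P.k := by
    linear_combination P.polar_add + P.polar_sub
  have e2 : 2 * (P.η * P.ξ') = P.m + P.δ * P.k := by
    linear_combination P.polar_add - P.polar_sub
  have e3 : (8 * P.H ^ 3 * (3 * P.δ) : ℂ) = P.ξ ^ 3 * (P.m + P.δ * P.k) ^ 3 -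
      P.η ^ 3 * (P.m - P.δ * P.k) ^ 3 := by
    rw [← e1, ← e2, ← P.sub_eq', ← P.mul_eq]
    ring
  have e4 : (6 * P.δ : ℂ) * (P.m ^ 3 + P.G * P.m ^ 2 * P.k - 9 * P.m * P.k ^ 2 * P.D -
      P.G * P.k ^ 3 * P.D - 8 * P.H ^ 3) = 0 := by
    linear_combination (-2) * e3 - 2 * P.δ * (P.G * P.k ^ 3 + 9 * P.m * P.k ^ 2) * P.sq_eq -
      (P.m + P.δ * P.k) ^ 3 * P.two_mul_cube + (P.m - P.δ * P.k) ^ 3 * P.two_mul_cube'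
  have e5 := (mul_eq_zero.1 e4).resolve_left (mul_ne_zero (by norm_num) P.δ_ne)
  have e6 : P.m ^ 3 + P.G * P.m ^ 2 * P.k - 9 * P.m * P.k ^ 2 * P.D -
      P.G * P.k ^ 3 * P.D - 8 * P.H ^ 3 = 0 := by exact_mod_cast e5
  linarith [P.four_mul_H_cube]

theorem padeNum_two (X Y : ℂ) :
    padeNum 2 X Y = 9 * (5 * X ^ 2 + 35 * X * Y + 14 * Y ^ 2) := by
  have h : ∀ e : ℤ, 2 * padeWeight 2 e = 9 * ((e - 2) * (e - 5)) := fun e => by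
    have := factorial_mul_padeWeight 2 e
    simp [Finset.prod_range_succ, Nat.factorial] at this
    rw [this]; ring
  have h0 : padeWeight 2 0 = 45 := by linarith [h 0]
  have h3 : padeWeight 2 3 = -9 := by linarith [h 3]
  have h6 : padeWeight 2 6 = 18 := by linarith [h 6]
  have : Nat.choose 7 3 = 35 := by decide
  simp [padeNum, padeCoeff, Finset.sum_range_succ, h0, h3, h6, this]
  ring

theorem padeDet_two_ne_zero : P.padeDet 2 ≠ 0 := by
  intro h
  rw [padeDet, padeNum_two, padeNum_two] at h
  have hG := P.G_sq_gt
  have hD1 := P.one_le_abs_D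
  have e1 : 2 * (P.ξ * P.η') = P.m - P.δ * P.k := by
    linear_combination P.polar_add + P.polar_sub
  have e2 : 2 * (P.η * P.ξ') = P.m + P.δ * P.k := by
    linear_combination P.polar_add - P.polar_sub
  have hX : P.ξ ^ 3 = (P.G + 3 * P.δ) / 2 := by linear_combination P.two_mul_cube / 2
  have hY : P.η ^ 3 = (P.G - 3 * P.δ) / 2 := by linear_combination P.two_mul_cube' / 2
  rw [hX, hY, show P.ξ * P.η' = (P.m - P.δ * P.k) / 2 by linear_combination e1 / 2,
    show P.η * P.ξ' = (P.m + P.δ * P.k) / 2 by linear_combination e2 / 2] at h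
  have h1 : (P.δ : ℂ) * (P.m * P.G + P.k * (P.G ^ 2 + 8 * P.D)) = 0 := by
    linear_combination (-2 / 243) * h + 8 / 3 * P.δ * P.k * P.sq_eq
  have h2 := (mul_eq_zero.1 h1).resolve_left P.δ_ne
  have h3 : P.m * P.G + P.k * (P.G ^ 2 + 8 * P.D) = 0 := by exact_mod_cast h2
  have h4 : P.G ^ 3 * (P.G ^ 2 + 27 * P.D) =
      -4 * P.k ^ 3 * P.D ^ 2 * (7 * P.G ^ 2 + 64 * P.D) := by
    have h := P.covariant_identity
    have h4 : 2 * (P.G ^ 3 * (P.G ^ 2 + 27 * P.D)) =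
        2 * (-4 * P.k ^ 3 * P.D ^ 2 * (7 * P.G ^ 2 + 64 * P.D)) := by
      set u := P.m * P.G with hu
      set v := -(P.k * (P.G ^ 2 + 8 * P.D)) with hv
      linear_combination (-P.G ^ 3) * h + (u ^ 2 + u * v + v ^ 2 + P.G ^ 2 * P.k * (u + v) -
        9 * P.G ^ 2 * P.k ^ 2 * P.D) * h3
    linarith
  have h5 : 7 * P.G ^ 2 + 64 * P.D ∣ 8000 * P.G * P.D ^ 2 := by
    refine ⟨196 * P.k ^ 3 * P.D ^ 2 + 7 * P.G ^ 3 + 125 * P.D * P.G, ?_⟩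
    linear_combination -49 * h4
  have hG0 : P.G ≠ 0 := by
    intro h0
    rw [h0] at hG
    simp at hG
    linarith
  have h6 := Int.le_of_dvd (abs_pos.2 (mul_ne_zero (mul_ne_zero (by norm_num) hG0)
    (pow_ne_zero 2 P.disc_ne))) ((dvd_abs _ _).2 h5)
  have h7 : 7 * |(P.G : ℝ)| ^ 2 - 64 * |(P.D : ℝ)| ≤ 8000 * |(P.G : ℝ)| * |(P.D : ℝ)| ^ 2 := by
    have : ((7 * P.G ^ 2 + 64 * P.D : ℤ) : ℝ) ≤ (|8000 * P.G * P.D ^ 2| : ℤ) := by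
      exact_mod_cast h6
    push_cast at this
    rw [abs_mul, abs_mul, abs_pow] at this
    rw [sq_abs]
    have h8 := neg_abs_le (P.D : ℝ)
    norm_num at this ⊢
    linarith
  have h8 : 10 ^ 20 * |(P.D : ℝ)| ^ 2 ≤ |(P.G : ℝ)| := by
    have h1 := P.le_G
    have h2 := P.big_mul_sq_le_a
    have h3 := P.big_le_a
    have h5 : P.a ≤ P.a ^ 3 := le_self_pow₀ (by linarith) (by norm_num)
    linarith
  nlinarith

end ResolventPair

namespace ResolventPair

variable (P : ResolventPair)

theorem abs_k_le : |(P.k : ℝ)| ≤ 8 * P.a / P.b ^ 2 + 8 * P.b / P.a ^ 2 := by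
  have ha := P.a_pos
  have hb := P.b_pos
  have h1 : P.δ * P.k = P.ξ * (P.ξ' - P.η') - P.ξ' * (P.ξ - P.η) := by
    linear_combination P.polar_sub
  have h2 : ‖P.δ‖ * |(P.k : ℝ)| ≤ 2 * P.a * (4 * ‖P.δ‖ / P.b ^ 2) +
      2 * P.b * (4 * ‖P.δ‖ / P.a ^ 2) := by
    rw [← Complex.norm_intCast, ← norm_mul, h1]
    refine (norm_sub_le _ _).trans ?_
    rw [norm_mul, norm_mul]
    have := P.norm_ξ
    have := P.norm_ξ'
    have := P.near
    have := P.near'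
    gcongr
  refine le_of_mul_le_mul_left (h2.trans (le_of_eq ?_)) P.norm_δ_pos
  ring

theorem one_le_abs_k : 1 ≤ |(P.k : ℝ)| := by
  exact_mod_cast Int.one_le_abs P.k_ne

theorem eight_mul_a_div_le : 8 * P.a / P.b ^ 2 ≤ 1 / 9 := by
  have ha := P.a_pos
  have hb := P.b_pos
  rw [div_le_div_iff₀ (by positivity) (by norm_num)]
  nlinarith [P.a_le, P.big_le_a]

theorem a_sq_le : P.a ^ 2 ≤ 9 * P.b := by
  have h1 := P.one_le_abs_k.trans P.abs_k_le
  have h2 := P.eight_mul_a_div_le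
  have ha := P.a_pos
  have h3 : 8 / 9 ≤ 8 * P.b / P.a ^ 2 := by linarith
  rw [div_le_div_iff₀ (by norm_num) (by positivity)] at h3
  linarith

/-- The integer measuring the first Padé approximation. -/
def firstPade : ℤ := P.m + P.k * P.G

theorem abs_firstPade_le : |(P.firstPade : ℝ)| ≤
    342 * (P.b * ‖P.δ‖ ^ 2 / P.a ^ 5) + 128 * (P.a ^ 4 / P.b ^ 2) := by
  have ha := P.a_pos
  have hb := P.b_pos
  have h1 : (3 / 2) * (P.δ * P.firstPade) = -(P.η' * ((P.ξ - P.η) ^ 3 * (P.ξ + P.η)) +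
      P.η * (P.η ^ 3 + 2 * P.ξ ^ 3) * (P.η' - P.ξ')) := by
    have hX : P.ξ ^ 3 = (P.G + 3 * P.δ) / 2 := by linear_combination P.two_mul_cube / 2
    have hY : P.η ^ 3 = (P.G - 3 * P.δ) / 2 := by linear_combination P.two_mul_cube' / 2
    have h : P.η' * ((P.ξ - P.η) ^ 3 * (P.ξ + P.η)) +
        P.η * (P.η ^ 3 + 2 * P.ξ ^ 3) * (P.η' - P.ξ') =
        P.ξ * P.η' * (P.ξ ^ 3 + 2 * P.η ^ 3) - P.η * P.ξ' * (P.η ^ 3 + 2 * P.ξ ^ 3) := by ring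
    rw [h, hX, hY, firstPade]
    push_cast
    linear_combination (-3 / 2 * P.δ) * P.polar_add + (3 / 2 * P.G) * P.polar_sub
  have h2 : 3 / 2 * (‖P.δ‖ * |(P.firstPade : ℝ)|) ≤
      2 * P.b * ((4 * ‖P.δ‖ / P.a ^ 2) ^ 3 * (2 * P.a + 2 * P.a)) +
        2 * P.a * ((2 * P.a) ^ 3 + 2 * (2 * P.a) ^ 3) * (4 * ‖P.δ‖ / P.b ^ 2) := by
    have h3 := congrArg norm h1
    rw [norm_neg, norm_mul, norm_mul, Complex.norm_intCast] at h3
    norm_num at h3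
    rw [h3]
    refine (norm_add_le _ _).trans ?_
    rw [norm_mul, norm_mul, norm_mul, norm_mul, norm_pow]
    have i1 := P.norm_ξ
    have i2 := P.norm_η
    have i3 := P.norm_η'
    have i4 := P.near
    have i5 : ‖P.η' - P.ξ'‖ ≤ 4 * ‖P.δ‖ / P.b ^ 2 := by rw [norm_sub_rev]; exact P.near'
    have i6 : ‖P.ξ + P.η‖ ≤ 2 * P.a + 2 * P.a := (norm_add_le _ _).trans (by gcongr)
    have i7 : ‖P.η ^ 3 + 2 * P.ξ ^ 3‖ ≤ (2 * P.a) ^ 3 + 2 * (2 * P.a) ^ 3 := by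
      refine (norm_add_le _ _).trans ?_
      rw [norm_mul, norm_pow, norm_pow, Complex.norm_ofNat]
      gcongr
    gcongr
  have h4 : ‖P.δ‖ * |(P.firstPade : ℝ)| ≤ ‖P.δ‖ * (342 * (P.b * ‖P.δ‖ ^ 2 / P.a ^ 5) +
      128 * (P.a ^ 4 / P.b ^ 2)) := by
    have h5 : 2 * P.b * ((4 * ‖P.δ‖ / P.a ^ 2) ^ 3 * (2 * P.a + 2 * P.a)) +
        2 * P.a * ((2 * P.a) ^ 3 + 2 * (2 * P.a) ^ 3) * (4 * ‖P.δ‖ / P.b ^ 2) =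
        ‖P.δ‖ * (512 * (P.b * ‖P.δ‖ ^ 2 / P.a ^ 5) + 192 * (P.a ^ 4 / P.b ^ 2)) := by
      field_simp
      ring
    have h6 : 0 ≤ ‖P.δ‖ * (P.b * ‖P.δ‖ ^ 2 / P.a ^ 5) := by positivity
    rw [h5] at h2
    linarith
  exact le_of_mul_le_mul_left h4 P.norm_δ_pos

theorem firstPade_identity : 2 * P.G ^ 2 + 54 * P.D = P.firstPade * (P.firstPade - P.k * P.G) ^ 2 -
    9 * P.firstPade * P.k ^ 2 * P.D + 8 * P.k ^ 3 * P.G * P.D := by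
  rw [← P.covariant_identity, firstPade]
  ring

theorem abs_firstPade_lt (hb : P.b ^ 2 ≤ P.a ^ 9) :
    |(P.firstPade : ℝ)| < 1 / 2 + 128 * (P.a ^ 4 / P.b ^ 2) := by
  have ha := P.a_pos
  have hb0 := P.b_pos
  refine lt_of_le_of_lt P.abs_firstPade_le ?_
  gcongr
  set s := P.b * ‖P.δ‖ ^ 2 / P.a ^ 5 with hs
  have hs2 : s ^ 2 ≤ 1 / 10 ^ 6 := by
    rw [hs, P.norm_δ_sq, div_pow, mul_pow, div_le_div_iff₀ (by positivity) (by norm_num)]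
    calc P.b ^ 2 * (3 * |(P.D : ℝ)|) ^ 2 * 10 ^ 6 ≤ P.a ^ 9 * (3 * |(P.D : ℝ)|) ^ 2 * 10 ^ 6 := by
          gcongr
      _ = P.a ^ 9 * (9 * 10 ^ 6 * |(P.D : ℝ)| ^ 2) := by ring
      _ ≤ P.a ^ 9 * P.a := by
          gcongr
          nlinarith [P.big_mul_sq_le_a, sq_nonneg |(P.D : ℝ)|]
      _ = _ := by ring
  have hs3 : s ≤ 1 / 1000 := by
    by_contra! h
    nlinarith
  linarith

theorem firstPade_eq_zero_or (hb : P.b ^ 2 ≤ P.a ^ 9) :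
    P.firstPade = 0 ∨ (|(P.firstPade : ℝ)| ≤ 10370 ∧ |(P.k : ℝ)| ≤ 129) := by
  have ha := P.a_pos
  have hb0 := P.b_pos
  have h1 := P.abs_firstPade_lt hb
  by_cases h0 : P.firstPade = 0
  · exact Or.inl h0
  right
  have h2 : (1 : ℝ) ≤ |(P.firstPade : ℝ)| := by exact_mod_cast Int.one_le_abs h0
  constructor
  · have h3 : P.a ^ 4 / P.b ^ 2 ≤ 81 := by
      rw [div_le_iff₀ (by positivity)]
      nlinarith [P.a_sq_le, sq_nonneg P.a]
    linarith
  · have h3 : 1 / 256 ≤ P.a ^ 4 / P.b ^ 2 := by linarith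
    rw [div_le_div_iff₀ (by norm_num) (by positivity)] at h3
    have h4 : P.b ≤ 16 * P.a ^ 2 := abs_le_of_sq_le_sq' (by nlinarith) (by positivity) |>.2
    have h5 : 8 * P.b / P.a ^ 2 ≤ 128 := by
      rw [div_le_iff₀ (by positivity)]
      linarith
    linarith [P.abs_k_le, P.eight_mul_a_div_le]

theorem firstPade_ne_zero : P.firstPade ≠ 0 := by
  intro h
  have h1 := P.firstPade_identity
  rw [h] at h1
  have h2 : P.G ∣ 54 * P.D := ⟨8 * P.k ^ 3 * P.D - 2 * P.G, by linarith⟩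
  have h3 := Int.le_of_dvd (abs_pos.2 (mul_ne_zero (by norm_num) P.disc_ne))
    ((abs_dvd_abs _ _).2 h2)
  have h4 : |(P.G : ℝ)| ≤ 54 * |(P.D : ℝ)| := by
    rw [abs_mul] at h3
    norm_num at h3
    exact_mod_cast h3
  have := P.G_sq_gt
  have := P.one_le_abs_D
  linarith

theorem sq_a_pow_nine_lt : P.a ^ 9 < P.b ^ 2 := by
  by_contra! hb
  rcases P.firstPade_eq_zero_or hb with h | ⟨hν, hk⟩
  · exact P.firstPade_ne_zero h
  set ν := P.firstPade with hνdef
  have hD := P.one_le_abs_D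
  have hG := P.G_sq_gt
  have hid := P.firstPade_identity
  rw [← hνdef] at hid
  by_cases hc : ν * P.k ^ 2 = 2
  · have hkk : P.k ^ 2 = 1 := by
      have h1 : P.k ^ 2 ∣ 2 := ⟨ν, by linarith⟩
      have h2 := Int.le_of_dvd (by norm_num) h1
      have h3 : P.k ≤ 1 := by nlinarith
      have h4 : -1 ≤ P.k := by nlinarith
      have := P.k_ne
      have : P.k = 1 ∨ P.k = -1 := by omega
      rcases this with h | h <;> rw [h] <;> norm_num
    have hν2 : ν = 2 := by rw [hkk] at hc; linarith
    have h1 : P.k * P.G * (1 - P.D) = 1 - 9 * P.D := by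
      rw [hν2] at hid
      have hk3 : P.k ^ 3 = P.k := by rw [pow_succ, hkk, one_mul]
      rw [hk3, hkk] at hid
      have : (2 - P.k * P.G) ^ 2 = 4 - 4 * (P.k * P.G) + P.G ^ 2 := by
        linear_combination P.G ^ 2 * hkk
      rw [this] at hid
      linarith
    have h2 : P.D ≠ 1 := by
      intro h; rw [h] at h1; norm_num at h1
    have h3 : (1 : ℝ) ≤ |1 - (P.D : ℝ)| := by
      exact_mod_cast Int.one_le_abs (sub_ne_zero.2 h2.symm)
    have h4 : |(P.k : ℝ)| * |(P.G : ℝ)| * |1 - (P.D : ℝ)| = |1 - 9 * (P.D : ℝ)| := by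
      rw [← abs_mul, ← abs_mul]
      exact_mod_cast congrArg abs h1
    have h5 : |1 - 9 * (P.D : ℝ)| ≤ 1 + 9 * |(P.D : ℝ)| := by
      refine (abs_sub _ _).trans ?_
      rw [abs_mul]; norm_num
    have h6 := P.one_le_abs_k
    have h7 : |(P.G : ℝ)| ≤ |(P.k : ℝ)| * |(P.G : ℝ)| * |1 - (P.D : ℝ)| := by
      have := abs_nonneg (P.G : ℝ)
      calc |(P.G : ℝ)| = 1 * |(P.G : ℝ)| * 1 := by ring
        _ ≤ _ := by gcongr
    linarith
  · have h1 : (1 : ℝ) ≤ |2 - (ν : ℝ) * (P.k : ℝ) ^ 2| := by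
      exact_mod_cast Int.one_le_abs (sub_ne_zero.2 (Ne.symm hc))
    have h2 : (2 - (ν : ℝ) * (P.k : ℝ) ^ 2) * (P.G : ℝ) ^ 2 = ν ^ 3 - 2 * ν ^ 2 * P.k * P.G -
        9 * ν * P.k ^ 2 * P.D + 8 * P.k ^ 3 * P.G * P.D - 54 * P.D := by
      have : (2 - ν * P.k ^ 2) * P.G ^ 2 = ν ^ 3 - 2 * ν ^ 2 * P.k * P.G -
        9 * ν * P.k ^ 2 * P.D + 8 * P.k ^ 3 * P.G * P.D - 54 * P.D := by linarith
      exact_mod_cast this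
    have h3 : |(P.G : ℝ)| ^ 2 ≤ |(ν : ℝ)| ^ 3 + 2 * |(ν : ℝ)| ^ 2 * |(P.k : ℝ)| * |(P.G : ℝ)| +
        9 * |(ν : ℝ)| * |(P.k : ℝ)| ^ 2 * |(P.D : ℝ)| +
        8 * |(P.k : ℝ)| ^ 3 * |(P.G : ℝ)| * |(P.D : ℝ)| + 54 * |(P.D : ℝ)| := by
      calc |(P.G : ℝ)| ^ 2 ≤ |2 - (ν : ℝ) * (P.k : ℝ) ^ 2| * |(P.G : ℝ)| ^ 2 :=
            le_mul_of_one_le_left (by positivity) h1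
        _ = |(2 - (ν : ℝ) * (P.k : ℝ) ^ 2) * (P.G : ℝ) ^ 2| := by rw [abs_mul, abs_pow]
        _ ≤ |(ν : ℝ) ^ 3| + |2 * (ν : ℝ) ^ 2 * P.k * P.G| + |9 * (ν : ℝ) * P.k ^ 2 * P.D| +
            |8 * (P.k : ℝ) ^ 3 * P.G * P.D| + |54 * (P.D : ℝ)| := by
          rw [h2]
          refine (abs_sub _ _).trans (add_le_add_left ?_ _)
          refine (abs_add_le _ _).trans (add_le_add_left ?_ _)
          refine (abs_sub _ _).trans (add_le_add_left ?_ _)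
          exact abs_sub _ _
        _ = _ := by simp only [abs_mul, abs_pow]; norm_num
    have h4 : |(P.G : ℝ)| ^ 2 ≤ 10370 ^ 3 + 2 * 10370 ^ 2 * 129 * |(P.G : ℝ)| +
        9 * 10370 * 129 ^ 2 * |(P.D : ℝ)| +
        8 * 129 ^ 3 * |(P.G : ℝ)| * |(P.D : ℝ)| + 54 * |(P.D : ℝ)| := by
      refine h3.trans ?_
      gcongr
    have h5 := abs_nonneg (P.G : ℝ)
    nlinarith

theorem elim (P : ResolventPair) : False := by
  have ha := P.a_pos
  have ha1 : 1 ≤ P.a := le_trans (by norm_num) P.big_le_a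
  have hb0 := P.b_pos
  have h1 := P.sq_a_pow_nine_lt
  refine P.padeDet_two_ne_zero (P.padeDet_eq_zero (by norm_num) ?_ ?_)
  · calc P.a ^ (16 * 2 + 5) ≤ P.a ^ 45 := pow_le_pow_right₀ ha1 (by norm_num)
      _ = (P.a ^ 9) ^ 5 := by rw [← pow_mul]
      _ ≤ (P.b ^ 2) ^ 5 := by gcongr
      _ = _ := by rw [← pow_mul]
  · calc P.b ^ 2 ≤ (P.a ^ 7) ^ 2 := by gcongr; exact P.b_lt_a_pow_seven.le
      _ = _ := by rw [← pow_mul]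

end ResolventPair

/-- The value at `P` of the monic binary cubic form with coefficients `1, b, c, d`. -/
def monicCubic (b c d : ℤ) (P : ℤ × ℤ) : ℤ :=
  P.1 ^ 3 + b * P.1 ^ 2 * P.2 + c * P.1 * P.2 ^ 2 + d * P.2 ^ 3

/-- The determinant of two integer points. -/
def pointDet (P Q : ℤ × ℤ) : ℤ := P.1 * Q.2 - Q.1 * P.2

/-- `t` lists the roots of `x³ + bx² + cx + d`. -/
structure IsRootTriple {R : Type*} [CommRing R] (b c d : ℤ) (t : Fin 3 → R) : Prop where
  sum : t 0 + t 1 + t 2 = -b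
  pair : t 0 * t 1 + t 1 * t 2 + t 2 * t 0 = c
  prod : t 0 * t 1 * t 2 = -d

section RootForm

variable {R : Type*} [CommRing R] (t : Fin 3 → R)

/-- The linear factor `x - tᵢy`. -/
def linForm (i : Fin 3) (P : ℤ × ℤ) : R := P.1 - t i * P.2

/-- The linear forms proportional to `x - tᵢy` normalised to have sum zero. -/
def rootForm (i : Fin 3) (P : ℤ × ℤ) : R := (t (i + 1) - t (i + 2)) * linForm t i P

/-- The product of the differences of the roots. -/
def rootDelta : R := (t 1 - t 2) * (t 2 - t 0) * (t 0 - t 1)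

theorem rootForm_sum (i : Fin 3) (P : ℤ × ℤ) :
    rootForm t i P + rootForm t (i + 1) P + rootForm t (i + 2) P = 0 := by
  fin_cases i <;> simp [rootForm, linForm] <;> ring

theorem rootForm_cross (i : Fin 3) (P Q : ℤ × ℤ) :
    rootForm t i P * rootForm t (i + 1) Q - rootForm t (i + 1) P * rootForm t i Q =
      rootDelta t * pointDet P Q := by
  fin_cases i <;> simp [rootForm, linForm, rootDelta, pointDet] <;> ring

variable {t} {b c d : ℤ}

theorem IsRootTriple.linForm_prod (h : IsRootTriple b c d t) (i : Fin 3) (P : ℤ × ℤ) :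
    linForm t i P * linForm t (i + 1) P * linForm t (i + 2) P = monicCubic b c d P := by
  have h1 := h.sum
  have h2 := h.pair
  have h3 := h.prod
  fin_cases i <;> simp [linForm, monicCubic] <;>
    linear_combination (-(P.1 : R) ^ 2 * P.2) * h1 + P.1 * P.2 ^ 2 * h2 - P.2 ^ 3 * h3

theorem IsRootTriple.rootForm_prod (h : IsRootTriple b c d t) (i : Fin 3) (P : ℤ × ℤ) :
    rootForm t i P * rootForm t (i + 1) P * rootForm t (i + 2) P =
      rootDelta t * monicCubic b c d P := by
  rw [← h.linForm_prod i]
  fin_cases i <;> simp [rootForm, rootDelta] <;> ring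

theorem IsRootTriple.rootDelta_sq (h : IsRootTriple b c d t) :
    rootDelta t ^ 2 = cubicDisc 1 b c d := by
  have h1 : (b : R) = -(t 0 + t 1 + t 2) := by linear_combination h.sum
  have h3 : (d : R) = -(t 0 * t 1 * t 2) := by linear_combination h.prod
  simp only [cubicDisc, rootDelta]
  push_cast
  rw [h1, h3, ← h.pair]
  ring

theorem IsRootTriple.map {S : Type*} [CommRing S] (h : IsRootTriple b c d t) (φ : R →+* S) :
    IsRootTriple b c d (fun i => φ (t i)) where
  sum := by simpa using congrArg φ h.sum
  pair := by simpa using congrArg φ h.pair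
  prod := by simpa using congrArg φ h.prod

theorem map_linForm {S : Type*} [CommRing S] (φ : R →+* S) (i : Fin 3) (P : ℤ × ℤ) :
    φ (linForm t i P) = linForm (fun i => φ (t i)) i P := by
  simp [linForm]

theorem map_rootForm {S : Type*} [CommRing S] (φ : R →+* S) (i : Fin 3) (P : ℤ × ℤ) :
    φ (rootForm t i P) = rootForm (fun i => φ (t i)) i P := by
  simp [rootForm, map_linForm]

/-- The Hessian of a monic cubic form, polarised and doubled. -/
def hessianPolar (b c d : ℤ) (P Q : ℤ × ℤ) : ℤ :=
  2 * (b ^ 2 - 3 * c) * P.1 * Q.1 + (b * c - 9 * d) * (P.1 * Q.2 + Q.1 * P.2) +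
    2 * (c ^ 2 - 3 * b * d) * P.2 * Q.2

/-- The Hessian of a monic cubic form. -/
def hessian (b c d : ℤ) (P : ℤ × ℤ) : ℤ :=
  (b ^ 2 - 3 * c) * P.1 ^ 2 + (b * c - 9 * d) * P.1 * P.2 + (c ^ 2 - 3 * b * d) * P.2 ^ 2

/-- The cubic covariant of a monic cubic form. -/
def cubicCovariant (b c d : ℤ) (P : ℤ × ℤ) : ℤ :=
  (27 * d - 9 * b * c + 2 * b ^ 3) * P.1 ^ 3 +
    3 * (b ^ 2 * c - 6 * c ^ 2 + 9 * b * d) * P.1 ^ 2 * P.2 -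
    3 * (b * c ^ 2 - 6 * b ^ 2 * d + 9 * c * d) * P.1 * P.2 ^ 2 -
    (27 * d ^ 2 - 9 * b * c * d + 2 * c ^ 3) * P.2 ^ 3

theorem IsRootTriple.hessian_eq (h : IsRootTriple b c d t) (i : Fin 3) (P : ℤ × ℤ) :
    (rootForm t (i + 1) P - rootForm t (i + 2) P) ^ 2 + 3 * rootForm t i P ^ 2 =
      4 * hessian b c d P := by
  have h1 : (b : R) = -(t 0 + t 1 + t 2) := by linear_combination h.sum
  have h3 : (d : R) = -(t 0 * t 1 * t 2) := by linear_combination h.prod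
  simp only [hessian]
  push_cast
  rw [h1, h3, ← h.pair]
  fin_cases i <;> simp [rootForm, linForm] <;> ring

theorem IsRootTriple.hessianPolar_eq (h : IsRootTriple b c d t) (i : Fin 3) (P Q : ℤ × ℤ) :
    (rootForm t (i + 1) P - rootForm t (i + 2) P) * (rootForm t (i + 1) Q - rootForm t (i + 2) Q) +
      3 * rootForm t i P * rootForm t i Q = 2 * hessianPolar b c d P Q := by
  have h1 : (b : R) = -(t 0 + t 1 + t 2) := by linear_combination h.sum
  have h3 : (d : R) = -(t 0 * t 1 * t 2) := by linear_combination h.prod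
  simp only [hessianPolar]
  push_cast
  rw [h1, h3, ← h.pair]
  fin_cases i <;> simp [rootForm, linForm] <;> ring

theorem IsRootTriple.cubicCovariant_eq (h : IsRootTriple b c d t) (i : Fin 3) (P : ℤ × ℤ) :
    (rootForm t (i + 1) P - rootForm t (i + 2) P) * (rootForm t (i + 2) P - rootForm t i P) *
      (rootForm t i P - rootForm t (i + 1) P) = cubicCovariant b c d P := by
  have h1 : (b : R) = -(t 0 + t 1 + t 2) := by linear_combination h.sum
  have h3 : (d : R) = -(t 0 * t 1 * t 2) := by linear_combination h.prod
  simp only [cubicCovariant]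
  push_cast
  rw [h1, h3, ← h.pair]
  fin_cases i <;> simp [rootForm, linForm] <;> ring

end RootForm

theorem pointDet_ne_zero {b c d : ℤ} {P Q : ℤ × ℤ} (hP : monicCubic b c d P = 1)
    (hQ : monicCubic b c d Q = 1) (hPQ : P ≠ Q) : pointDet P Q ≠ 0 := by
  intro h
  obtain ⟨x, y⟩ := P
  obtain ⟨x', y'⟩ := Q
  simp only [pointDet, monicCubic] at *
  have e1 : ∃ l : ℤ, x' = l * x ∧ y' = l * y := by
    refine ⟨x ^ 2 * x' + b * x * y * x' + c * y ^ 2 * x' + d * y ^ 2 * y', ?_, ?_⟩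
    · linear_combination (-x') * hP - d * y ^ 2 * h
    · linear_combination (-y') * hP + (x ^ 2 + b * x * y + c * y ^ 2) * h
  obtain ⟨l, rfl, rfl⟩ := e1
  have e2 : l ^ 3 = 1 := by
    linear_combination hQ - l ^ 3 * hP
  have e3 : l = 1 := by
    have : (l - 1) * (l ^ 2 + l + 1) = 0 := by linear_combination e2
    rcases mul_eq_zero.1 this with h | h
    · linarith
    · nlinarith [sq_nonneg (2 * l + 1)]
  apply hPQ
  rw [e3]; simp

section Size

variable (t : Fin 3 → ℂ)

/-- The largest absolute value of the three linear forms at `P`. -/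
noncomputable def rootSize (P : ℤ × ℤ) : ℝ :=
  max (max ‖rootForm t 0 P‖ ‖rootForm t 1 P‖) ‖rootForm t 2 P‖

/-- The `i`-th linear form is the smallest one at `P`. -/
def IsNearRoot (i : Fin 3) (P : ℤ × ℤ) : Prop := ∀ j, ‖rootForm t i P‖ ≤ ‖rootForm t j P‖

theorem exists_isNearRoot (P : ℤ × ℤ) : ∃ i, IsNearRoot t i P := by
  obtain ⟨i, _, hi⟩ := Finset.exists_min_image Finset.univ (fun j => ‖rootForm t j P‖) ⟨0, by simp⟩
  exact ⟨i, fun j => hi j (Finset.mem_univ j)⟩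

theorem norm_rootForm_le (i : Fin 3) (P : ℤ × ℤ) : ‖rootForm t i P‖ ≤ rootSize t P := by
  fin_cases i <;> simp [rootSize]

theorem rootSize_nonneg (P : ℤ × ℤ) : 0 ≤ rootSize t P :=
  (norm_nonneg _).trans (norm_rootForm_le t 0 P)

variable {t}

theorem IsNearRoot.rootSize_eq {i : Fin 3} {P : ℤ × ℤ} (h : IsNearRoot t i P) :
    rootSize t P = max ‖rootForm t (i + 1) P‖ ‖rootForm t (i + 2) P‖ := by
  have h0 := h 0
  have h1 := h 1
  have h2 := h 2
  fin_cases i <;> simp [rootSize] at * <;> grind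

theorem norm_rootForm_triangle (i : Fin 3) (P : ℤ × ℤ) :
    ‖rootForm t (i + 1) P‖ ≤ ‖rootForm t (i + 2) P‖ + ‖rootForm t i P‖ ∧
    ‖rootForm t (i + 2) P‖ ≤ ‖rootForm t (i + 1) P‖ + ‖rootForm t i P‖ := by
  have h := rootForm_sum t i P
  constructor
  · rw [show rootForm t (i + 1) P = -(rootForm t (i + 2) P + rootForm t i P) by
      linear_combination h, norm_neg]
    exact norm_add_le _ _
  · rw [show rootForm t (i + 2) P = -(rootForm t (i + 1) P + rootForm t i P) by
      linear_combination h, norm_neg]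
    exact norm_add_le _ _

theorem IsNearRoot.sub_le {i : Fin 3} {P : ℤ × ℤ} (h : IsNearRoot t i P) :
    rootSize t P - ‖rootForm t i P‖ ≤ ‖rootForm t (i + 1) P‖ ∧
    rootSize t P - ‖rootForm t i P‖ ≤ ‖rootForm t (i + 2) P‖ := by
  have h1 := norm_rootForm_triangle (t := t) i P
  have h2 := norm_nonneg (rootForm t i P)
  rw [h.rootSize_eq]
  rcases max_cases ‖rootForm t (i + 1) P‖ ‖rootForm t (i + 2) P‖ with h3 | h3 <;>
    constructor <;> linarith

theorem IsNearRoot.half_le {i : Fin 3} {P : ℤ × ℤ} (h : IsNearRoot t i P) :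
    rootSize t P ≤ 2 * ‖rootForm t (i + 1) P‖ ∧ rootSize t P ≤ 2 * ‖rootForm t (i + 2) P‖ := by
  have h1 := h.sub_le
  have h2 := h (i + 1)
  have h3 := h (i + 2)
  constructor <;> linarith

theorem rootSize_mul_le (P Q : ℤ × ℤ) : ‖rootDelta t‖ * |(pointDet P Q : ℝ)| ≤
    2 * (rootSize t P * rootSize t Q) := by
  rw [← Complex.norm_intCast, ← norm_mul, ← rootForm_cross t 0]
  refine (norm_sub_le _ _).trans ?_
  rw [norm_mul, norm_mul, two_mul]
  have := norm_rootForm_le t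
  have := rootSize_nonneg t
  gcongr <;> simp [*]

variable {b c d : ℤ} {P Q : ℤ × ℤ}

theorem norm_rootDelta_le (hP : monicCubic b c d P = 1)
    (hQ : monicCubic b c d Q = 1) (hPQ : P ≠ Q) :
    ‖rootDelta t‖ ≤ 2 * (rootSize t P * rootSize t Q) := by
  refine le_trans ?_ (rootSize_mul_le P Q)
  have : (1 : ℝ) ≤ |(pointDet P Q : ℝ)| := by
    exact_mod_cast Int.one_le_abs (pointDet_ne_zero hP hQ hPQ)
  exact le_mul_of_one_le_right (norm_nonneg _) this

theorem IsRootTriple.norm_rootDelta_sq (ht : IsRootTriple b c d t) :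
    ‖rootDelta t‖ ^ 2 = |(cubicDisc 1 b c d : ℝ)| := by
  rw [← norm_pow, ht.rootDelta_sq, Complex.norm_intCast]

theorem IsRootTriple.rootDelta_ne (ht : IsRootTriple b c d t) (hD : cubicDisc 1 b c d ≠ 0) :
    rootDelta t ≠ 0 := by
  intro h
  have := ht.rootDelta_sq
  rw [h] at this
  norm_num at this
  exact hD (by exact_mod_cast this.symm)

theorem IsRootTriple.norm_rootForm_prod (ht : IsRootTriple b c d t) (i : Fin 3)
    (hP : monicCubic b c d P = 1) :
    ‖rootForm t i P‖ * ‖rootForm t (i + 1) P‖ * ‖rootForm t (i + 2) P‖ = ‖rootDelta t‖ := by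
  rw [← norm_mul, ← norm_mul, ht.rootForm_prod, hP]
  simp

theorem IsRootTriple.rootSize_pos (ht : IsRootTriple b c d t) (hD : cubicDisc 1 b c d ≠ 0)
    (hP : monicCubic b c d P = 1) :
    0 < rootSize t P := by
  refine lt_of_le_of_ne (rootSize_nonneg t P) fun h => ht.rootDelta_ne hD ?_
  have h1 := norm_rootForm_le t 0 P
  rw [← h] at h1
  have h2 := ht.norm_rootForm_prod 0 hP
  rw [le_antisymm h1 (norm_nonneg _)] at h2
  simpa using h2.symm

theorem IsNearRoot.norm_le (ht : IsRootTriple b c d t) (hD : cubicDisc 1 b c d ≠ 0)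
    (hP : monicCubic b c d P = 1) {i : Fin 3}
    (h : IsNearRoot t i P) : ‖rootForm t i P‖ ≤ 2 * ‖rootDelta t‖ / rootSize t P ^ 2 := by
  have h0 := ht.rootSize_pos hD hP
  have h1 := ht.norm_rootForm_prod i hP
  obtain ⟨h2, h3⟩ := h.half_le
  rw [le_div_iff₀ (by positivity), ← h1]
  have h4 := norm_nonneg (rootForm t i P)
  have h5 := h.rootSize_eq
  have h6 : rootSize t P ^ 2 ≤ 2 * (‖rootForm t (i + 1) P‖ * ‖rootForm t (i + 2) P‖) := by
    rcases max_cases ‖rootForm t (i + 1) P‖ ‖rootForm t (i + 2) P‖ with ⟨h, -⟩ | ⟨h, -⟩ <;>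
      rw [h] at h5 <;> rw [← h5] <;> nlinarith
  nlinarith

theorem IsNearRoot.gap (ht : IsRootTriple b c d t) (hD : cubicDisc 1 b c d ≠ 0)
    (hP : monicCubic b c d P = 1)
    (hQ : monicCubic b c d Q = 1) (hPQ : P ≠ Q) {i : Fin 3} (h : IsNearRoot t i P)
    (h' : IsNearRoot t i Q) :
    1 ≤ 2 * (rootSize t Q / rootSize t P ^ 2 + rootSize t P / rootSize t Q ^ 2) := by
  have h1 := norm_pos_iff.2 (ht.rootDelta_ne hD)
  have h2 := ht.rootSize_pos hD hP
  have h2' := ht.rootSize_pos hD hQ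
  refine le_of_mul_le_mul_left (a := ‖rootDelta t‖) ?_ h1
  have h3 : (1 : ℝ) ≤ |(pointDet P Q : ℝ)| := by
    exact_mod_cast Int.one_le_abs (pointDet_ne_zero hP hQ hPQ)
  calc ‖rootDelta t‖ * 1 ≤ ‖rootDelta t‖ * |(pointDet P Q : ℝ)| := by gcongr
    _ ≤ 2 * ‖rootDelta t‖ / rootSize t P ^ 2 * rootSize t Q +
        rootSize t P * (2 * ‖rootDelta t‖ / rootSize t Q ^ 2) := by
      rw [← Complex.norm_intCast, ← norm_mul, ← rootForm_cross t i]
      refine (norm_sub_le _ _).trans ?_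
      rw [norm_mul, norm_mul]
      have a1 := norm_rootForm_le t (i + 1) P
      have a2 := norm_rootForm_le t (i + 1) Q
      have a3 := h.norm_le ht hD hP
      have a4 := h'.norm_le ht hD hQ
      gcongr
    _ = _ := by ring

theorem IsNearRoot.sq_le (ht : IsRootTriple b c d t) (hD : cubicDisc 1 b c d ≠ 0)
    (hP : monicCubic b c d P = 1)
    (hQ : monicCubic b c d Q = 1) (hPQ : P ≠ Q) {i : Fin 3} (h : IsNearRoot t i P)
    (h' : IsNearRoot t i Q) (hle : rootSize t P ≤ rootSize t Q) (h4 : 4 ≤ rootSize t P) :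
    rootSize t P ^ 2 ≤ 4 * rootSize t Q := by
  have h1 := h.gap ht hD hP hQ hPQ h'
  have h2 : rootSize t P / rootSize t Q ^ 2 ≤ 1 / 4 := by
    rw [div_le_div_iff₀ (by have := ht.rootSize_pos hD hQ; positivity) (by norm_num)]
    nlinarith
  have h3 : 1 / 4 ≤ rootSize t Q / rootSize t P ^ 2 := by linarith
  rw [div_le_div_iff₀ (by norm_num) (by have := ht.rootSize_pos hD hP; positivity)] at h3
  linarith

/-- Two distinct solutions near the same root are not both large. -/
theorem IsNearRoot.not_both_large (ht : IsRootTriple b c d t) (hD : 10 ^ 40 ≤ |cubicDisc 1 b c d|)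
    (hP : monicCubic b c d P = 1) (hQ : monicCubic b c d Q = 1) (hPQ : P ≠ Q) {i : Fin 3}
    (h : IsNearRoot t i P) (h' : IsNearRoot t i Q) (hle : rootSize t P ≤ rootSize t Q) :
    rootSize t P < |(cubicDisc 1 b c d : ℝ)| ^ 6 := by
  by_contra! hlarge
  have hD0 : cubicDisc 1 b c d ≠ 0 := by
    intro h; rw [h] at hD; norm_num at hD
  set D := cubicDisc 1 b c d with hDdef
  have hDR : (10 : ℝ) ^ 40 ≤ |(D : ℝ)| := by exact_mod_cast hD
  obtain ⟨s, hs2, hs3⟩ : ∃ s : ℂ, s ^ 2 = -3 ∧ ‖s‖ ≤ 2 := by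
    refine ⟨(Real.sqrt 3 : ℝ) * Complex.I, ?_, ?_⟩
    · rw [mul_pow, Complex.I_sq, ← Complex.ofReal_pow, Real.sq_sqrt (by norm_num)]
      norm_num
    · rw [norm_mul, Complex.norm_I, mul_one, Complex.norm_real,
        Real.norm_of_nonneg (by positivity), Real.sqrt_le_left (by norm_num)]
      norm_num
  have ha : 10 ^ 40 * |(D : ℝ)| ^ 5 ≤ rootSize t P := by
    refine le_trans ?_ hlarge
    rw [pow_succ' _ 5]
    gcongr
  set a := rootSize t P with hadef
  set b' := rootSize t Q with hbdef
  have hbound : ∀ X : ℤ × ℤ,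
      ‖(rootForm t (i + 1) X - rootForm t (i + 2) X - s * rootForm t i X) / 2‖
      ≤ 2 * rootSize t X ∧
      ‖(rootForm t (i + 1) X - rootForm t (i + 2) X + s * rootForm t i X) / 2‖
      ≤ 2 * rootSize t X := by
    intro X
    have h1 := norm_rootForm_le t (i + 1) X
    have h2 := norm_rootForm_le t (i + 2) X
    have h3 := norm_rootForm_le t i X
    have h4 : ‖rootForm t (i + 1) X - rootForm t (i + 2) X‖ ≤ 2 * rootSize t X :=
      (norm_sub_le _ _).trans (by linarith)
    have h5 : ‖s * rootForm t i X‖ ≤ 2 * rootSize t X := by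
      rw [norm_mul]; gcongr
    rw [norm_div, norm_div, Complex.norm_ofNat]
    constructor
    · rw [div_le_iff₀ (by norm_num)]
      exact (norm_sub_le _ _).trans (by linarith)
    · rw [div_le_iff₀ (by norm_num)]
      exact (norm_add_le _ _).trans (by linarith)
  have hcube : ∀ X : ℤ × ℤ, monicCubic b c d X = 1 →
      ((rootForm t (i + 1) X - rootForm t (i + 2) X - s * rootForm t i X) / 2) ^ 3 -
      ((rootForm t (i + 1) X - rootForm t (i + 2) X + s * rootForm t i X) / 2) ^ 3 =
      3 * (s * rootDelta t) := by
    intro X hX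
    have e1 := ht.rootForm_prod i X
    have e2 := rootForm_sum t i X
    rw [hX] at e1
    have e3 : rootForm t i X = -(rootForm t (i + 1) X + rootForm t (i + 2) X) := by
      linear_combination e2
    rw [e3] at e1 ⊢
    push_cast at e1
    linear_combination 3 * s * e1 +
      s * (rootForm t (i + 1) X + rootForm t (i + 2) X) ^ 3 / 4 * hs2
  have hnear : ∀ X : ℤ × ℤ, monicCubic b c d X = 1 → IsNearRoot t i X →
      ‖(rootForm t (i + 1) X - rootForm t (i + 2) X - s * rootForm t i X) / 2 -
      (rootForm t (i + 1) X - rootForm t (i + 2) X + s * rootForm t i X) / 2‖ ≤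
      4 * ‖s * rootDelta t‖ / rootSize t X ^ 2 := by
    intro X hX hn
    have e1 := hn.norm_le ht hD0 hX
    have e2 := ht.rootSize_pos hD0 hX
    rw [show (rootForm t (i + 1) X - rootForm t (i + 2) X - s * rootForm t i X) / 2 -
      (rootForm t (i + 1) X - rootForm t (i + 2) X + s * rootForm t i X) / 2 =
      -(s * rootForm t i X) by ring, norm_neg, norm_mul]
    calc _ ≤ ‖s‖ * (2 * ‖rootDelta t‖ / rootSize t X ^ 2) := by gcongr
      _ ≤ ‖s‖ * (4 * ‖rootDelta t‖ / rootSize t X ^ 2) := by gcongr; norm_num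
      _ = _ := by rw [norm_mul s]; ring
  refine ResolventPair.elim
    { ξ := (rootForm t (i + 1) P - rootForm t (i + 2) P - s * rootForm t i P) / 2
      η := (rootForm t (i + 1) P - rootForm t (i + 2) P + s * rootForm t i P) / 2
      ξ' := (rootForm t (i + 1) Q - rootForm t (i + 2) Q - s * rootForm t i Q) / 2
      η' := (rootForm t (i + 1) Q - rootForm t (i + 2) Q + s * rootForm t i Q) / 2
      δ := s * rootDelta t
      G := cubicCovariant b c d P
      H := hessian b c d P
      D := D
      k := pointDet P Q
      m := hessianPolar b c d P Q
      a := a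
      b := b'
      mul_eq := by
        linear_combination ht.hessian_eq i P / 4 - rootForm t i P ^ 2 / 4 * hs2
      sub_eq := hcube P hP
      add_eq := by
        rw [← ht.cubicCovariant_eq i P]
        have e3 : rootForm t i P = -(rootForm t (i + 1) P + rootForm t (i + 2) P) := by
          linear_combination rootForm_sum t i P
        rw [e3]
        linear_combination 3 / 4 * (rootForm t (i + 1) P - rootForm t (i + 2) P) *
          (rootForm t (i + 1) P + rootForm t (i + 2) P) ^ 2 * hs2
      sub_eq' := hcube Q hQ
      sq_eq := by
        rw [mul_pow, hs2, ht.rootDelta_sq]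
      polar_sub := by
        have e3 := rootForm_sum t i P
        have e4 := rootForm_sum t i Q
        linear_combination (-s) * rootForm_cross t i P Q + s / 2 * rootForm t i P * e4 -
          s / 2 * rootForm t i Q * e3
      polar_add := by
        linear_combination ht.hessianPolar_eq i P Q / 2 -
          rootForm t i P * rootForm t i Q / 2 * hs2
      disc_ne := hD0
      k_ne := pointDet_ne_zero hP hQ hPQ
      le_a := ha
      a_le := hle
      norm_ξ := (hbound P).1
      norm_η := (hbound P).2
      norm_ξ' := (hbound Q).1
      norm_η' := (hbound Q).2
      near := hnear P hP h
      near' := hnear Q hQ h'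
      le_G := by
        obtain ⟨l1, l2⟩ := h.sub_le
        rw [← hadef] at l1 l2
        have hn := h.norm_le ht hD0 hP
        rw [← hadef] at hn
        have ha1 : 10 ^ 40 ≤ a := by
          have : (1 : ℝ) ≤ |(D : ℝ)| ^ 5 := one_le_pow₀ (by linarith)
          linarith
        have hW : ‖rootDelta t‖ ≤ a := by
          have h1 := ht.norm_rootDelta_sq
          rw [← hDdef] at h1
          have h2 : |(D : ℝ)| ≤ |(D : ℝ)| ^ 5 := le_self_pow₀ (by linarith) (by norm_num)
          by_contra! h3
          nlinarith
        have h10 : ‖rootForm t i P‖ ≤ a / 10 := by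
          refine hn.trans ?_
          rw [div_le_iff₀ (by positivity)]
          have : a * 10 ^ 40 ≤ a * a := by gcongr
          nlinarith
        have e3 := rootForm_sum t i P
        have m1 : 3 / 2 * a ≤ ‖rootForm t (i + 1) P - rootForm t (i + 2) P‖ := by
          have e : 2 * rootForm t (i + 1) P =
              (rootForm t (i + 1) P - rootForm t (i + 2) P) - rootForm t i P := by
            linear_combination e3
          have e' := congrArg norm e
          rw [norm_mul, Complex.norm_ofNat] at e'
          have := norm_sub_le (rootForm t (i + 1) P - rootForm t (i + 2) P) (rootForm t i P)
          linarith
        have m2 : 8 / 10 * a ≤ ‖rootForm t (i + 2) P - rootForm t i P‖ := by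
          have := norm_sub_norm_le (rootForm t (i + 2) P) (rootForm t i P)
          linarith
        have m3 : 8 / 10 * a ≤ ‖rootForm t i P - rootForm t (i + 1) P‖ := by
          rw [norm_sub_rev]
          have := norm_sub_norm_le (rootForm t (i + 1) P) (rootForm t i P)
          linarith
        rw [← Complex.norm_intCast, ← ht.cubicCovariant_eq i P, norm_mul, norm_mul]
        calc a ^ 3 / 2 ≤ (3 / 2 * a) * (8 / 10 * a) * (8 / 10 * a) := by
              have : 0 ≤ a ^ 3 := by positivity
              nlinarith
          _ ≤ _ := by gcongr }

end Size

section CubicUnits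

open Polynomial

/-- The triples of conjugates of elements of norm one of the ring generated by a root. -/
def cubicUnits (θ : Fin 3 → ℝ) : Submonoid (Fin 3 → ℝ) where
  carrier := {η | (∃ g : ℤ[X], ∀ i, η i = aeval (θ i) g) ∧ η 0 * η 1 * η 2 = 1}
  mul_mem' := by
    rintro η η' ⟨⟨g, hg⟩, h⟩ ⟨⟨g', hg'⟩, h'⟩
    refine ⟨⟨g * g', fun i => by simp [hg, hg']⟩, ?_⟩
    simp only [Pi.mul_apply]
    linear_combination η' 0 * η' 1 * η' 2 * h + h'
  one_mem' := ⟨⟨1, by simp⟩, by simp⟩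

variable {θ : Fin 3 → ℝ} {b c d : ℤ}

theorem cubicUnits_ne_zero {η : Fin 3 → ℝ} (h : η ∈ cubicUnits θ) (i : Fin 3) : η i ≠ 0 := by
  intro h0
  have := h.2
  fin_cases i <;> simp at h0 <;> rw [h0] at this <;> simp at this

theorem IsRootTriple.cube_eq {R : Type*} [CommRing R] {t : Fin 3 → R} (ht : IsRootTriple b c d t)
    (i : Fin 3) : t i ^ 3 + b * t i ^ 2 + c * t i + d = 0 := by
  have h1 : (b : R) = -(t 0 + t 1 + t 2) := by linear_combination ht.sum
  have h3 : (d : R) = -(t 0 * t 1 * t 2) := by linear_combination ht.prod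
  rw [h1, h3, ← ht.pair]
  fin_cases i <;> simp <;> ring

theorem exists_quadratic_eq (ht : IsRootTriple b c d θ) (g : ℤ[X]) :
    ∃ p q r : ℤ, ∀ i, aeval (θ i) g = p + q * θ i + r * θ i ^ 2 := by
  induction g using Polynomial.induction_on' with
  | add g g' h h' =>
    obtain ⟨p, q, r, h⟩ := h
    obtain ⟨p', q', r', h'⟩ := h'
    refine ⟨p + p', q + q', r + r', fun i => ?_⟩
    rw [map_add, h, h']
    push_cast
    ring
  | monomial n a =>
    rw [← C_mul_X_pow_eq_monomial]
    induction n with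
    | zero => exact ⟨a, 0, 0, fun i => by simp⟩
    | succ n ih =>
      obtain ⟨p, q, r, h⟩ := ih
      refine ⟨-r * d, p - r * c, q - r * b, fun i => ?_⟩
      rw [pow_succ, ← mul_assoc, map_mul, h, aeval_X]
      push_cast
      linear_combination r * ht.cube_eq i

theorem linForm_mem_cubicUnits (ht : IsRootTriple b c d θ) {P : ℤ × ℤ}
    (hP : monicCubic b c d P = 1) : (fun i => linForm θ i P) ∈ cubicUnits θ := by
  refine ⟨⟨C P.1 - X * C P.2, fun i => by simp [linForm]⟩, ?_⟩
  have := ht.linForm_prod 0 P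
  rw [hP] at this
  simpa using this

theorem linForm_inv_mem_cubicUnits (ht : IsRootTriple b c d θ) {P : ℤ × ℤ}
    (hP : monicCubic b c d P = 1) : (fun i => linForm θ i P)⁻¹ ∈ cubicUnits θ := by
  have h1 := linForm_mem_cubicUnits ht hP
  refine ⟨⟨C (P.1 ^ 2 + b * P.1 * P.2 + c * P.2 ^ 2) + C (P.1 * P.2 + b * P.2 ^ 2) * X +
    C (P.2 ^ 2) * X ^ 2, fun i => ?_⟩, ?_⟩
  · rw [Pi.inv_apply]
    refine inv_eq_of_mul_eq_one_right ?_
    have h2 : (P.1 ^ 3 + b * P.1 ^ 2 * P.2 + c * P.1 * P.2 ^ 2 + d * P.2 ^ 3 : ℝ) = 1 := by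
      exact_mod_cast hP
    simp [linForm]
    linear_combination h2 - (P.2 : ℝ) ^ 3 * ht.cube_eq i
  · have := h1.2
    simp only [Pi.inv_apply]
    rw [← mul_inv, ← mul_inv, this, inv_one]

theorem cubicUnits_dichotomy (ht : IsRootTriple b c d θ)
    (hD : rootDelta θ ≠ 0)
    (hirr : ∀ x y : ℤ, monicCubic b c d (x, y) = 0 → y = 0) {η : Fin 3 → ℝ}
    (h : η ∈ cubicUnits θ) :
    (∀ i, |η i| = 1) ∨ (Function.Injective η ∧
      |rootDelta θ| ≤ |(η 1 - η 2) * (η 2 - η 0) * (η 0 - η 1)|) := by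
  obtain ⟨⟨g, hg⟩, hn⟩ := h
  obtain ⟨p, q, r, hpqr⟩ := exists_quadratic_eq ht g
  have hη : ∀ i, η i = p + q * θ i + r * θ i ^ 2 := fun i => (hg i).trans (hpqr i)
  have key : (η 1 - η 2) * (η 2 - η 0) * (η 0 - η 1) =
      rootDelta θ * monicCubic b c d (q - r * b, r) := by
    rw [← ht.linForm_prod 0]
    simp only [linForm, hη, rootDelta]
    push_cast
    have h1 : (b : ℝ) = -(θ 0 + θ 1 + θ 2) := by linear_combination ht.sum
    rw [h1]
    simp
    ring
  by_cases hN : monicCubic b c d (q - r * b, r) = 0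
  · left
    have hr := hirr _ _ hN
    rw [hr] at hN
    have hq : q = 0 := by simpa [monicCubic] using hN
    have hp : ∀ i, η i = p := fun i => by rw [hη, hr, hq]; simp
    rw [hp, hp, hp] at hn
    have h3 : p * p * p = 1 := by exact_mod_cast hn
    have h4 : IsUnit p := IsUnit.of_mul_eq_one (p * p) (by linarith)
    intro i
    rw [hp]
    exact_mod_cast Int.isUnit_iff_abs_eq.1 h4
  · right
    have h1 : (1 : ℝ) ≤ |(monicCubic b c d (q - r * b, r) : ℝ)| := by
      exact_mod_cast Int.one_le_abs hN
    refine ⟨?_, ?_⟩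
    · have h2 : (η 1 - η 2) * (η 2 - η 0) * (η 0 - η 1) ≠ 0 := by
        rw [key]
        exact mul_ne_zero hD (by exact_mod_cast hN)
      intro i j hij
      by_contra hne
      apply h2
      fin_cases i <;> fin_cases j <;> simp at hij hne <;> rw [hij] <;> ring
    · rw [key, abs_mul]
      exact le_mul_of_one_le_right (abs_nonneg _) h1

end CubicUnits

section LogUnits

variable (θ : Fin 3 → ℝ) {b c d : ℤ}

/-- The logarithmic image, in the coordinates `(-λᵢ, λᵢ₊₁ - λᵢ₊₂)`, of the cubic units. -/
noncomputable def logUnits (i : Fin 3) : AddSubgroup (ℝ × ℝ) where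
  carrier := {p | ∃ η : Fin 3 → ℝ, η ∈ cubicUnits θ ∧ η⁻¹ ∈ cubicUnits θ ∧
    p = (-Real.log |η i|, Real.log |η (i + 1)| - Real.log |η (i + 2)|)}
  add_mem' := by
    rintro _ _ ⟨η, h, h', rfl⟩ ⟨ξ, k, k', rfl⟩
    refine ⟨η * ξ, mul_mem h k, by rw [mul_inv]; exact mul_mem h' k', ?_⟩
    have e := fun j => Real.log_mul (abs_ne_zero.2 (cubicUnits_ne_zero h j))
      (abs_ne_zero.2 (cubicUnits_ne_zero k j))
    simp only [Pi.mul_apply, abs_mul, e, Prod.mk_add_mk]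
    ext <;> (simp; ring)
  zero_mem' := ⟨1, one_mem _, by rw [inv_one]; exact one_mem _, by simp; rfl⟩
  neg_mem' := by
    rintro _ ⟨η, h, h', rfl⟩
    refine ⟨η⁻¹, h', by rwa [inv_inv], ?_⟩
    simp only [Pi.inv_apply, abs_inv, Real.log_inv]
    ext <;> simp
    ring

variable {θ}

theorem sum_log_eq_zero {η : Fin 3 → ℝ} (h : η ∈ cubicUnits θ) (i : Fin 3) :
    Real.log |η i| + Real.log |η (i + 1)| + Real.log |η (i + 2)| = 0 := by
  have h0 := fun j => abs_ne_zero.2 (cubicUnits_ne_zero h j)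
  rw [← Real.log_mul (h0 _) (h0 _), ← Real.log_mul (mul_ne_zero (h0 _) (h0 _)) (h0 _), ← abs_mul,
    ← abs_mul]
  have e : η i * η (i + 1) * η (i + 2) = 1 := by
    rw [← h.2]
    fin_cases i <;> simp <;> ring
  rw [e]; simp

variable (ht : IsRootTriple b c d θ) (hD : rootDelta θ ≠ 0)
  (hirr : ∀ x y : ℤ, monicCubic b c d (x, y) = 0 → y = 0)

include ht hD hirr

theorem eq_zero_of_mem_logUnits_of_le (hL : 48 ≤ Real.log |rootDelta θ|) {i : Fin 3} {p : ℝ × ℝ}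
    (hp : p ∈ logUnits θ i) (h1 : |p.1| ≤ 2 / 7 * Real.log |rootDelta θ|)
    (h2 : |p.2| ≤ 2 / 7 * Real.log |rootDelta θ|) : p = 0 := by
  obtain ⟨η, h, h', rfl⟩ := hp
  have h0 := fun j => abs_pos.2 (cubicUnits_ne_zero h j)
  set H := Real.log |rootDelta θ| with hH
  simp only at h1 h2
  have hs := sum_log_eq_zero h i
  have hle : ∀ j, Real.log |η j| ≤ 2 / 7 * H := by
    rw [abs_le] at h1 h2
    have e : Real.log |η i| ≤ 2 / 7 * H ∧ Real.log |η (i + 1)| ≤ 2 / 7 * H ∧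
        Real.log |η (i + 2)| ≤ 2 / 7 * H := ⟨by linarith, by linarith, by linarith⟩
    intro j
    fin_cases i <;> fin_cases j <;> simp at e ⊢ <;> tauto
  have hexp : ∀ j, |η j| ≤ Real.exp (2 / 7 * H) := fun j => by
    rw [← Real.log_le_iff_le_exp (h0 j)]; exact hle j
  rcases cubicUnits_dichotomy ht hD hirr h with h3 | ⟨-, h3⟩
  · simp [h3]
  · exfalso
    have hsub : ∀ j k, |η j - η k| ≤ 2 * Real.exp (2 / 7 * H) := fun j k =>
      (abs_sub _ _).trans (by linarith [hexp j, hexp k])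
    have h4 : |(η 1 - η 2) * (η 2 - η 0) * (η 0 - η 1)| ≤
        2 * Real.exp (2 / 7 * H) * (2 * Real.exp (2 / 7 * H)) * (2 * Real.exp (2 / 7 * H)) := by
      rw [abs_mul, abs_mul]
      gcongr <;> apply hsub
    have h5 : |rootDelta θ| = Real.exp (1 / 7 * H) * (Real.exp (2 / 7 * H) *
        Real.exp (2 / 7 * H) * Real.exp (2 / 7 * H)) := by
      rw [← Real.exp_add, ← Real.exp_add, ← Real.exp_add, ← Real.exp_log (abs_pos.2 hD), ← hH]
      congr 1; ring
    have h6 : 8 < Real.exp (1 / 7 * H) := by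
      have := Real.add_one_le_exp (1 / 14 * H)
      have e : Real.exp (1 / 7 * H) = Real.exp (1 / 14 * H) * Real.exp (1 / 14 * H) := by
        rw [← Real.exp_add]; congr 1; ring
      rw [e]; nlinarith
    have h7 := Real.exp_pos (2 / 7 * H)
    have h8 : 0 < Real.exp (2 / 7 * H) * Real.exp (2 / 7 * H) * Real.exp (2 / 7 * H) := by
      positivity
    nlinarith [h3.trans h4]

omit hD in
theorem forall_abs_eq_one_of_sq_eq (hD : rootDelta θ ≠ 0) {η : Fin 3 → ℝ} (h : η ∈ cubicUnits θ)
    {i j : Fin 3} (hij : i ≠ j) (h2 : |η i| = |η j|) : ∀ k, |η k| = 1 := by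
  rcases cubicUnits_dichotomy ht hD hirr (pow_mem h 2) with h3 | ⟨h3, -⟩
  · intro k
    have := h3 k
    rw [Pi.pow_apply, abs_pow] at this
    exact (pow_eq_one_iff_of_nonneg (abs_nonneg _) two_ne_zero).1 this
  · exact absurd (h3 (by simpa [sq_eq_sq_iff_abs_eq_abs] using h2)) hij

theorem eq_zero_of_mem_logUnits_of_snd {i : Fin 3} {p : ℝ × ℝ}
    (hp : p ∈ logUnits θ i) (h2 : p.2 = 0) : p = 0 := by
  obtain ⟨η, h, h', rfl⟩ := hp
  have h0 := fun j => abs_pos.2 (cubicUnits_ne_zero h j)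
  have h3 := forall_abs_eq_one_of_sq_eq ht hirr hD h (i := i + 1) (j := i + 2)
    (by fin_cases i <;> simp) (Real.log_injOn_pos (h0 _) (h0 _) (by simpa [sub_eq_zero] using h2))
  simp [h3]

omit hD hirr in
theorem sub_mem_logUnits (hD : rootDelta θ ≠ 0) (i : Fin 3) {P Q : ℤ × ℤ}
    (hP : monicCubic b c d P = 1) (hQ : monicCubic b c d Q = 1) :
    (Real.log |rootForm θ i Q| - Real.log |rootForm θ i P|,
      Real.log |rootForm θ (i + 1) P| - Real.log |rootForm θ (i + 2) P| -
      (Real.log |rootForm θ (i + 1) Q| - Real.log |rootForm θ (i + 2) Q|)) ∈ logUnits θ i := by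
  have key : ∀ {P : ℤ × ℤ}, monicCubic b c d P = 1 → ∀ j, Real.log |rootForm θ j P| =
      Real.log |θ (j + 1) - θ (j + 2)| + Real.log |linForm θ j P| := by
    intro P hP j
    have h1 : rootForm θ j P ≠ 0 := by
      intro h0
      have := ht.rootForm_prod j P
      rw [h0, hP] at this
      simp at this
      exact hD this.symm
    rw [rootForm] at h1 ⊢
    rw [abs_mul, Real.log_mul (abs_ne_zero.2 (left_ne_zero_of_mul h1))
      (abs_ne_zero.2 (right_ne_zero_of_mul h1))]
  have h1 := linForm_mem_cubicUnits ht hP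
  have h2 := linForm_inv_mem_cubicUnits ht hP
  have k1 := linForm_mem_cubicUnits ht hQ
  have k2 := linForm_inv_mem_cubicUnits ht hQ
  refine ⟨(fun i => linForm θ i P) * (fun i => linForm θ i Q)⁻¹, mul_mem h1 k2, ?_, ?_⟩
  · rw [mul_inv, inv_inv]; exact mul_mem h2 k1
  · have e := fun j => Real.log_mul (abs_ne_zero.2 (cubicUnits_ne_zero h1 j))
      (abs_ne_zero.2 (cubicUnits_ne_zero k2 j))
    simp only [Pi.mul_apply, abs_mul, e]
    simp only [Pi.inv_apply, abs_inv, Real.log_inv, key hP, key hQ]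
    ext <;> simp <;> ring

end LogUnits

section Dirichlet

variable {G : AddSubgroup (ℝ × ℝ)} {H : ℝ}

theorem lt_of_discrete_of_det_ne_zero (hG : ∀ p ∈ G, |p.1| ≤ H → |p.2| ≤ H → p = 0) (hH : 1 ≤ H)
    {v z : ℝ × ℝ} (hv : v ∈ G) (hz : z ∈ G) {τ : ℝ} (h1 : 1 ≤ v.1) (h2 : v.1 ≤ z.1)
    (h3 : |v.2| ≤ τ) (h4 : |z.2| ≤ τ) (hdet : v.1 * z.2 - z.1 * v.2 ≠ 0) : H < 6 * τ * z.1 := by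
  by_contra! hle
  have hv0 : 0 < v.1 := by linarith
  have hq0 : 0 < z.1 / v.1 := div_pos (by linarith) hv0
  have hn : 0 < ⌈v.1⌉₊ := Nat.ceil_pos.2 hv0
  obtain ⟨j, k, hk0, hkn, hjk⟩ := Real.exists_int_int_abs_mul_sub_le (z.1 / v.1) hn
  have hn1 : (⌈v.1⌉₊ : ℝ) ≤ v.1 + 1 := (Nat.ceil_lt_add_one hv0.le).le
  have hn2 : v.1 ≤ (⌈v.1⌉₊ : ℝ) := Nat.le_ceil _
  have hkn' : (k : ℝ) ≤ ⌈v.1⌉₊ := by exact_mod_cast hkn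
  have hk0' : (0 : ℝ) < k := by exact_mod_cast hk0
  have hτ : 0 ≤ τ := (abs_nonneg _).trans h3
  set n : ℝ := (⌈v.1⌉₊ : ℝ)
  have e1 : |k * z.1 - j * v.1| ≤ 1 := by
    have : k * z.1 - j * v.1 = (k * (z.1 / v.1) - j) * v.1 := by field_simp
    rw [this, abs_mul, abs_of_pos hv0]
    calc |k * (z.1 / v.1) - j| * v.1 ≤ 1 / (n + 1) * (n + 1) := by gcongr; linarith
      _ = 1 := div_mul_cancel₀ _ (by linarith)
  have e2 : |(j : ℝ)| ≤ k * (z.1 / v.1) + 1 := by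
    have h5 : |k * (z.1 / v.1) - j| ≤ 1 := hjk.trans (by
      rw [div_le_one (by linarith)]; linarith)
    rw [abs_le] at h5
    have h6 : 0 ≤ k * (z.1 / v.1) := by positivity
    rw [abs_le]
    constructor <;> linarith
  have hmem : k • z - j • v ∈ G := sub_mem (zsmul_mem hz k) (zsmul_mem hv j)
  have hzero := hG _ hmem (by simpa using e1.trans hH) ?_
  · have q1 : k * z.1 = j * v.1 := by
      have := congrArg Prod.fst hzero
      simpa [sub_eq_zero] using this
    have q2 : k * z.2 = j * v.2 := by
      have := congrArg Prod.snd hzero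
      simpa [sub_eq_zero] using this
    apply hdet
    have : k * (v.1 * z.2 - z.1 * v.2) = 0 := by linear_combination v.1 * q2 - v.2 * q1
    exact (mul_eq_zero.1 this).resolve_left hk0'.ne'
  · refine le_trans ?_ hle
    simp only [Prod.snd_sub, zsmul_eq_mul]
    calc |k * z.2 - j * v.2| ≤ k * τ + (k * (z.1 / v.1) + 1) * τ := by
          refine (abs_sub _ _).trans ?_
          rw [abs_mul, abs_mul, abs_of_pos hk0']
          gcongr
      _ ≤ (2 * v.1) * τ + ((2 * v.1) * (z.1 / v.1) + 1) * τ := by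
          have : (k : ℝ) ≤ 2 * v.1 := by linarith
          gcongr
      _ = (2 * v.1 + 2 * z.1 + 1) * τ := by field_simp; ring
      _ ≤ 6 * z.1 * τ := by gcongr; linarith
      _ = 6 * τ * z.1 := by ring

theorem exists_int_relation (hG : ∀ p ∈ G, |p.1| ≤ H → |p.2| ≤ H → p = 0)
    {v ω z : ℝ × ℝ} (hv : v ∈ G) (hω : ω ∈ G) (hz : z ∈ G)
    (h1 : |v.1| + |ω.1| ≤ 1000 * H) (h2 : |v.2| + |ω.2| ≤ 1000 * H)
    (hdet : v.1 * ω.2 - ω.1 * v.2 ≠ 0) :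
    ∃ j a b : ℤ, 0 < j ∧ j ≤ 10 ^ 9 ∧ j • z = a • v + b • ω := by
  set Δ := v.1 * ω.2 - ω.1 * v.2 with hΔ
  set α := (z.1 * ω.2 - ω.1 * z.2) / Δ
  set β := (v.1 * z.2 - z.1 * v.2) / Δ
  have hz1 : z.1 = α * v.1 + β * ω.1 := by
    simp only [α, β]; field_simp; rw [hΔ]; ring
  have hz2 : z.2 = α * v.2 + β * ω.2 := by
    simp only [α, β]; field_simp; rw [hΔ]; ring
  obtain ⟨a, k, hk0, hk, ha⟩ := Real.exists_int_int_abs_mul_sub_le α (n := 10 ^ 6) (by norm_num)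
  obtain ⟨b, m, hm0, hm, hb⟩ := Real.exists_int_int_abs_mul_sub_le (k * β) (n := 1000) (by norm_num)
  have hm0' : (0 : ℝ) < m := by exact_mod_cast hm0
  have hm' : (m : ℝ) ≤ 1000 := by exact_mod_cast hm
  have ha' : |m * (k * α - a)| ≤ 1 / 1000 := by
    rw [abs_mul, abs_of_pos hm0']
    calc (m : ℝ) * |k * α - a| ≤ 1000 * (1 / ((10 ^ 6 : ℕ) + 1)) := by gcongr
      _ ≤ _ := by norm_num
  have hb' : |m * (k * β) - b| ≤ 1 / 1000 := hb.trans (by norm_num)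
  have bound : ∀ x y : ℝ, |x| + |y| ≤ 1000 * H →
      |m * (k * α - a) * x + (m * (k * β) - b) * y| ≤ H := by
    intro x y hxy
    calc _ ≤ 1 / 1000 * |x| + 1 / 1000 * |y| := by
          refine (abs_add_le _ _).trans ?_
          rw [abs_mul, abs_mul _ y]
          gcongr
      _ ≤ H := by linarith
  have hmem : (m * k) • z - ((m * a) • v + b • ω) ∈ G :=
    sub_mem (zsmul_mem hz _) (add_mem (zsmul_mem hv _) (zsmul_mem hω _))
  refine ⟨m * k, m * a, b, by positivity, by push_cast at hk hm; nlinarith, ?_⟩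
  refine sub_eq_zero.1 (hG _ hmem ?_ ?_)
  · convert bound v.1 ω.1 h1 using 2
    simp
    rw [hz1]; ring
  · convert bound v.2 ω.2 h2 using 2
    simp
    rw [hz2]; ring

end Dirichlet

section Arms

variable {θ : Fin 3 → ℝ} {b c d : ℤ}

/-- The logarithm of the size of a point. -/
noncomputable def logSize (θ : Fin 3 → ℝ) (P : ℤ × ℤ) : ℝ :=
  Real.log (rootSize (fun i => (θ i : ℂ)) P)

theorem IsRootTriple.ofReal (ht : IsRootTriple b c d θ) :
    IsRootTriple b c d (fun i => (θ i : ℂ)) := ht.map Complex.ofRealHom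

theorem norm_rootForm_ofReal (i : Fin 3) (P : ℤ × ℤ) :
    ‖rootForm (fun i => (θ i : ℂ)) i P‖ = |rootForm θ i P| := by
  rw [← Real.norm_eq_abs, ← Complex.norm_real]
  exact congrArg _ (map_rootForm Complex.ofRealHom i P).symm

theorem norm_rootDelta_ofReal : ‖rootDelta (fun i => (θ i : ℂ))‖ = |rootDelta θ| := by
  rw [← Real.norm_eq_abs, ← Complex.norm_real]
  simp [rootDelta]

variable {P : ℤ × ℤ} {i : Fin 3}

theorem IsRootTriple.rootForm_ne_zero {F : Type*} [Field F] {t : Fin 3 → F}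
    (ht : IsRootTriple b c d t) (hD : rootDelta t ≠ 0) (hP : monicCubic b c d P = 1) (i : Fin 3) :
    rootForm t i P ≠ 0 := by
  intro h0
  have := ht.rootForm_prod i P
  rw [h0, hP] at this
  simp at this
  exact hD this.symm

theorem cubicDisc_ne_zero_of_rootDelta (ht : IsRootTriple b c d θ) (hD : rootDelta θ ≠ 0) :
    cubicDisc 1 b c d ≠ 0 := by
  intro h
  have := ht.rootDelta_sq
  rw [h] at this
  simp at this
  exact hD this

variable (ht : IsRootTriple b c d θ) (hD : rootDelta θ ≠ 0) (hP : monicCubic b c d P = 1)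

include ht hD hP

theorem log_rootForm_le_logSize (j : Fin 3) : Real.log |rootForm θ j P| ≤ logSize θ P := by
  refine Real.log_le_log (abs_pos.2 (ht.rootForm_ne_zero hD hP j)) ?_
  rw [← norm_rootForm_ofReal]
  exact norm_rootForm_le _ j P

theorem sum_log_rootForm (j : Fin 3) : Real.log |rootForm θ j P| + Real.log |rootForm θ (j + 1) P| +
    Real.log |rootForm θ (j + 2) P| = Real.log |rootDelta θ| := by
  have h0 := fun j => abs_ne_zero.2 (ht.rootForm_ne_zero hD hP j)
  rw [← Real.log_mul (h0 _) (h0 _), ← Real.log_mul (mul_ne_zero (h0 _) (h0 _)) (h0 _), ← abs_mul,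
    ← abs_mul, ht.rootForm_prod, hP]
  simp

theorem le_log_rootForm (j : Fin 3) :
    Real.log |rootDelta θ| - 2 * logSize θ P ≤ Real.log |rootForm θ j P| := by
  have h1 := sum_log_rootForm ht hD hP j
  have h2 := log_rootForm_le_logSize ht hD hP (j + 1)
  have h3 := log_rootForm_le_logSize ht hD hP (j + 2)
  linarith

variable (hi : IsNearRoot (fun i => (θ i : ℂ)) i P)

include hi

theorem IsNearRoot.log_bounds :
    Real.log |rootForm θ i P| ≤ Real.log |rootDelta θ| - 2 * logSize θ P + 2 ∧
    logSize θ P - 1 ≤ Real.log |rootForm θ (i + 1) P| ∧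
    logSize θ P - 1 ≤ Real.log |rootForm θ (i + 2) P| := by
  have h0 := ht.ofReal.rootSize_pos (cubicDisc_ne_zero_of_rootDelta ht hD) hP
  obtain ⟨h1, h2⟩ := hi.half_le
  rw [norm_rootForm_ofReal] at h1 h2
  have e1 := Real.log_le_log h0 h1
  have e2 := Real.log_le_log h0 h2
  rw [Real.log_mul two_ne_zero (abs_ne_zero.2 (ht.rootForm_ne_zero hD hP _))] at e1 e2
  have e3 := Real.log_two_lt_d9
  have e4 := sum_log_rootForm ht hD hP i
  rw [← logSize] at e1 e2
  refine ⟨by linarith, by linarith, by linarith⟩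

theorem IsNearRoot.abs_log_sub :
    Real.exp (Real.log |rootDelta θ| - 3 * logSize θ P) ≤
      |(Real.log |rootForm θ (i + 1) P| - Real.log |rootForm θ (i + 2) P|)| ∧
    |(Real.log |rootForm θ (i + 1) P| - Real.log |rootForm θ (i + 2) P|)| ≤
      4 * Real.exp (Real.log |rootDelta θ| - 3 * logSize θ P) := by
  have h0 := ht.ofReal.rootSize_pos (cubicDisc_ne_zero_of_rootDelta ht hD) hP
  have hD0 := cubicDisc_ne_zero_of_rootDelta ht hD
  have h1 := hi.half_le
  have h2 := hi.norm_le ht.ofReal hD0 hP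
  have h3 := ht.ofReal.norm_rootForm_prod i hP
  have h4 := norm_rootForm_le (fun i => (θ i : ℂ)) (i + 1) P
  have h5 := norm_rootForm_le (fun i => (θ i : ℂ)) (i + 2) P
  have h6 := hi (i + 1)
  have h7 := hi (i + 2)
  have hW : Real.exp (Real.log |rootDelta θ| - 3 * logSize θ P) =
      |rootDelta θ| / rootSize (fun i => (θ i : ℂ)) P ^ 3 := by
    rw [Real.exp_sub, Real.exp_log (abs_pos.2 hD), logSize, ← Real.exp_log (pow_pos h0 3),
      Real.log_pow]
    norm_num
  rw [hW]
  simp only [norm_rootForm_ofReal, norm_rootDelta_ofReal] at *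
  set U := rootSize (fun i => (θ i : ℂ)) P
  have p0 := abs_pos.2 (ht.rootForm_ne_zero hD hP i)
  have p1 := abs_pos.2 (ht.rootForm_ne_zero hD hP (i + 1))
  have p2 := abs_pos.2 (ht.rootForm_ne_zero hD hP (i + 2))
  have hsum := rootForm_sum θ i P
  have hdiff : |rootForm θ (i + 1) P| = |rootForm θ (i + 2) P| + |rootForm θ i P| ∨
      |rootForm θ (i + 2) P| = |rootForm θ (i + 1) P| + |rootForm θ i P| := by
    rcases abs_cases (rootForm θ i P) with ⟨a1, _⟩ | ⟨a1, _⟩ <;>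
    rcases abs_cases (rootForm θ (i + 1) P) with ⟨a2, _⟩ | ⟨a2, _⟩ <;>
    rcases abs_cases (rootForm θ (i + 2) P) with ⟨a3, _⟩ | ⟨a3, _⟩ <;>
    first | (left; linarith) | (right; linarith)
  have hlow : |rootDelta θ| / U ^ 3 * U ≤ |rootForm θ i P| := by
    have : |rootDelta θ| / U ^ 3 * U = |rootDelta θ| / U ^ 2 := by field_simp
    rw [this, div_le_iff₀ (by positivity), ← h3]
    have : |rootForm θ (i + 1) P| * |rootForm θ (i + 2) P| ≤ U * U := by gcongr
    nlinarith
  have main : ∀ {x y s : ℝ}, 0 < y → 0 < s → x = y + s → x ≤ U → U ≤ 2 * y →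
      |rootDelta θ| / U ^ 3 * U ≤ s → s ≤ 2 * |rootDelta θ| / U ^ 2 →
      |rootDelta θ| / U ^ 3 ≤ |Real.log x - Real.log y| ∧
      |Real.log x - Real.log y| ≤ 4 * (|rootDelta θ| / U ^ 3) := by
    intro x y s hy hs hx hxU hyU hs1 hs2
    have hx0 : 0 < x := by linarith
    have hlog : Real.log x - Real.log y = Real.log (x / y) := (Real.log_div hx0.ne' hy.ne').symm
    rw [hlog, abs_of_nonneg (Real.log_nonneg (by rw [le_div_iff₀ hy]; linarith))]
    constructor
    · refine le_trans ?_ (Real.one_sub_inv_le_log_of_pos (by positivity))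
      have : 1 - (x / y)⁻¹ = s / x := by rw [inv_div, hx]; field_simp; ring
      rw [this, le_div_iff₀ hx0]
      refine le_trans ?_ hs1
      gcongr
    · refine (Real.log_le_sub_one_of_pos (by positivity)).trans ?_
      have : x / y - 1 = s / y := by rw [hx]; field_simp; ring
      rw [this, div_le_iff₀ hy]
      calc s ≤ 2 * |rootDelta θ| / U ^ 2 := hs2
        _ = 2 * (|rootDelta θ| / U ^ 3) * U := by field_simp
        _ ≤ 2 * (|rootDelta θ| / U ^ 3) * (2 * y) := by gcongr
        _ = _ := by ring
  rcases hdiff with h | h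
  · exact main p2 p0 h h4 h1.2 hlow h2
  · rw [abs_sub_comm]
    exact main p1 p0 h h5 h1.1 hlow h2

end Arms

section ThreePoints

/-- Numerical properties of three points near the same root. -/
structure ArmData (h : ℝ) (l ℓ T : Fin 3 → ℝ) : Prop where
  le_h : 2000 ≤ h
  le_l : h ≤ 2 * l 0 + 1
  step₁ : 2 * l 0 ≤ l 1 + 2
  step₂ : 2 * l 1 ≤ l 2 + 2
  le_ℓ : ∀ k, h - 2 * l k ≤ ℓ k
  ℓ_le : ∀ k, ℓ k ≤ h - 2 * l k + 2
  le_T : ∀ k, Real.exp (h - 3 * l k) ≤ |T k|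
  T_le : ∀ k, |T k| ≤ 4 * Real.exp (h - 3 * l k)

variable {h : ℝ} {l ℓ T : Fin 3 → ℝ} (A : ArmData h l ℓ T)

namespace ArmData

include A

theorem le_fst : h - 7 ≤ ℓ 0 - ℓ 1 := by
  have := A.le_l
  have := A.step₁
  have := A.le_ℓ 0
  have := A.ℓ_le 1
  linarith

theorem two_mul_fst_le : 2 * (ℓ 0 - ℓ 1) ≤ ℓ 0 - ℓ 2 := by
  have := A.le_h
  have := A.le_l
  have := A.step₁
  have := A.step₂
  have := A.le_ℓ 0
  have := A.ℓ_le 0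
  have := A.le_ℓ 1
  have := A.ℓ_le 2
  linarith

theorem fst_le : ℓ 0 - ℓ 2 ≤ 2 * l 2 := by
  have := A.le_h
  have := A.le_l
  have := A.ℓ_le 0
  have := A.le_ℓ 2
  linarith

theorem T_zero_le : |T 0| ≤ 30 * Real.exp (-h / 2) := by
  refine (A.T_le 0).trans ?_
  have h1 : Real.exp (h - 3 * l 0) ≤ Real.exp (1 + 1) * Real.exp (-h / 2) := by
    rw [← Real.exp_add]
    gcongr
    linarith [A.le_l]
  have h2 := Real.exp_one_lt_d9
  have h3 : Real.exp (1 + 1) ≤ 7.5 := by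
    rw [Real.exp_add]
    nlinarith [Real.exp_pos 1]
  nlinarith [Real.exp_pos (-h / 2)]

theorem T_le_div {k : Fin 3} (hk : l 1 ≤ l k) : |T k| ≤ |T 0| / 100 := by
  have h1 : Real.exp 400 * Real.exp (h - 3 * l k) ≤ Real.exp (h - 3 * l 0) := by
    rw [← Real.exp_add]
    gcongr
    linarith [A.le_h, A.le_l, A.step₁]
  have h2 := Real.add_one_le_exp (400 : ℝ)
  have h3 := A.T_le k
  have h4 := A.le_T 0
  nlinarith [Real.exp_pos (h - 3 * l k)]

theorem l_one_le : l 1 ≤ l 2 := by linarith [A.le_h, A.le_l, A.step₁, A.step₂]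

theorem abs_T_sub {k : Fin 3} (hk : l 1 ≤ l k) :
    0.99 * |T 0| ≤ |T k - T 0| ∧ |T k - T 0| ≤ 1.01 * |T 0| := by
  have h1 := A.T_le_div hk
  have h2 := abs_sub_abs_le_abs_sub (T 0) (T k)
  have h3 := abs_sub (T k) (T 0)
  rw [abs_sub_comm] at h2
  constructor <;> linarith

theorem abs_snd_le {k : Fin 3} (hk : l 1 ≤ l k) : |T k - T 0| ≤ 31 * Real.exp (-h / 2) := by
  have h1 := (A.abs_T_sub hk).2
  have h2 := A.T_zero_le
  linarith [abs_nonneg (T 0), Real.exp_pos (-h / 2)]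

theorem det_ne_zero : (ℓ 0 - ℓ 1) * (T 2 - T 0) - (ℓ 0 - ℓ 2) * (T 1 - T 0) ≠ 0 := by
  intro h0
  have h1 := (A.abs_T_sub le_rfl).1
  have h2 := (A.abs_T_sub A.l_one_le).2
  have h3 := A.le_fst
  have h4 := A.two_mul_fst_le
  have h5 := A.le_h
  have h6 := A.le_T 0
  have h7 := Real.exp_pos (h - 3 * l 0)
  have h8 : |(ℓ 0 - ℓ 1) * (T 2 - T 0)| = |(ℓ 0 - ℓ 2) * (T 1 - T 0)| := by
    rw [sub_eq_zero.1 h0]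
  rw [abs_mul, abs_mul, abs_of_pos (a := ℓ 0 - ℓ 1) (by linarith),
    abs_of_pos (a := ℓ 0 - ℓ 2) (by linarith)] at h8
  have h9 : (ℓ 0 - ℓ 1) * |T 2 - T 0| ≤ (ℓ 0 - ℓ 1) * (1.01 * |T 0|) := by
    have : 0 ≤ ℓ 0 - ℓ 1 := by linarith
    gcongr
  have h10 : 2 * (ℓ 0 - ℓ 1) * (0.99 * |T 0|) ≤ (ℓ 0 - ℓ 2) * |T 1 - T 0| := by
    have : 0 ≤ ℓ 0 - ℓ 2 := by linarith
    gcongr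
  have h11 : 0 < (ℓ 0 - ℓ 1) * |T 0| := mul_pos (by linarith) (by linarith)
  linarith

theorem exp_le {G : AddSubgroup (ℝ × ℝ)}
    (hG : ∀ p ∈ G, |p.1| ≤ 2 / 7 * h → |p.2| ≤ 2 / 7 * h → p = 0)
    (hv : (ℓ 0 - ℓ 1, T 1 - T 0) ∈ G) (hz : (ℓ 0 - ℓ 2, T 2 - T 0) ∈ G) :
    Real.exp (h / 2) ≤ l 2 := by
  have h1 := A.le_h
  have h2 := A.le_fst
  have h3 := A.two_mul_fst_le
  have h4 := lt_of_discrete_of_det_ne_zero hG (by linarith) hv hz (by simp only; linarith)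
    (by simp only; linarith) (A.abs_snd_le le_rfl) (A.abs_snd_le A.l_one_le) A.det_ne_zero
  have h5 := A.fst_le
  have h6 := Real.exp_pos (-h / 2)
  have h7 : Real.exp (h / 2) * Real.exp (-h / 2) = 1 := by
    rw [← Real.exp_add]; ring_nf; simp
  have h8 : 1 ≤ Real.exp (-h / 2) * l 2 := by nlinarith
  nlinarith [Real.exp_pos (h / 2)]

theorem exp_neg_le : 31 * Real.exp (-h / 2) ≤ 1 / 40 := by
  have h1 : Real.exp (h / 2) * Real.exp (-h / 2) = 1 := by
    rw [← Real.exp_add]; ring_nf; simp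
  have h2 := Real.quadratic_le_exp_of_nonneg (x := h / 2) (by linarith [A.le_h])
  have h3 := A.le_h
  have h4 : 1240 ≤ Real.exp (h / 2) := by nlinarith
  nlinarith [Real.exp_pos (-h / 2)]

variable {w : ℝ × ℝ} (hl : l 1 ≤ 12 * h) (hw : |w.1| ≤ 40 * h) (hw' : h / 2 - 5 ≤ |w.2|)

include hw hw'

theorem le_det : h ^ 2 / 4 ≤ |(ℓ 0 - ℓ 1) * w.2 - w.1 * (T 1 - T 0)| := by
  have h1 := A.le_h
  have h2 := A.le_fst
  have h3 := A.exp_neg_le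
  have h4 := A.abs_snd_le le_rfl
  have h5 : (h - 7) * (h / 2 - 5) ≤ |(ℓ 0 - ℓ 1) * w.2| := by
    rw [abs_mul, abs_of_pos (a := ℓ 0 - ℓ 1) (by linarith)]
    have : 0 ≤ ℓ 0 - ℓ 1 := by linarith
    have : 0 ≤ h / 2 - 5 := by linarith
    gcongr
  have h6 : |w.1 * (T 1 - T 0)| ≤ 40 * h * (1 / 40) := by
    rw [abs_mul]
    gcongr
    linarith
  have h7 := abs_sub_abs_le_abs_sub ((ℓ 0 - ℓ 1) * w.2) (w.1 * (T 1 - T 0))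
  nlinarith

include hl

theorem exists_relation {G : AddSubgroup (ℝ × ℝ)}
    (hG : ∀ p ∈ G, |p.1| ≤ 2 / 7 * h → |p.2| ≤ 2 / 7 * h → p = 0)
    (hv : (ℓ 0 - ℓ 1, T 1 - T 0) ∈ G) (hz : (ℓ 0 - ℓ 2, T 2 - T 0) ∈ G) (hwG : w ∈ G)
    (hw2 : |w.2| ≤ 40 * h) :
    ∃ j a b : ℤ, 0 < j ∧ j ≤ 10 ^ 9 ∧
      j * (T 2 - T 0) = a * (T 1 - T 0) + b * w.2 ∧
      |(a : ℝ)| ≤ 10 ^ 9 * l 2 ∧ |(b : ℝ)| ≤ 10 ^ 9 * l 2 := by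
  have h1 := A.le_h
  have h2 := A.le_fst
  have h3 := A.exp_neg_le
  have h4 := A.abs_snd_le le_rfl
  have h4' := A.abs_snd_le A.l_one_le
  have h5 := A.le_det hw hw'
  have h6 := A.two_mul_fst_le
  have h7 := A.fst_le
  have h8 : ℓ 0 - ℓ 1 ≤ 25 * h := by
    linarith [A.ℓ_le 0, A.le_ℓ 1, A.le_l]
  have e1 : |ℓ 0 - ℓ 1| = ℓ 0 - ℓ 1 := abs_of_pos (by linarith)
  have e2 : |ℓ 0 - ℓ 2| = ℓ 0 - ℓ 2 := abs_of_pos (by linarith)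
  obtain ⟨j, a, b, hj0, hj, hrel⟩ := exists_int_relation hG hv hwG hz
    (by simp only [e1]; linarith) (by simp only; linarith)
    (abs_pos.1 (by simp only; nlinarith))
  have r1 : j * (ℓ 0 - ℓ 2) = a * (ℓ 0 - ℓ 1) + b * w.1 := by
    simpa using congrArg Prod.fst hrel
  have r2 : j * (T 2 - T 0) = a * (T 1 - T 0) + b * w.2 := by
    simpa using congrArg Prod.snd hrel
  refine ⟨j, a, b, hj0, hj, r2, ?_, ?_⟩
  all_goals
    have hj0' : (0 : ℝ) < j := by exact_mod_cast hj0
    have hj' : (j : ℝ) ≤ 10 ^ 9 := by exact_mod_cast hj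
    set Δ := (ℓ 0 - ℓ 1) * w.2 - w.1 * (T 1 - T 0) with hΔ
  · have k1 : a * Δ = j * ((ℓ 0 - ℓ 2) * w.2 - w.1 * (T 2 - T 0)) := by
      rw [hΔ]; linear_combination w.1 * r2 - w.2 * r1
    have k2 : |(a : ℝ)| * |Δ| ≤ 10 ^ 9 * (2 * l 2 * (40 * h) + 40 * h * 1) := by
      rw [← abs_mul, k1, abs_mul, abs_of_pos hj0']
      gcongr
      refine (abs_sub _ _).trans ?_
      rw [abs_mul, abs_mul, e2]
      gcongr
      · linarith
      · linarith
    have k3 : |(a : ℝ)| * (h ^ 2 / 4) ≤ |(a : ℝ)| * |Δ| := by gcongr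
    by_contra! hcon
    have hl2 : 1000 ≤ l 2 := by linarith
    have k4 : 10 ^ 9 * l 2 * (h ^ 2 / 4) ≤ |(a : ℝ)| * (h ^ 2 / 4) := by gcongr
    have k5 : l 2 * (h ^ 2 / 4) ≤ (2 * l 2 * (40 * h) + 40 * h * 1) := by linarith
    have k6 : l 2 * (h ^ 2 / 4) ≤ 81 * l 2 * h := by nlinarith
    have k7 : 0 < l 2 * h := by positivity
    nlinarith
  · have k1 : b * Δ = j * ((ℓ 0 - ℓ 1) * (T 2 - T 0) - (ℓ 0 - ℓ 2) * (T 1 - T 0)) := by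
      rw [hΔ]; linear_combination (T 1 - T 0) * r1 - (ℓ 0 - ℓ 1) * r2
    have k2 : |(b : ℝ)| * |Δ| ≤ 10 ^ 9 * (25 * h * 1 + 2 * l 2 * 1) := by
      rw [← abs_mul, k1, abs_mul, abs_of_pos hj0']
      gcongr
      refine (abs_sub _ _).trans ?_
      rw [abs_mul, abs_mul, e1, e2]
      gcongr
      · linarith
      · linarith
      · linarith
    have k3 : |(b : ℝ)| * (h ^ 2 / 4) ≤ |(b : ℝ)| * |Δ| := by gcongr
    by_contra! hcon
    have hl2 : 1000 ≤ l 2 := by linarith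
    have k4 : 10 ^ 9 * l 2 * (h ^ 2 / 4) ≤ |(b : ℝ)| * (h ^ 2 / 4) := by gcongr
    have k5 : l 2 * (h ^ 2 / 4) ≤ 25 * h * 1 + 2 * l 2 * 1 := by linarith
    have k7 : 0 < l 2 * h := by positivity
    nlinarith

end ArmData

end ThreePoints

section LinearForm

theorem pow_nine_mul_le_exp {X : ℝ} (hX : 100000 ≤ X) : 8 * 10 ^ 9 * X ^ 9 ≤ Real.exp X := by
  have h := Real.pow_div_factorial_le_exp X (by linarith) 13
  refine le_trans ?_ h
  rw [le_div_iff₀ (by positivity)]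
  have h1 : ((Nat.factorial 13 : ℕ) : ℝ) = 6227020800 := by norm_num [Nat.factorial]
  rw [h1]
  have h2 : (100000 : ℝ) ^ 4 ≤ X ^ 4 := by gcongr
  have h3 : 0 < X ^ 9 := by positivity
  have h4 : X ^ 13 = X ^ 4 * X ^ 9 := by ring
  rw [h4]
  nlinarith

variable {L : Type*} [Field L] [NumberField L]

/-- A nonvanishing inhomogeneous linear form in three logarithms of algebraic numbers with
integer coefficients, the first coefficient being one, is not too small. -/
theorem linearForm_elim {X : ℕ} (hX : 100000 ≤ X) (hL : Module.finrank ℚ L ≤ 6) (φ₀ : L →+* ℂ)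
    {β : Fin 4 → L} (hβ : ∀ k, IsIntegral ℤ (β k))
    (hβX : ∀ (φ : L →+* ℂ) k, ‖φ (β k)‖ ≤ Real.exp X) {l : Fin 4 → ℝ}
    (hl : ∀ k, φ₀ (β k) = Complex.exp (l k : ℝ)) {a b : ℤ} (h0 : |l 0| ≤ X)
    (h2 : |l 2| ≤ X) (h3 : |l 3| ≤ X) (hab : |a * l 2 + b * l 3| ≤ X)
    (ha : |(a : ℝ)| ≤ Real.exp X) (hb : |(b : ℝ)| ≤ Real.exp X)
    (hind : ∀ p q : ℤ, p * l 2 + q * l 3 = 0 → p = 0 ∧ q = 0)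
    (hne : l 1 - l 0 + a * l 2 + b * l 3 ≠ 0)
    (hle : |l 1 - l 0 + a * l 2 + b * l 3| ≤ Real.exp (-(2 * (X : ℝ) ^ 60))) : False := by
  set Λ := l 1 - l 0 + a * l 2 + b * l 3 with hΛ
  have hXR : (100000 : ℝ) ≤ X := by exact_mod_cast hX
  have hX9 := pow_nine_mul_le_exp hXR
  have hX0 : (0 : ℝ) < X ^ 9 := by positivity
  have he1 : 1 ≤ Real.exp (X : ℝ) := Real.one_le_exp (by positivity)
  have hlt : ∀ x : Fin (X ^ 9), ((x : ℕ) : ℝ) ≤ X ^ 9 := fun x => by exact_mod_cast x.2.le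
  have hnn : ∀ x : Fin (X ^ 9), (0 : ℝ) ≤ ((x : ℕ) : ℝ) := fun x => by positivity
  let ι := Fin (X ^ 9) × Fin (X ^ 9) × Fin (X ^ 9)
  let B : ι → L := fun i => β 1 ^ (i.1 : ℕ) * β 0 ^ (X ^ 9 - i.1 : ℕ) * β 2 ^ (i.2.1 : ℕ) *
    β 3 ^ (i.2.2 : ℕ)
  let c : ι → ℤ := fun i => i.2.1 - a * i.1
  let c' : ι → ℤ := fun i => i.2.2 - b * i.1
  have coeff : ∀ (x y : Fin (X ^ 9)) (m : ℤ), |(m : ℝ)| ≤ Real.exp X →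
      |(((y : ℤ) - m * (x : ℤ) : ℤ) : ℝ)| ≤ Real.exp (2 * X) := by
    intro x y m hm
    push_cast
    calc |((y : ℕ) : ℝ) - m * ((x : ℕ) : ℝ)| ≤ X ^ 9 + Real.exp X * X ^ 9 := by
          refine (abs_sub _ _).trans ?_
          rw [abs_mul, abs_of_nonneg (hnn x), abs_of_nonneg (hnn y)]
          gcongr
          · exact hlt y
          · exact hlt x
      _ ≤ Real.exp X * Real.exp X := by nlinarith
      _ = _ := by rw [← Real.exp_add]; ring_nf
  have value : ∀ i : ι, φ₀ (B i) = Complex.exp ((X ^ 9 * l 0 + (c i * l 2 + c' i * l 3) +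
      (i.1 : ℕ) * Λ : ℝ) : ℂ) := by
    intro i
    simp only [B, map_mul, map_pow, hl, ← Complex.exp_nat_mul, ← Complex.exp_add]
    congr 1
    rw [Nat.cast_sub i.1.2.le]
    simp only [c, c', hΛ]
    push_cast
    ring
  have inj0 : ∀ i j : ι, B i = B j → i.1 = j.1 → i = j := by
    intro i j hij h1
    have h := value i
    rw [hij, value j, ← Complex.ofReal_exp, ← Complex.ofReal_exp, Complex.ofReal_inj,
      Real.exp_eq_exp, h1] at h
    simp only [c, c', h1] at h
    push_cast at h
    have h4 := hind (j.2.1 - i.2.1) (j.2.2 - i.2.2) (by push_cast; linarith)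
    have h5 : (j.2.1 : ℕ) = i.2.1 := by exact_mod_cast sub_eq_zero.1 h4.1
    have h6 : (j.2.2 : ℕ) = i.2.2 := by exact_mod_cast sub_eq_zero.1 h4.2
    ext
    · rw [h1]
    · exact h5.symm
    · exact h6.symm
  refine BakerSystem.elim (L := L) (ι := ι)
    { X := X, φ₀ := φ₀, B := B, c := c, c' := c', l₁ := l 2, l₂ := l 3, κ := X ^ 9 * l 0,
      e := fun i => (i.1 : ℕ) * Λ, finrank_le := hL, le_X := hX, card_eq := ?_,
      isIntegral := fun i => ((((hβ _).pow _).mul ((hβ _).pow _)).mul ((hβ _).pow _)).mul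
        ((hβ _).pow _), norm_B_le := ?_, abs_c_le := fun i => coeff _ _ _ ha,
      abs_c'_le := fun i => coeff _ _ _ hb, abs_l₁_le := h2, abs_l₂_le := h3, abs_κ_le := ?_,
      abs_e_le := ?_, abs_freq_le := ?_, φ₀_B := value, fiber := ?_, inj := ?_ }
  · simp only [ι, Fintype.card_prod, Fintype.card_fin]
    ring
  · intro φ i
    simp only [B, map_mul, map_pow, norm_mul, norm_pow]
    calc _ ≤ Real.exp X ^ (i.1 : ℕ) * Real.exp X ^ (X ^ 9 - i.1 : ℕ) * Real.exp X ^ (X ^ 9) *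
          Real.exp X ^ (X ^ 9) := by
          have m : ∀ (k : Fin 4) (x : Fin (X ^ 9)), ‖φ (β k)‖ ^ (x : ℕ) ≤
              Real.exp X ^ (X ^ 9) := fun k x =>
            (pow_le_pow_left₀ (norm_nonneg _) (hβX φ k) _).trans (pow_le_pow_right₀ he1 x.2.le)
          gcongr
          · exact hβX φ 1
          · exact hβX φ 0
          · exact m 2 _
          · exact m 3 _
      _ = _ := by
          rw [← pow_add, Nat.add_sub_of_le i.1.2.le, ← Real.exp_nat_mul, ← Real.exp_add,
            ← Real.exp_add]
          push_cast
          congr 1; ring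
  · rw [abs_mul, abs_of_pos hX0]
    calc (X : ℝ) ^ 9 * |l 0| ≤ X ^ 9 * X := by gcongr
      _ ≤ 2 * (X : ℝ) ^ 10 := by nlinarith [pow_pos (show (0 : ℝ) < X by linarith) 10]
  · intro i
    rw [abs_mul, abs_of_nonneg (hnn _)]
    calc ((i.1 : ℕ) : ℝ) * |Λ| ≤ Real.exp ((X : ℝ) ^ 60) * Real.exp (-(2 * (X : ℝ) ^ 60)) := by
          have h5 : (X : ℝ) ≤ X ^ 60 := le_self_pow₀ (by linarith) (by norm_num)
          have h6 : Real.exp X ≤ Real.exp ((X : ℝ) ^ 60) := Real.exp_le_exp.2 h5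
          gcongr
          linarith [hlt i.1]
      _ = _ := by rw [← Real.exp_add]; ring_nf
  · intro i
    have h5 : (c i * l 2 + c' i * l 3) = ((i.2.1 : ℕ) : ℝ) * l 2 + ((i.2.2 : ℕ) : ℝ) * l 3 -
        ((i.1 : ℕ) : ℝ) * (a * l 2 + b * l 3) := by
      simp only [c, c']; push_cast; ring
    rw [h5]
    have m : ∀ (x : Fin (X ^ 9)) {y : ℝ}, |y| ≤ X → |((x : ℕ) : ℝ) * y| ≤ X ^ 9 * X := by
      intro x y hy
      rw [abs_mul, abs_of_nonneg (hnn x)]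
      gcongr
      exact hlt x
    have m1 := m i.2.1 h2
    have m2 := m i.2.2 h3
    have m3 := m i.1 hab
    have m4 : (0 : ℝ) ≤ X ^ 9 * X := by positivity
    have m5 : 4 * (X : ℝ) ^ 10 = 4 * (X ^ 9 * X) := by ring
    rw [m5]
    refine (abs_sub _ _).trans ?_
    linarith [abs_add_le (((i.2.1 : ℕ) : ℝ) * l 2) (((i.2.2 : ℕ) : ℝ) * l 3)]
  · intro i
    classical
    refine ⟨Finset.univ.filter fun j => B j = B i, ?_, fun j hj => by simpa using hj⟩
    calc _ ≤ (Finset.univ : Finset (Fin (X ^ 9))).card := by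
          refine Finset.card_le_card_of_injOn (fun j => j.1) (fun _ _ => Finset.mem_univ _) ?_
          intro j hj k hk hjk
          simp only [Finset.coe_filter, Finset.mem_univ, true_and, Set.mem_ofPred_eq] at hj hk
          exact inj0 j k (hj.trans hk.symm) hjk
      _ = X ^ 9 := by simp
      _ ≤ X ^ 12 := Nat.pow_le_pow_right (by omega) (by norm_num)
  · intro i j hij hc hc'
    refine inj0 i j hij ?_
    have h := value i
    rw [hij, value j, ← Complex.ofReal_exp, ← Complex.ofReal_exp, Complex.ofReal_inj,
      Real.exp_eq_exp, hc, hc'] at h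
    have h5 : ((j.1 : ℕ) : ℝ) = (i.1 : ℕ) := mul_right_cancel₀ hne (by linarith)
    ext
    exact_mod_cast h5.symm

end LinearForm

section Conjugates

theorem exists_pow_log_le (C : ℝ) (n : ℕ) :
    ∃ H : ℝ, 2000 ≤ H ∧ ∀ h, H ≤ h → ∀ x, Real.exp (h / 2) ≤ x → (C * Real.log x) ^ n ≤ x := by
  have h1 := (Real.isLittleO_pow_log_id_atTop (n := n)).def (c := 1 / (|C| + 1) ^ n) (by positivity)
  obtain ⟨N, hN⟩ := Filter.eventually_atTop.1 h1
  refine ⟨max 2000 (2 * N), le_max_left _ _, fun h hh x hx => ?_⟩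
  have h2 : 2 * N ≤ h := (le_max_right _ _).trans hh
  have h3 := Real.add_one_le_exp (h / 2)
  have hx0 : 0 < x := (Real.exp_pos _).trans_le hx
  have h4 := hN x (by linarith)
  simp only [id, Real.norm_eq_abs, abs_of_pos hx0] at h4
  rw [one_div, ← div_eq_inv_mul, le_div_iff₀ (by positivity)] at h4
  calc (C * Real.log x) ^ n ≤ |(C * Real.log x) ^ n| := le_abs_self _
    _ = |Real.log x ^ n| * |C| ^ n := by rw [mul_pow, abs_mul, abs_pow C, mul_comm]
    _ ≤ |Real.log x ^ n| * (|C| + 1) ^ n := by gcongr; linarith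
    _ ≤ x := h4

/-- Two root triples of the same separable cubic agree up to a permutation. -/
theorem exists_norm_rootForm_eq {b c d : ℤ} {s s' : Fin 3 → ℂ} (hs : IsRootTriple b c d s)
    (hs' : IsRootTriple b c d s') (hD : rootDelta s ≠ 0) :
    ∃ σ : Fin 3 → Fin 3, ∀ i P, ‖rootForm s' i P‖ = ‖rootForm s (σ i) P‖ := by
  have hD' : rootDelta s' ≠ 0 := by
    intro h
    have h1 := hs'.rootDelta_sq
    rw [← hs.rootDelta_sq, h] at h1
    rw [zero_pow two_ne_zero] at h1
    exact hD (pow_eq_zero_iff two_ne_zero |>.1 h1.symm)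
  have h1 : ∀ i, ∃ j, s' i = s j := by
    intro i
    have e : (s' i - s 0) * (s' i - s 1) * (s' i - s 2) = 0 := by
      have a1 : s' 0 + s' 1 + s' 2 = s 0 + s 1 + s 2 := by rw [hs.sum, hs'.sum]
      have a2 : s' 0 * s' 1 + s' 1 * s' 2 + s' 2 * s' 0 = s 0 * s 1 + s 1 * s 2 + s 2 * s 0 := by
        rw [hs.pair, hs'.pair]
      have a3 : s' 0 * s' 1 * s' 2 = s 0 * s 1 * s 2 := by rw [hs.prod, hs'.prod]
      fin_cases i <;> simp only [Fin.zero_eta, Fin.mk_one, Fin.reduceFinMk]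
      · linear_combination s' 0 ^ 2 * a1 - s' 0 * a2 + a3
      · linear_combination s' 1 ^ 2 * a1 - s' 1 * a2 + a3
      · linear_combination s' 2 ^ 2 * a1 - s' 2 * a2 + a3
    rcases mul_eq_zero.1 e with e | e
    · rcases mul_eq_zero.1 e with e | e
      · exact ⟨0, sub_eq_zero.1 e⟩
      · exact ⟨1, sub_eq_zero.1 e⟩
    · exact ⟨2, sub_eq_zero.1 e⟩
  choose σ hσ using h1
  refine ⟨σ, fun i P => ?_⟩
  have hinj : σ 1 ≠ σ 2 ∧ σ 2 ≠ σ 0 ∧ σ 0 ≠ σ 1 := by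
    refine ⟨fun h => hD' ?_, fun h => hD' ?_, fun h => hD' ?_⟩ <;>
      simp [rootDelta, hσ, h]
  have hne : σ (i + 1) ≠ σ (i + 2) ∧ σ i ≠ σ (i + 1) ∧ σ i ≠ σ (i + 2) := by
    obtain ⟨h1, h2, h3⟩ := hinj
    fin_cases i <;> simp <;> refine ⟨?_, ?_, ?_⟩ <;> first | assumption | exact Ne.symm ‹_›
  simp only [rootForm, linForm, norm_mul, hσ]
  congr 1
  generalize σ i = x at *
  generalize σ (i + 1) = y at *
  generalize σ (i + 2) = z at *
  have h4 : (y = x + 1 ∧ z = x + 2) ∨ (y = x + 2 ∧ z = x + 1) := by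
    revert hne; revert x y z; decide
  rcases h4 with ⟨rfl, rfl⟩ | ⟨rfl, rfl⟩
  · rfl
  · rw [norm_sub_rev]

section Ratio

variable {R : Type*} [CommRing R] (t : Fin 3 → R)

/-- The quotient of the values of a linear factor at two points where the form is one. -/
def linRatio (k : Fin 3) (P Q : ℤ × ℤ) : R :=
  linForm t k P * (linForm t (k + 1) Q * linForm t (k + 2) Q)

variable {t} {b c d : ℤ} {P Q : ℤ × ℤ}

theorem IsRootTriple.linRatio_mul (ht : IsRootTriple b c d t) (hQ : monicCubic b c d Q = 1)
    (k : Fin 3) : linRatio t k P Q * rootForm t k Q = rootForm t k P := by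
  have h := ht.linForm_prod k Q
  rw [hQ] at h
  rw [linRatio, rootForm, rootForm]
  linear_combination (linForm t k P * (t (k + 1) - t (k + 2))) * h

theorem map_linRatio {S : Type*} [CommRing S] (φ : R →+* S) (k : Fin 3) :
    φ (linRatio t k P Q) = linRatio (fun i => φ (t i)) k P Q := by
  simp [linRatio, map_linForm]

theorem IsRootTriple.isIntegral (ht : IsRootTriple b c d t) (k : Fin 3) : IsIntegral ℤ (t k) := by
  refine ⟨Polynomial.X ^ 3 + Polynomial.C b * Polynomial.X ^ 2 + Polynomial.C c * Polynomial.X +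
    Polynomial.C d, by monicity!, ?_⟩
  simp only [Polynomial.eval₂_add, Polynomial.eval₂_mul, Polynomial.eval₂_pow, Polynomial.eval₂_X,
    Polynomial.eval₂_C]
  simpa only [eq_intCast] using ht.cube_eq k

theorem IsRootTriple.isIntegral_linForm (ht : IsRootTriple b c d t) (k : Fin 3) (P : ℤ × ℤ) :
    IsIntegral ℤ (linForm t k P) := by
  have h : ∀ n : ℤ, IsIntegral ℤ (n : R) := fun n => by
    simpa using isIntegral_algebraMap (R := ℤ) (A := R) (x := n)
  exact (h _).sub ((ht.isIntegral k).mul (h _))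

theorem IsRootTriple.isIntegral_rootForm (ht : IsRootTriple b c d t) (k : Fin 3) (P : ℤ × ℤ) :
    IsIntegral ℤ (rootForm t k P) :=
  ((ht.isIntegral _).sub (ht.isIntegral _)).mul (ht.isIntegral_linForm k P)

theorem IsRootTriple.isIntegral_linRatio (ht : IsRootTriple b c d t) (k : Fin 3) (P Q : ℤ × ℤ) :
    IsIntegral ℤ (linRatio t k P Q) :=
  (ht.isIntegral_linForm k P).mul ((ht.isIntegral_linForm _ Q).mul (ht.isIntegral_linForm _ Q))

end Ratio

variable {θ : Fin 3 → ℝ} {b c d : ℤ} {P Q : ℤ × ℤ}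

theorem linRatio_sq (ht : IsRootTriple b c d θ) (hD : rootDelta θ ≠ 0)
    (hP : monicCubic b c d P = 1) (hQ : monicCubic b c d Q = 1) (k : Fin 3) :
    linRatio θ k P Q ^ 2 =
      Real.exp (2 * (Real.log |rootForm θ k P| - Real.log |rootForm θ k Q|)) := by
  have h1 := ht.linRatio_mul (P := P) hQ k
  have p := abs_pos.2 (ht.rootForm_ne_zero hD hP k)
  have q := abs_pos.2 (ht.rootForm_ne_zero hD hQ k)
  rw [two_mul, Real.exp_add, Real.exp_sub, Real.exp_log p, Real.exp_log q, ← sq, ← sq_abs, ← h1,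
    abs_mul]
  field_simp

variable {L : Type*} [Field L] {t : Fin 3 → L}

theorem norm_map_linRatio_le (ht : IsRootTriple b c d θ) (hD : rootDelta θ ≠ 0)
    (ht' : IsRootTriple b c d t)
    (hP : monicCubic b c d P = 1) (hQ : monicCubic b c d Q = 1) (φ : L →+* ℂ) (k : Fin 3) :
    ‖φ (linRatio t k P Q)‖ ≤
      Real.exp (logSize θ P + 2 * logSize θ Q - Real.log |rootDelta θ|) := by
  have hDC : rootDelta (fun i => (θ i : ℂ)) ≠ 0 := by
    rw [← norm_ne_zero_iff, norm_rootDelta_ofReal]; exact abs_ne_zero.2 hD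
  obtain ⟨σ, hσ⟩ := exists_norm_rootForm_eq ht.ofReal (ht'.map φ) hDC
  have h1 := congrArg (fun x => ‖φ x‖) (ht'.linRatio_mul (P := P) hQ k)
  simp only [map_mul, norm_mul, map_rootForm, hσ, norm_rootForm_ofReal] at h1
  have p := abs_pos.2 (ht.rootForm_ne_zero hD hP (σ k))
  have q := abs_pos.2 (ht.rootForm_ne_zero hD hQ (σ k))
  rw [← eq_div_iff q.ne'] at h1
  rw [h1, ← Real.exp_log p, ← Real.exp_log q, ← Real.exp_sub, Real.exp_le_exp]
  have h2 := log_rootForm_le_logSize ht hD hP (σ k)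
  have h3 := le_log_rootForm ht hD hQ (σ k)
  linarith

theorem norm_map_rootForm_le (ht : IsRootTriple b c d θ) (hD : rootDelta θ ≠ 0)
    (ht' : IsRootTriple b c d t)
    (hP : monicCubic b c d P = 1) (φ : L →+* ℂ) (k : Fin 3) :
    ‖φ (rootForm t k P)‖ ≤ Real.exp (logSize θ P) := by
  have hDC : rootDelta (fun i => (θ i : ℂ)) ≠ 0 := by
    rw [← norm_ne_zero_iff, norm_rootDelta_ofReal]; exact abs_ne_zero.2 hD
  obtain ⟨σ, hσ⟩ := exists_norm_rootForm_eq ht.ofReal (ht'.map φ) hDC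
  rw [map_rootForm, hσ, norm_rootForm_ofReal,
    ← Real.exp_log (abs_pos.2 (ht.rootForm_ne_zero hD hP (σ k))), Real.exp_le_exp]
  exact log_rootForm_le_logSize ht hD hP (σ k)

/-- The logarithmic difference of the two linear forms other than the `i`-th. -/
noncomputable def logDiff (θ : Fin 3 → ℝ) (i : Fin 3) (P : ℤ × ℤ) : ℝ :=
  Real.log |rootForm θ (i + 1) P| - Real.log |rootForm θ (i + 2) P|

theorem norm_map_linRatio_pair_le (ht : IsRootTriple b c d θ) (hD : rootDelta θ ≠ 0)
    (ht' : IsRootTriple b c d t)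
    (hP : monicCubic b c d P = 1) (hQ : monicCubic b c d Q = 1) (φ : L →+* ℂ) (i j : Fin 3)
    {x : ℝ} (hx : 3 * logSize θ P + 3 * logSize θ Q - 2 * Real.log |rootDelta θ| ≤ x) :
    ‖φ ((linRatio t i P Q * linRatio t j Q P) ^ 2)‖ ≤ Real.exp (2 * x) := by
  rw [map_pow, map_mul, norm_pow, norm_mul, two_mul x, Real.exp_add, ← sq]
  gcongr
  calc _ ≤ Real.exp (logSize θ P + 2 * logSize θ Q - Real.log |rootDelta θ|) *
        Real.exp (logSize θ Q + 2 * logSize θ P - Real.log |rootDelta θ|) := by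
        gcongr
        · exact norm_map_linRatio_le ht hD ht' hP hQ φ i
        · exact norm_map_linRatio_le ht hD ht' hQ hP φ j
    _ ≤ Real.exp x := by
        rw [← Real.exp_add, Real.exp_le_exp]
        linarith

theorem map_linRatio_pair (ht : IsRootTriple b c d θ) (hD : rootDelta θ ≠ 0)
    (hP : monicCubic b c d P = 1) (hQ : monicCubic b c d Q = 1) {φ : L →+* ℂ}
    (hφ : ∀ i, φ (t i) = θ i) (i : Fin 3) :
    φ ((linRatio t (i + 1) P Q * linRatio t (i + 2) Q P) ^ 2) =
      Complex.exp ((2 * (logDiff θ i P - logDiff θ i Q) : ℝ) : ℂ) := by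
  have h1 : ∀ k (P Q : ℤ × ℤ), φ (linRatio t k P Q) = ((linRatio θ k P Q : ℝ) : ℂ) := by
    intro k P Q
    rw [map_linRatio, funext hφ]
    exact (map_linRatio Complex.ofRealHom k).symm
  rw [map_pow, map_mul, h1, h1, mul_pow, ← Complex.ofReal_pow, ← Complex.ofReal_pow,
    linRatio_sq ht hD hP hQ, linRatio_sq ht hD hQ hP, ← Complex.ofReal_mul, ← Complex.ofReal_exp,
    ← Real.exp_add]
  simp only [logDiff]
  congr 2
  ring

theorem map_rootForm_pow (ht : IsRootTriple b c d θ) (hD : rootDelta θ ≠ 0)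
    (hP : monicCubic b c d P = 1) {φ : L →+* ℂ} (hφ : ∀ i, φ (t i) = θ i) (k : Fin 3) (j : ℕ) :
    φ (rootForm t k P ^ (2 * j)) =
      Complex.exp ((2 * j * Real.log |rootForm θ k P| : ℝ) : ℂ) := by
  have h1 : φ (rootForm t k P) = ((rootForm θ k P : ℝ) : ℂ) := by
    rw [map_rootForm, funext hφ]
    exact (map_rootForm Complex.ofRealHom k P).symm
  have h2 : (2 * j : ℝ) = ((2 * j : ℕ) : ℝ) := by push_cast; rfl
  rw [map_pow, h1, ← Complex.ofReal_pow, ← Complex.ofReal_exp, pow_mul, ← sq_abs, ← pow_mul,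
    h2, Real.exp_nat_mul, Real.exp_log (abs_pos.2 (ht.rootForm_ne_zero hD hP k))]

/-- Four solutions cannot satisfy a multiplicative relation of the given shape when the third one
is extremely large. -/
theorem exists_four_points_elim : ∃ H : ℝ, 2000 ≤ H ∧
    ∀ {L : Type} [Field L] [NumberField L] {t : Fin 3 → L} {θ : Fin 3 → ℝ} {b c d : ℤ}
      {P₁ P₂ P₃ Q : ℤ × ℤ} {φ₀ : L →+* ℂ} {i : Fin 3} {j p q : ℤ},
      Module.finrank ℚ L ≤ 6 → IsRootTriple b c d θ → IsRootTriple b c d t → rootDelta θ ≠ 0 →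
      (∀ i, φ₀ (t i) = θ i) → H ≤ Real.log |rootDelta θ| →
      monicCubic b c d P₁ = 1 → monicCubic b c d P₂ = 1 → monicCubic b c d Q = 1 →
      logSize θ P₁ ≤ 12 * Real.log |rootDelta θ| → logSize θ P₂ ≤ 12 * Real.log |rootDelta θ| →
      logSize θ Q ≤ 12 * Real.log |rootDelta θ| →
      Real.exp (Real.log |rootDelta θ| / 2) ≤ logSize θ P₃ →
      |logDiff θ i P₃| ≤ 4 * Real.exp (Real.log |rootDelta θ| - 3 * logSize θ P₃) →
      logDiff θ i P₃ ≠ 0 →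
      |logDiff θ i P₂ - logDiff θ i P₁| ≤ 1 → |logDiff θ i P₃ - logDiff θ i P₁| ≤ 1 →
      |logDiff θ i Q - logDiff θ i P₁| ≤ 40 * Real.log |rootDelta θ| →
      0 < j → j ≤ 10 ^ 9 →
      j * (logDiff θ i P₃ - logDiff θ i P₁) =
        p * (logDiff θ i P₂ - logDiff θ i P₁) + q * (logDiff θ i Q - logDiff θ i P₁) →
      |(p : ℝ)| ≤ 10 ^ 9 * logSize θ P₃ → |(q : ℝ)| ≤ 10 ^ 9 * logSize θ P₃ →
      (∀ m n : ℤ, m * (logDiff θ i P₂ - logDiff θ i P₁) + n * (logDiff θ i Q - logDiff θ i P₁) = 0 →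
        m = 0 ∧ n = 0) → False := by
  obtain ⟨H, hH, hlog⟩ := exists_pow_log_le (10 ^ 13) 60
  refine ⟨H, hH, ?_⟩
  intro L _ _ t θ b c d P₁ P₂ P₃ Q φ₀ i j p q hL ht ht' hD hφ hHh hP₁ hP₂ hQ l₁ l₂ lQ l₃ hT₃ hT₃0
    hv hz hw hj0 hj hrel hp hq hind
  set h := Real.log |rootDelta θ| with hh
  set l := logSize θ P₃
  have hl0 : 0 < l := (Real.exp_pos _).trans_le l₃
  have hhl : h ≤ 2 * Real.log l := by
    have := Real.log_le_log (Real.exp_pos _) l₃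
    rw [Real.log_exp] at this
    linarith
  set X := ⌈10 ^ 12 * h + Real.log l⌉₊ with hX
  have hX1 : 10 ^ 12 * h + Real.log l ≤ X := Nat.le_ceil _
  have hX2 : (X : ℝ) ≤ 10 ^ 12 * h + Real.log l + 1 := (Nat.ceil_lt_add_one (by linarith)).le
  have hX3 : 10 ^ 12 * h ≤ (X : ℝ) := by linarith
  have hX4 : (X : ℝ) ^ 60 ≤ l := by
    refine le_trans ?_ (hlog h hHh l l₃)
    gcongr
    linarith
  have hX5 : (100000 : ℝ) ≤ X := by linarith
  have hX6 : 2 * (X : ℝ) ≤ X ^ 60 := by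
    have h1 : (X : ℝ) ^ 2 ≤ X ^ 60 := pow_le_pow_right₀ (by linarith) (by norm_num)
    nlinarith
  lift j to ℕ using hj0.le
  have hj0' : (0 : ℝ) < j := by exact_mod_cast hj0
  have hj' : (j : ℝ) ≤ 10 ^ 9 := by exact_mod_cast hj
  have hcoef : ∀ {m : ℤ}, |(m : ℝ)| ≤ 10 ^ 9 * l → |(m : ℝ)| ≤ Real.exp X := by
    intro m hm
    refine hm.trans ?_
    have h1 := Real.add_one_le_exp (10 ^ 12 * h)
    calc 10 ^ 9 * l ≤ Real.exp (10 ^ 12 * h) * Real.exp (Real.log l) := by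
          rw [Real.exp_log hl0]
          gcongr
          linarith
      _ ≤ _ := by rw [← Real.exp_add, Real.exp_le_exp]; linarith
  have hlin : p * (2 * (logDiff θ i P₂ - logDiff θ i P₁)) +
      q * (2 * (logDiff θ i Q - logDiff θ i P₁)) =
      2 * j * (logDiff θ i P₃ - logDiff θ i P₁) := by
    push_cast at hrel
    linear_combination (-2) * hrel
  have hΛ : 2 * j * Real.log |rootForm θ (i + 1) P₁| - 2 * j * Real.log |rootForm θ (i + 2) P₁| +
      p * (2 * (logDiff θ i P₂ - logDiff θ i P₁)) +
      q * (2 * (logDiff θ i Q - logDiff θ i P₁)) = 2 * j * logDiff θ i P₃ := by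
    rw [add_assoc, hlin]
    simp only [logDiff]
    ring
  have hpow : ∀ (φ : L →+* ℂ) k, ‖φ (rootForm t k P₁ ^ (2 * j))‖ ≤ Real.exp X := by
    intro φ k
    rw [map_pow, norm_pow]
    calc _ ≤ Real.exp (12 * h) ^ (2 * j) := by
          gcongr
          exact (norm_map_rootForm_le ht hD ht' hP₁ φ k).trans (Real.exp_le_exp.2 l₁)
      _ = Real.exp (2 * j * (12 * h)) := by rw [← Real.exp_nat_mul]; push_cast; rfl
      _ ≤ Real.exp X := by
          rw [Real.exp_le_exp]
          nlinarith
  refine linearForm_elim (L := L) (X := X) (by exact_mod_cast hX5) hL φ₀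
    (β := ![rootForm t (i + 2) P₁ ^ (2 * j), rootForm t (i + 1) P₁ ^ (2 * j),
      (linRatio t (i + 1) P₂ P₁ * linRatio t (i + 2) P₁ P₂) ^ 2,
      (linRatio t (i + 1) Q P₁ * linRatio t (i + 2) P₁ Q) ^ 2])
    (l := ![2 * j * Real.log |rootForm θ (i + 2) P₁|, 2 * j * Real.log |rootForm θ (i + 1) P₁|,
      2 * (logDiff θ i P₂ - logDiff θ i P₁), 2 * (logDiff θ i Q - logDiff θ i P₁)])
    (a := p) (b := q) ?_ ?_ ?_ ?_ ?_ ?_ ?_ (hcoef hp) (hcoef hq) ?_ ?_ ?_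
  · intro k
    fin_cases k
    · exact (ht'.isIntegral_rootForm _ _).pow _
    · exact (ht'.isIntegral_rootForm _ _).pow _
    · exact ((ht'.isIntegral_linRatio _ _ _).mul (ht'.isIntegral_linRatio _ _ _)).pow _
    · exact ((ht'.isIntegral_linRatio _ _ _).mul (ht'.isIntegral_linRatio _ _ _)).pow _
  · intro φ k
    fin_cases k
    · exact hpow φ _
    · exact hpow φ _
    · exact (norm_map_linRatio_pair_le ht hD ht' hP₂ hP₁ φ _ _ le_rfl).trans
        (Real.exp_le_exp.2 (by linarith))
    · exact (norm_map_linRatio_pair_le ht hD ht' hQ hP₁ φ _ _ le_rfl).trans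
        (Real.exp_le_exp.2 (by linarith))
  · intro k
    fin_cases k
    · exact map_rootForm_pow ht hD hP₁ hφ _ j
    · exact map_rootForm_pow ht hD hP₁ hφ _ j
    · exact map_linRatio_pair ht hD hP₂ hP₁ hφ i
    · exact map_linRatio_pair ht hD hQ hP₁ hφ i
  · have h1 := log_rootForm_le_logSize ht hD hP₁ (i + 2)
    have h2 := le_log_rootForm ht hD hP₁ (i + 2)
    have h3 : |(Real.log |rootForm θ (i + 2) P₁|)| ≤ 24 * h := by
      rw [abs_le]; constructor <;> linarith
    simp only [Matrix.cons_val]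
    rw [abs_mul, abs_of_pos (a := 2 * (j : ℝ)) (by positivity)]
    nlinarith
  · simp only [Matrix.cons_val]
    rw [abs_mul, abs_two]
    linarith
  · simp only [Matrix.cons_val]
    rw [abs_mul, abs_two]
    linarith
  · simp only [Matrix.cons_val]
    rw [hlin, abs_mul, abs_of_pos (a := 2 * (j : ℝ)) (by positivity)]
    nlinarith
  · intro m n hmn
    simp only [Matrix.cons_val] at hmn
    exact hind m n (by linarith)
  · simp only [Matrix.cons_val]
    rw [hΛ]
    exact mul_ne_zero (by positivity) hT₃0
  · simp only [Matrix.cons_val]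
    rw [hΛ, abs_mul, abs_of_pos (a := 2 * (j : ℝ)) (by positivity)]
    have h1 := pow_nine_mul_le_exp hX5
    have h2 : (1 : ℝ) ≤ X ^ 9 := one_le_pow₀ (by linarith)
    calc 2 * (j : ℝ) * |logDiff θ i P₃| ≤ 2 * 10 ^ 9 * (4 * Real.exp (h - 3 * l)) := by gcongr
      _ = 8 * 10 ^ 9 * Real.exp (h - 3 * l) := by ring
      _ ≤ Real.exp X * Real.exp (h - 3 * l) := by gcongr; linarith
      _ ≤ _ := by
        rw [← Real.exp_add, Real.exp_le_exp]
        linarith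

end Conjugates

section Configuration

variable {θ : Fin 3 → ℝ} {b c d : ℤ} {i : Fin 3}

theorem IsNearRoot.two_mul_log_le {t : Fin 3 → ℂ} (ht : IsRootTriple b c d t)
    (hD : cubicDisc 1 b c d ≠ 0) {P Q : ℤ × ℤ} (hP : monicCubic b c d P = 1)
    (hQ : monicCubic b c d Q = 1) (hPQ : P ≠ Q) (hi : IsNearRoot t i P) (hi' : IsNearRoot t i Q)
    (hle : Real.log (rootSize t P) ≤ Real.log (rootSize t Q))
    (h3 : 3 ≤ Real.log (rootSize t P)) :
    2 * Real.log (rootSize t P) ≤ Real.log (rootSize t Q) + 2 := by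
  have p := ht.rootSize_pos hD hP
  have q := ht.rootSize_pos hD hQ
  have h4 := Real.log_le_sub_one_of_pos p
  have h := hi.sq_le ht hD hP hQ hPQ hi' ((Real.log_le_log_iff p q).1 hle) (by linarith)
  have h5 := Real.log_le_log (by positivity) h
  rw [Real.log_pow, Real.log_mul (by norm_num) q.ne', show (4 : ℝ) = 2 ^ 2 by norm_num,
    Real.log_pow] at h5
  push_cast at h5
  linarith [Real.log_two_lt_d9]

/-- Three solutions near the same root, sorted by size, the first of which is not too small. -/
structure IsArm (θ : Fin 3 → ℝ) (b c d : ℤ) (i : Fin 3) (P : Fin 3 → ℤ × ℤ) : Prop where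
  eq_one : ∀ k, monicCubic b c d (P k) = 1
  near : ∀ k, IsNearRoot (fun i => (θ i : ℂ)) i (P k)
  ne₁ : P 0 ≠ P 1
  ne₂ : P 1 ≠ P 2
  le₁ : logSize θ (P 0) ≤ logSize θ (P 1)
  le₂ : logSize θ (P 1) ≤ logSize θ (P 2)
  le : Real.log |rootDelta θ| ≤ 2 * logSize θ (P 0) + 1

variable {P : Fin 3 → ℤ × ℤ} (hA : IsArm θ b c d i P) (ht : IsRootTriple b c d θ)
  (hD : rootDelta θ ≠ 0) (hH : 2000 ≤ Real.log |rootDelta θ|)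

include hA ht hD hH

theorem IsArm.armData : ArmData (Real.log |rootDelta θ|) (fun k => logSize θ (P k))
    (fun k => Real.log |rootForm θ i (P k)|) (fun k => logDiff θ i (P k)) where
  le_h := hH
  le_l := hA.le
  step₁ := (hA.near 0).two_mul_log_le ht.ofReal
    (cubicDisc_ne_zero_of_rootDelta ht hD) (hA.eq_one 0) (hA.eq_one 1) hA.ne₁ (hA.near 1)
    hA.le₁ (by rw [← logSize]; linarith [hA.le])
  step₂ := (hA.near 1).two_mul_log_le ht.ofReal
    (cubicDisc_ne_zero_of_rootDelta ht hD) (hA.eq_one 1) (hA.eq_one 2) hA.ne₂ (hA.near 2)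
    hA.le₂ (by rw [← logSize]; linarith [hA.le, hA.le₁])
  le_ℓ k := le_log_rootForm ht hD (hA.eq_one k) i
  ℓ_le k := ((hA.near k).log_bounds ht hD (hA.eq_one k)).1
  le_T k := ((hA.near k).abs_log_sub ht hD (hA.eq_one k)).1
  T_le k := ((hA.near k).abs_log_sub ht hD (hA.eq_one k)).2

variable (hirr : ∀ x y : ℤ, monicCubic b c d (x, y) = 0 → y = 0)

include hirr

/-- The third solution near a given root is extremely large. -/
theorem IsArm.exp_le : Real.exp (Real.log |rootDelta θ| / 2) ≤ logSize θ (P 2) :=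
  (hA.armData ht hD hH).exp_le
    (fun _ hp h1 h2 => eq_zero_of_mem_logUnits_of_le ht hD hirr (by linarith) hp h1 h2)
    (sub_mem_logUnits ht hD i (hA.eq_one 1) (hA.eq_one 0))
    (sub_mem_logUnits ht hD i (hA.eq_one 2) (hA.eq_one 0))

omit hirr in
theorem IsArm.other_bounds {Q : ℤ × ℤ} {i' : Fin 3} (hii : i' ≠ i)
    (hQ : monicCubic b c d Q = 1) (hi' : IsNearRoot (fun i => (θ i : ℂ)) i' Q)
    (hQl : Real.log |rootDelta θ| ≤ 2 * logSize θ Q + 1)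
    (hQ12 : logSize θ Q ≤ 12 * Real.log |rootDelta θ|)
    (hP12 : logSize θ (P 0) ≤ 12 * Real.log |rootDelta θ|) :
    |(Real.log |rootForm θ i (P 0)| - Real.log |rootForm θ i Q|)| ≤
        40 * Real.log |rootDelta θ| ∧
      Real.log |rootDelta θ| / 2 - 5 ≤ |logDiff θ i Q - logDiff θ i (P 0)| ∧
      |logDiff θ i Q - logDiff θ i (P 0)| ≤ 40 * Real.log |rootDelta θ| := by
  have A := hA.armData ht hD hH
  have h1 := A.T_zero_le
  have h2 := A.exp_neg_le
  have h3 := A.le_ℓ 0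
  have h4 := A.ℓ_le 0
  have h5 := A.le_l
  obtain ⟨q1, q2, q3⟩ := hi'.log_bounds ht hD hQ
  have q4 := le_log_rootForm ht hD hQ i'
  have q5 := fun k => log_rootForm_le_logSize ht hD hQ k
  have h6 : |logDiff θ i (P 0)| ≤ 1 / 40 := by linarith [Real.exp_pos (-Real.log |rootDelta θ| / 2)]
  obtain ⟨h7, h8⟩ := abs_le.1 h6
  obtain h | h : i' = i + 1 ∨ i' = i + 2 := by
    fin_cases i <;> fin_cases i' <;> simp at hii ⊢
  · have e1 : i' + 1 = i + 2 := by rw [h]; fin_cases i <;> rfl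
    have e2 : i' + 2 = i := by rw [h]; fin_cases i <;> rfl
    rw [e1] at q2
    rw [e2] at q3
    rw [h] at q1 q4
    have q6 := q5 i
    have q7 := q5 (i + 2)
    have r1 : logDiff θ i Q ≤ Real.log |rootDelta θ| - 3 * logSize θ Q + 3 := by
      rw [logDiff]; linarith
    have r2 : Real.log |rootDelta θ| - 3 * logSize θ Q ≤ logDiff θ i Q := by
      rw [logDiff]; linarith
    rw [abs_of_neg (a := logDiff θ i Q - logDiff θ i (P 0)) (by linarith)]
    refine ⟨?_, by linarith, by linarith⟩
    rw [abs_le]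
    constructor <;> linarith
  · have e1 : i' + 1 = i := by rw [h]; fin_cases i <;> rfl
    have e2 : i' + 2 = i + 1 := by rw [h]; fin_cases i <;> rfl
    rw [e1] at q2
    rw [e2] at q3
    rw [h] at q1 q4
    have q6 := q5 i
    have q7 := q5 (i + 1)
    have r1 : 3 * logSize θ Q - Real.log |rootDelta θ| - 3 ≤ logDiff θ i Q := by
      rw [logDiff]; linarith
    have r2 : logDiff θ i Q ≤ 3 * logSize θ Q - Real.log |rootDelta θ| := by
      rw [logDiff]; linarith
    rw [abs_of_pos (a := logDiff θ i Q - logDiff θ i (P 0)) (by linarith)]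
    refine ⟨?_, by linarith, by linarith⟩
    rw [abs_le]
    constructor <;> linarith

omit hA ht hD hH hirr in
/-- Three solutions near one root, the first two of moderate size, exclude a solution of moderate
size near another root. -/
theorem exists_isArm_elim : ∃ H : ℝ, 2000 ≤ H ∧
    ∀ {L : Type} [Field L] [NumberField L] {t : Fin 3 → L} {θ : Fin 3 → ℝ} {b c d : ℤ}
      {P : Fin 3 → ℤ × ℤ} {Q : ℤ × ℤ} {φ₀ : L →+* ℂ} {i i' : Fin 3},
      Module.finrank ℚ L ≤ 6 → IsRootTriple b c d θ → IsRootTriple b c d t → rootDelta θ ≠ 0 →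
      (∀ i, φ₀ (t i) = θ i) → H ≤ Real.log |rootDelta θ| →
      (∀ x y : ℤ, monicCubic b c d (x, y) = 0 → y = 0) →
      IsArm θ b c d i P → logSize θ (P 1) ≤ 12 * Real.log |rootDelta θ| →
      i' ≠ i → monicCubic b c d Q = 1 → IsNearRoot (fun i => (θ i : ℂ)) i' Q →
      Real.log |rootDelta θ| ≤ 2 * logSize θ Q + 1 →
      logSize θ Q ≤ 12 * Real.log |rootDelta θ| → False := by
  obtain ⟨H, hH0, key⟩ := exists_four_points_elim
  refine ⟨H, hH0, ?_⟩
  intro L _ _ t θ b c d P Q φ₀ i i' hL ht ht' hD hφ hH hirr hA hP1 hii hQ hi' hQl hQ12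
  have hH' : 2000 ≤ Real.log |rootDelta θ| := hH0.trans hH
  have A := hA.armData ht hD hH'
  have hG : ∀ p ∈ logUnits θ i, |p.1| ≤ 2 / 7 * Real.log |rootDelta θ| →
      |p.2| ≤ 2 / 7 * Real.log |rootDelta θ| → p = 0 :=
    fun _ hp h1 h2 => eq_zero_of_mem_logUnits_of_le ht hD hirr (by linarith) hp h1 h2
  have hP0 := hA.le₁.trans hP1
  obtain ⟨w1, w2, w3⟩ := hA.other_bounds ht hD hH' hii hQ hi' hQl hQ12 hP0
  have hv := sub_mem_logUnits ht hD i (hA.eq_one 1) (hA.eq_one 0)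
  have hz := sub_mem_logUnits ht hD i (hA.eq_one 2) (hA.eq_one 0)
  have hw := sub_mem_logUnits ht hD i hQ (hA.eq_one 0)
  obtain ⟨j, p, q, hj0, hj, hrel, hp, hq⟩ := A.exists_relation hP1 w1 w2 hG hv hz hw w3
  have hexp := A.exp_neg_le
  refine key hL ht ht' hD hφ hH (hA.eq_one 0) (hA.eq_one 1) hQ hP0 hP1 hQ12
    (hA.exp_le ht hD hH' hirr) (A.T_le 2) ?_ ((A.abs_snd_le le_rfl).trans (by linarith))
    ((A.abs_snd_le A.l_one_le).trans (by linarith)) w3 hj0 hj hrel hp hq ?_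
  · exact abs_pos.1 ((Real.exp_pos _).trans_le (A.le_T 2))
  · intro m n hmn
    have h1 := add_mem (zsmul_mem hv m) (zsmul_mem hw n)
    have h2 := eq_zero_of_mem_logUnits_of_snd ht hD hirr h1 (by simpa [logDiff] using hmn)
    have h3 := congrArg Prod.fst h2
    simp only [Prod.fst_add, Prod.smul_fst, Prod.fst_zero] at h3
    simp only [zsmul_eq_mul] at h3
    have h4 := A.le_det (w := (_, _)) w1 w2
    simp only [logDiff] at h4 hmn
    have h5 := pow_pos (show 0 < Real.log |rootDelta θ| by linarith) 2
    have h6 := abs_pos.1 (lt_of_lt_of_le (by linarith) h4)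
    constructor
    · have h7 : (m : ℝ) = 0 := by
        refine (mul_eq_zero.1 ?_).resolve_right h6
        linear_combination (Real.log |rootForm θ (i + 1) Q| - Real.log |rootForm θ (i + 2) Q| -
          (Real.log |rootForm θ (i + 1) (P 0)| - Real.log |rootForm θ (i + 2) (P 0)|)) * h3 -
          (Real.log |rootForm θ i (P 0)| - Real.log |rootForm θ i Q|) * hmn
      exact_mod_cast h7
    · have h7 : (n : ℝ) = 0 := by
        refine (mul_eq_zero.1 ?_).resolve_right h6
        linear_combination (Real.log |rootForm θ i (P 0)| - Real.log |rootForm θ i (P 1)|) * hmn -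
          (Real.log |rootForm θ (i + 1) (P 1)| - Real.log |rootForm θ (i + 2) (P 1)| -
          (Real.log |rootForm θ (i + 1) (P 0)| - Real.log |rootForm θ (i + 2) (P 0)|)) * h3
      exact_mod_cast h7

end Configuration

theorem Finset.exists_injective_monotone {α : Type*} (A : Finset α) (f : α → ℝ) {n : ℕ}
    (hn : n ≤ A.card) :
    ∃ P : Fin n → α, Function.Injective P ∧ (∀ k, P k ∈ A) ∧ Monotone fun k => f (P k) := by
  obtain ⟨B, hBA, hB⟩ := Finset.exists_subset_card_eq hn
  let e : Fin n → α := fun k => (B.equivFinOfCardEq hB).symm k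
  have he : Function.Injective e :=
    Subtype.val_injective.comp (B.equivFinOfCardEq hB).symm.injective
  exact ⟨e ∘ Tuple.sort (f ∘ e), he.comp (Equiv.injective _),
    fun k => hBA (Subtype.prop _), Tuple.monotone_sort (f ∘ e)⟩

section Counting

variable {b c d : ℤ} {t : Fin 3 → ℂ} {i : Fin 3} {A : Finset (ℤ × ℤ)} {P Q : ℤ × ℤ}

theorem log_norm_rootDelta (ht : IsRootTriple b c d t) :
    2 * Real.log ‖rootDelta t‖ = Real.log |(cubicDisc 1 b c d : ℝ)| := by
  rw [← ht.norm_rootDelta_sq, Real.log_pow]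
  norm_num

/-- Of two distinct solutions at most one is very small. -/
theorem le_or_le_two_mul_log (ht : IsRootTriple b c d t) (hD : cubicDisc 1 b c d ≠ 0)
    (hP : monicCubic b c d P = 1) (hQ : monicCubic b c d Q = 1) (hPQ : P ≠ Q) :
    Real.log ‖rootDelta t‖ ≤ 2 * Real.log (rootSize t P) + 1 ∨
      Real.log ‖rootDelta t‖ ≤ 2 * Real.log (rootSize t Q) + 1 := by
  have p := ht.rootSize_pos hD hP
  have q := ht.rootSize_pos hD hQ
  have h := Real.log_le_log (norm_pos_iff.2 (ht.rootDelta_ne hD)) (norm_rootDelta_le hP hQ hPQ)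
  rw [Real.log_mul two_ne_zero (by positivity), Real.log_mul p.ne' q.ne'] at h
  by_contra! hcon
  linarith [Real.log_two_lt_d9, hcon.1, hcon.2]

theorem IsNearRoot.log_lt (ht : IsRootTriple b c d t) (hD : 1000 ≤ Real.log ‖rootDelta t‖)
    (hD0 : cubicDisc 1 b c d ≠ 0) (hP : monicCubic b c d P = 1) (hQ : monicCubic b c d Q = 1)
    (hPQ : P ≠ Q)
    (h : IsNearRoot t i P) (h' : IsNearRoot t i Q)
    (hle : Real.log (rootSize t P) ≤ Real.log (rootSize t Q)) :
    Real.log (rootSize t P) < 12 * Real.log ‖rootDelta t‖ := by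
  have h1 := log_norm_rootDelta ht
  have p := ht.rootSize_pos hD0 hP
  have q := ht.rootSize_pos hD0 hQ
  have hD1 : (0 : ℝ) < |(cubicDisc 1 b c d : ℝ)| := by positivity
  have hD2 : 10 ^ 40 ≤ |cubicDisc 1 b c d| := by
    have h2 : (10 : ℝ) ^ 40 ≤ |(cubicDisc 1 b c d : ℝ)| := by
      rw [← Real.log_le_log_iff (by positivity) hD1, Real.log_pow, ← h1]
      have := Real.log_le_sub_one_of_pos (show (0 : ℝ) < 10 by norm_num)
      push_cast
      linarith
    exact_mod_cast h2
  have h3 := Real.log_lt_log p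
    (h.not_both_large ht hD2 hP hQ hPQ h' ((Real.log_le_log_iff p q).1 hle))
  rw [Real.log_pow, ← h1] at h3
  push_cast at h3
  linarith

/-- The number of solutions near a root which are not very small is at most six. -/
theorem card_le_six (ht : IsRootTriple b c d t) (hD : 1000 ≤ Real.log ‖rootDelta t‖)
    (hD0 : cubicDisc 1 b c d ≠ 0)
    (hA : ∀ P ∈ A, monicCubic b c d P = 1 ∧ IsNearRoot t i P ∧
      Real.log ‖rootDelta t‖ ≤ 2 * Real.log (rootSize t P) + 1) : A.card ≤ 6 := by
  by_contra! hcard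
  obtain ⟨P, hinj, hPA, hmono⟩ := A.exists_injective_monotone (fun P => Real.log (rootSize t P))
    (n := 7) hcard
  have hstep : ∀ k : Fin 6, 2 * Real.log (rootSize t (P k.castSucc)) ≤
      Real.log (rootSize t (P k.succ)) + 2 := by
    intro k
    have h1 := hA _ (hPA k.castSucc)
    have h2 := hA _ (hPA k.succ)
    exact h1.2.1.two_mul_log_le ht hD0 h1.1 h2.1 (hinj.ne (Fin.castSucc_lt_succ).ne) h2.2.1
      (hmono (Fin.castSucc_lt_succ).le) (by linarith [h1.2.2])
  have h0 := (hA _ (hPA 0)).2.2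
  have s0 := hstep 0
  have s1 := hstep 1
  have s2 := hstep 2
  have s3 := hstep 3
  have s4 := hstep 4
  have h5 := hA _ (hPA 5)
  have h6 := hA _ (hPA 6)
  have h7 := h5.2.1.log_lt ht hD hD0 h5.1 h6.1 (hinj.ne (by decide)) h6.2.1 (hmono (by decide))
  simp only [Fin.castSucc_zero, Fin.succ_zero_eq_one] at s0
  change 2 * Real.log (rootSize t (P 1)) ≤ Real.log (rootSize t (P 2)) + 2 at s1
  change 2 * Real.log (rootSize t (P 2)) ≤ Real.log (rootSize t (P 3)) + 2 at s2
  change 2 * Real.log (rootSize t (P 3)) ≤ Real.log (rootSize t (P 4)) + 2 at s3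
  change 2 * Real.log (rootSize t (P 4)) ≤ Real.log (rootSize t (P 5)) + 2 at s4
  linarith

/-- At most one solution is very small. -/
theorem card_le_filter_add_one (ht : IsRootTriple b c d t) (hD : cubicDisc 1 b c d ≠ 0)
    (hA : ∀ P ∈ A, monicCubic b c d P = 1) : A.card ≤
      (A.filter fun P => Real.log ‖rootDelta t‖ ≤ 2 * Real.log (rootSize t P) + 1).card + 1 := by
  rw [← A.card_filter_add_card_filter_not
    (p := fun P => Real.log ‖rootDelta t‖ ≤ 2 * Real.log (rootSize t P) + 1), add_le_add_iff_left,
    Finset.card_le_one]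
  intro P hP Q hQ
  rw [Finset.mem_filter] at hP hQ
  by_contra hPQ
  exact (le_or_le_two_mul_log ht hD (hA P hP.1) (hA Q hQ.1) hPQ).elim hP.2 hQ.2

open ComplexConjugate in
theorem IsNearRoot.eq_zero {r : ℝ} {z : ℂ} (ht : IsRootTriple b c d ![(r : ℂ), z, conj z])
    (hD : 1000 ≤ Real.log ‖rootDelta ![(r : ℂ), z, conj z]‖) (hD0 : cubicDisc 1 b c d ≠ 0)
    (hP : monicCubic b c d P = 1) (h : IsNearRoot ![(r : ℂ), z, conj z] i P)
    (hl : Real.log ‖rootDelta ![(r : ℂ), z, conj z]‖ ≤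
      2 * Real.log (rootSize ![(r : ℂ), z, conj z] P) + 1) : i = 0 := by
  set t := ![(r : ℂ), z, conj z] with ht'
  have hconj : ‖rootForm t 1 P‖ = ‖rootForm t 2 P‖ := by
    rw [← Complex.norm_conj (rootForm t 1 P), ← norm_neg (conj _)]
    congr 1
    simp [rootForm, linForm, ht']
    ring
  have h1 := ht.norm_rootForm_prod 0 hP
  have h2 := (norm_rootForm_triangle (t := t) 1 P)
  have h3 := ht.rootSize_pos hD0 hP
  by_contra hi
  have h4 : ‖rootForm t 1 P‖ ≤ ‖rootForm t 0 P‖ := by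
    have := h 0
    fin_cases i
    · simp at hi
    · exact this
    · rw [hconj]; exact this
  have h5 : rootSize t P = ‖rootForm t 0 P‖ := by
    apply le_antisymm
    · simp only [rootSize]
      simp [← hconj, h4]
    · exact norm_rootForm_le t 0 P
  have h6 : ‖rootForm t 0 P‖ ≤ 2 * ‖rootForm t 1 P‖ := by
    have h7 := h2.2
    change ‖rootForm t 0 P‖ ≤ ‖rootForm t 2 P‖ + ‖rootForm t 1 P‖ at h7
    linarith
  have h8 : rootSize t P ^ 3 ≤ 4 * ‖rootDelta t‖ := by
    rw [← h1]
    simp only [zero_add, ← hconj]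
    rw [h5]
    calc ‖rootForm t 0 P‖ ^ 3 = ‖rootForm t 0 P‖ * ‖rootForm t 0 P‖ ^ 2 := by ring
      _ ≤ ‖rootForm t 0 P‖ * (2 * ‖rootForm t 1 P‖) ^ 2 := by gcongr
      _ = _ := by ring
  have h9 := Real.log_le_log (by positivity) h8
  rw [Real.log_pow, Real.log_mul (by norm_num) (norm_ne_zero_iff.2 (ht.rootDelta_ne hD0))] at h9
  have := Real.log_le_sub_one_of_pos (show (0 : ℝ) < 4 by norm_num)
  push_cast at h9
  linarith

open ComplexConjugate in
theorem card_le_seven_of_conj {r : ℝ} {z : ℂ} (ht : IsRootTriple b c d ![(r : ℂ), z, conj z])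
    (hD : 1000 ≤ Real.log ‖rootDelta ![(r : ℂ), z, conj z]‖) (hD0 : cubicDisc 1 b c d ≠ 0)
    (hA : ∀ P ∈ A, monicCubic b c d P = 1) : A.card ≤ 7 := by
  refine (card_le_filter_add_one ht hD0 hA).trans (Nat.succ_le_succ ?_)
  refine card_le_six (i := 0) ht hD hD0 fun P hP => ?_
  rw [Finset.mem_filter] at hP
  obtain ⟨i, hi⟩ := exists_isNearRoot ![(r : ℂ), z, conj z] P
  obtain rfl := hi.eq_zero ht hD hD0 (hA P hP.1) hP.2
  exact ⟨hA P hP.1, hi, hP.2⟩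

end Counting

section Roots

variable {b c d : ℤ}

theorem exists_splitting (hD : cubicDisc 1 b c d ≠ 0) :
    ∃ (L : Type) (_ : Field L) (_ : NumberField L) (t : Fin 3 → L) (_ : L →+* ℂ),
      Module.finrank ℚ L ≤ 6 ∧ IsRootTriple b c d t := by
  let p : Cubic ℚ := ⟨1, b, c, d⟩
  have ha : p.a ≠ 0 := one_ne_zero
  have hs : (p.toPoly.map (algebraMap ℚ p.toPoly.SplittingField)).Splits :=
    Polynomial.SplittingField.splits _
  obtain ⟨x, y, z, h⟩ := (Cubic.splits_iff_roots_eq_three ha).1 hs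
  have ht : IsRootTriple b c d ![x, y, z] := by
    have e1 := Cubic.b_eq_three_roots ha h
    have e2 := Cubic.c_eq_three_roots ha h
    have e3 := Cubic.d_eq_three_roots ha h
    simp only [p, map_one, one_mul, map_intCast] at e1 e2 e3
    constructor <;> simp only [Matrix.cons_val]
    · linear_combination e1
    · linear_combination -1 * e2
    · linear_combination e3
  have hdiscr : p.discr ≠ 0 := by
    have h1 : p.discr = cubicDisc 1 b c d := by
      simp only [Cubic.discr, p, cubicDisc]
      push_cast
      ring
    rw [h1]
    exact_mod_cast hD
  have hsep : p.toPoly.Separable := by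
    have h2 := (Cubic.discr_ne_zero_iff_roots_nodup ha hs).1 hdiscr
    rw [Cubic.map_roots] at h2
    exact (Polynomial.separable_map _).1 ((Polynomial.nodup_roots_iff_of_splits
      (Polynomial.map_ne_zero (Cubic.ne_zero_of_a_ne_zero ha)) hs).1 h2)
  have hfin : Module.finrank ℚ p.toPoly.SplittingField ≤ 6 := by
    have : Fact (p.toPoly.map (algebraMap ℚ p.toPoly.SplittingField)).Splits := ⟨hs⟩
    rw [← Polynomial.Gal.card_of_separable hsep]
    refine (Nat.card_le_card_of_injective _
      (Polynomial.Gal.galActionHom_injective p.toPoly p.toPoly.SplittingField)).trans ?_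
    rw [Nat.card_perm, Nat.card_eq_fintype_card]
    have h3 : Fintype.card (p.toPoly.rootSet p.toPoly.SplittingField) ≤ 3 := by
      rw [Polynomial.card_rootSet_eq_natDegree hsep hs, Cubic.natDegree_of_a_ne_zero ha]
    exact Nat.factorial_le h3
  have : NumberField p.toPoly.SplittingField := { }
  exact ⟨p.toPoly.SplittingField, inferInstance, inferInstance, ![x, y, z],
    (Polynomial.SplittingField.lift p.toPoly (IsAlgClosed.splits _) :
      p.toPoly.SplittingField →ₐ[ℚ] ℂ), hfin, ht⟩

theorem IsRootTriple.exists_eq_of_cube_eq {F : Type*} [Field F] {t : Fin 3 → F}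
    (ht : IsRootTriple b c d t) {x : F} (hx : x ^ 3 + b * x ^ 2 + c * x + d = 0) :
    ∃ j, x = t j := by
  have h : (x - t 0) * (x - t 1) * (x - t 2) = 0 := by
    rw [← hx]
    linear_combination (-x ^ 2) * ht.sum + x * ht.pair - ht.prod
  rcases mul_eq_zero.1 h with h | h
  · rcases mul_eq_zero.1 h with h | h
    · exact ⟨0, sub_eq_zero.1 h⟩
    · exact ⟨1, sub_eq_zero.1 h⟩
  · exact ⟨2, sub_eq_zero.1 h⟩

theorem IsRootTriple.cons_eq {R : Type*} [CommRing R] {t : Fin 3 → R} (ht : IsRootTriple b c d t)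
    {i j k : Fin 3} (hij : i ≠ j) (hik : i ≠ k) (hjk : j ≠ k) :
    IsRootTriple b c d ![t i, t j, t k] := by
  have h1 := ht.sum
  have h2 := ht.pair
  have h3 := ht.prod
  fin_cases i <;> fin_cases j <;> fin_cases k <;> simp at hij hik hjk <;>
    constructor <;> simp <;> first | linear_combination h1 | linear_combination h2 |
      linear_combination h3

open ComplexConjugate in
theorem IsRootTriple.real_or_conj {t : Fin 3 → ℂ} (ht : IsRootTriple b c d t) :
    (∃ θ : Fin 3 → ℝ, ∀ i, t i = θ i) ∨
      ∃ (r : ℝ) (z : ℂ), IsRootTriple b c d ![(r : ℂ), z, conj z] := by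
  by_cases hreal : ∀ i, conj (t i) = t i
  · exact .inl ⟨fun i => (t i).re, fun i => (Complex.conj_eq_iff_re.1 (hreal i)).symm⟩
  · right
    push Not at hreal
    obtain ⟨i, hi⟩ := hreal
    obtain ⟨j, hj⟩ := ht.exists_eq_of_cube_eq (x := conj (t i)) (by
      simpa using congrArg conj (ht.cube_eq i))
    have hij : i ≠ j := by
      rintro rfl
      exact hi hj
    obtain ⟨k, hki, hkj⟩ : ∃ k : Fin 3, k ≠ i ∧ k ≠ j := by
      clear hj hi
      revert i j
      decide
    have h1 := ht.cons_eq hki hkj hij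
    have h2 := h1.sum
    simp only [Matrix.cons_val, ← hj] at h2
    have h3 : (((t k).re : ℝ) : ℂ) = t k := by
      rw [← Complex.conj_eq_iff_re]
      have h4 := congrArg conj h2
      simp only [map_add, map_neg, Complex.conj_conj, map_intCast] at h4
      linear_combination h4 - h2
    refine ⟨(t k).re, t i, ?_⟩
    rw [h3, hj]
    exact h1

end Roots

section Real

variable {b c d : ℤ} {θ : Fin 3 → ℝ}

open Classical in
/-- The elements of a finite set of points which are near a given root and not very small. -/
noncomputable def armFinset (θ : Fin 3 → ℝ) (A : Finset (ℤ × ℤ)) (i : Fin 3) : Finset (ℤ × ℤ) :=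
  (A.filter fun P => Real.log |rootDelta θ| ≤ 2 * logSize θ P + 1).filter
    (IsNearRoot (fun i => (θ i : ℂ)) i)

variable {A : Finset (ℤ × ℤ)} {i : Fin 3}

theorem mem_armFinset {P : ℤ × ℤ} : P ∈ armFinset θ A i ↔
    (P ∈ A ∧ Real.log |rootDelta θ| ≤ 2 * logSize θ P + 1) ∧
      IsNearRoot (fun i => (θ i : ℂ)) i P := by
  classical
  rw [armFinset, Finset.mem_filter, Finset.mem_filter]

variable (hA : ∀ P ∈ A, monicCubic b c d P = 1)

include hA

theorem isArm_of_mem_armFinset {P : Fin 3 → ℤ × ℤ} (hinj : Function.Injective P)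
    (hP : ∀ k, P k ∈ armFinset θ A i) (hmono : Monotone fun k => logSize θ (P k)) :
    IsArm θ b c d i P where
  eq_one k := hA _ (mem_armFinset.1 (hP k)).1.1
  near k := (mem_armFinset.1 (hP k)).2
  ne₁ := hinj.ne (by decide)
  ne₂ := hinj.ne (by decide)
  le₁ := hmono (by decide)
  le₂ := hmono (by decide)
  le := (mem_armFinset.1 (hP 0)).1.2

variable (ht : IsRootTriple b c d θ) (hD : rootDelta θ ≠ 0)

include ht hD

theorem card_le_sum_card_armFinset (i : Fin 3) : A.card ≤
    (armFinset θ A i).card + (armFinset θ A (i + 1)).card + (armFinset θ A (i + 2)).card + 1 := by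
  classical
  have h := card_le_filter_add_one ht.ofReal (cubicDisc_ne_zero_of_rootDelta ht hD) hA
  rw [norm_rootDelta_ofReal] at h
  refine h.trans (Nat.succ_le_succ ?_)
  refine le_trans (Finset.card_le_card fun P hP => ?_) ((Finset.card_union_le
    (armFinset θ A i ∪ armFinset θ A (i + 1)) _).trans
    (Nat.add_le_add_right (Finset.card_union_le _ _) _))
  obtain ⟨j, hj⟩ := exists_isNearRoot (fun i => (θ i : ℂ)) P
  have hPj : P ∈ armFinset θ A j := mem_armFinset.2 ⟨Finset.mem_filter.1 hP, hj⟩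
  obtain rfl | rfl | rfl : j = i ∨ j = i + 1 ∨ j = i + 2 := by
    clear hPj hj
    revert i j
    decide
  all_goals simp [hPj]

variable (hH : 2000 ≤ Real.log |rootDelta θ|)

include hH

theorem logSize_lt_of_mem_armFinset {P Q : ℤ × ℤ} (hP : P ∈ armFinset θ A i)
    (hQ : Q ∈ armFinset θ A i) (hPQ : P ≠ Q) (hle : logSize θ P ≤ logSize θ Q) :
    logSize θ P < 12 * Real.log |rootDelta θ| := by
  rw [mem_armFinset] at hP hQ
  have h := hP.2.log_lt ht.ofReal (by rw [norm_rootDelta_ofReal]; linarith)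
    (cubicDisc_ne_zero_of_rootDelta ht hD) (hA _ hP.1.1) (hA _ hQ.1.1) hPQ hQ.2 hle
  rwa [norm_rootDelta_ofReal] at h

variable (hirr : ∀ x y : ℤ, monicCubic b c d (x, y) = 0 → y = 0)

include hirr

theorem card_armFinset_le_three : (armFinset θ A i).card ≤ 3 := by
  by_contra! hcard
  obtain ⟨P, hinj, hPA, hmono⟩ := Finset.exists_injective_monotone _ (logSize θ) hcard
  have h1 := (isArm_of_mem_armFinset hA (P := fun k => P k.castSucc)
    (hinj.comp (Fin.castSucc_injective 3)) (fun k => hPA _)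
    (fun _ _ h => hmono h)).exp_le ht hD hH hirr
  have h2 := logSize_lt_of_mem_armFinset hA ht hD hH (hPA 2) (hPA 3) (hinj.ne (by decide))
    (hmono (by decide))
  have h3 := Real.quadratic_le_exp_of_nonneg (x := Real.log |rootDelta θ| / 2) (by linarith)
  change _ ≤ logSize θ (P 2) at h1
  nlinarith

omit hA ht hD hH hirr in
theorem exists_card_le_seven_of_real : ∃ H : ℝ, 2000 ≤ H ∧
    ∀ {L : Type} [Field L] [NumberField L] {t : Fin 3 → L} {θ : Fin 3 → ℝ} {b c d : ℤ}
      {A : Finset (ℤ × ℤ)} {φ₀ : L →+* ℂ},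
      Module.finrank ℚ L ≤ 6 → IsRootTriple b c d θ → IsRootTriple b c d t → rootDelta θ ≠ 0 →
      (∀ i, φ₀ (t i) = θ i) → H ≤ Real.log |rootDelta θ| →
      (∀ x y : ℤ, monicCubic b c d (x, y) = 0 → y = 0) →
      (∀ P ∈ A, monicCubic b c d P = 1) → A.card ≤ 7 := by
  obtain ⟨H, hH0, key⟩ := exists_isArm_elim
  refine ⟨H, hH0, ?_⟩
  intro L _ _ t θ b c d A φ₀ hL ht ht' hD hφ hH hirr hA
  have hH' := hH0.trans hH
  by_contra! hcard
  have h3 := fun i => card_armFinset_le_three (i := i) hA ht hD hH' hirr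
  have hsum := fun i => card_le_sum_card_armFinset hA ht hD i
  obtain ⟨i, hi⟩ : ∃ i, 3 ≤ (armFinset θ A i).card := by
    by_contra! h
    have h0 := hsum 0
    have := h 0
    have := h (0 + 1)
    have := h (0 + 2)
    lia
  obtain ⟨j, hji, hj⟩ : ∃ j ≠ i, 2 ≤ (armFinset θ A j).card := by
    by_contra! h
    have h0 := hsum i
    have := h3 i
    have := h (i + 1) (by simp)
    have := h (i + 2) (by simp)
    lia
  obtain ⟨P, hPinj, hPA, hPmono⟩ := Finset.exists_injective_monotone _ (logSize θ) hi
  obtain ⟨Q, hQinj, hQA, hQmono⟩ := Finset.exists_injective_monotone _ (logSize θ) hj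
  have hQ := mem_armFinset.1 (hQA 0)
  exact key hL ht ht' hD hφ hH hirr (isArm_of_mem_armFinset hA hPinj hPA hPmono)
    (logSize_lt_of_mem_armFinset hA ht hD hH' (hPA 1) (hPA 2) (hPinj.ne (by decide))
      (hPmono (by decide))).le hji (hA _ hQ.1.1) hQ.2 hQ.1.2
    (logSize_lt_of_mem_armFinset hA ht hD hH' (hQA 0) (hQA 1) (hQinj.ne (by decide))
      (hQmono (by decide))).le

end Real

section Reducible

variable {b c d : ℤ}

theorem exists_int_root {x y : ℤ} (h : monicCubic b c d (x, y) = 0) (hy : y ≠ 0) :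
    ∃ r : ℤ, r ^ 3 + b * r ^ 2 + c * r + d = 0 := by
  have hy' : (y : ℚ) ≠ 0 := by exact_mod_cast hy
  have h1 : ((x : ℚ) / y) ^ 3 + b * (x / y : ℚ) ^ 2 + c * (x / y : ℚ) + d = 0 := by
    have h2 : (x : ℚ) ^ 3 + b * x ^ 2 * y + c * x * y ^ 2 + d * y ^ 3 = 0 := by
      exact_mod_cast h
    field_simp
    linear_combination h2
  have h3 : IsIntegral ℤ ((x : ℚ) / y) := by
    refine ⟨Polynomial.X ^ 3 + Polynomial.C b * Polynomial.X ^ 2 + Polynomial.C c * Polynomial.X +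
      Polynomial.C d, by monicity!, ?_⟩
    simp only [Polynomial.eval₂_add, Polynomial.eval₂_mul, Polynomial.eval₂_pow,
      Polynomial.eval₂_X, Polynomial.eval₂_C]
    simpa only [eq_intCast] using h1
  obtain ⟨r, hr⟩ := IsIntegrallyClosed.isIntegral_iff.1 h3
  refine ⟨r, ?_⟩
  rw [← hr, eq_intCast] at h1
  exact_mod_cast h1

theorem card_le_two_of_quadratic {α β γ : ℤ} (hα : α ≠ 0) {A : Finset (ℤ × ℤ)}
    (hinj : ∀ P ∈ A, ∀ Q ∈ A, P.2 = Q.2 → P = Q)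
    (hA : ∀ P ∈ A, α * P.2 ^ 2 + β * P.2 + γ = 0) : A.card ≤ 2 := by
  by_contra! hcard
  obtain ⟨P, Q, R, hP, hQ, hR, hPQ, hPR, hQR⟩ := Finset.two_lt_card_iff.1 hcard
  have h1 := hA P hP
  have h2 := hA Q hQ
  have h3 := hA R hR
  have n1 : P.2 - Q.2 ≠ 0 := fun h => hPQ (hinj _ hP _ hQ (sub_eq_zero.1 h))
  have n2 : P.2 - R.2 ≠ 0 := fun h => hPR (hinj _ hP _ hR (sub_eq_zero.1 h))
  have n3 : Q.2 - R.2 ≠ 0 := fun h => hQR (hinj _ hQ _ hR (sub_eq_zero.1 h))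
  have h4 : α * (P.2 + Q.2) + β = 0 :=
    (mul_eq_zero.1 (by linear_combination h1 - h2 : (P.2 - Q.2) * (α * (P.2 + Q.2) + β) = 0)
      ).resolve_left n1
  have h5 : α * (P.2 + R.2) + β = 0 :=
    (mul_eq_zero.1 (by linear_combination h1 - h3 : (P.2 - R.2) * (α * (P.2 + R.2) + β) = 0)
      ).resolve_left n2
  exact mul_ne_zero hα n3 (by linear_combination h4 - h5)

theorem card_le_four_of_int_root (hD : cubicDisc 1 b c d ≠ 0) {r : ℤ}
    (hr : r ^ 3 + b * r ^ 2 + c * r + d = 0) {A : Finset (ℤ × ℤ)}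
    (hA : ∀ P ∈ A, monicCubic b c d P = 1) : A.card ≤ 4 := by
  classical
  have hα : 3 * r ^ 2 + 2 * b * r + c ≠ 0 := by
    intro h
    refine hD ?_
    have hc : c = -(3 * r ^ 2 + 2 * b * r) := by linear_combination h
    have hd : d = -(r ^ 3 + b * r ^ 2 + c * r) := by linear_combination hr
    rw [cubicDisc, hd, hc]
    ring
  have hfac : ∀ P ∈ A, (P.1 - r * P.2) *
      (P.1 ^ 2 + (b + r) * P.1 * P.2 + (c + b * r + r ^ 2) * P.2 ^ 2) = 1 := by
    intro P hP
    rw [← hA P hP, monicCubic]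
    linear_combination (-P.2 ^ 3) * hr
  rw [← A.card_filter_add_card_filter_not (p := fun P => P.1 - r * P.2 = 1)]
  refine Nat.add_le_add (b := 2) (d := 2) ?_ ?_
  · refine card_le_two_of_quadratic (β := 3 * r + b) (γ := 0) hα ?_ ?_
    · intro P hP Q hQ hPQ
      rw [Finset.mem_filter] at hP hQ
      exact Prod.ext (by linear_combination hP.2 - hQ.2 + r * hPQ) hPQ
    · intro P hP
      rw [Finset.mem_filter] at hP
      have h1 := hfac P hP.1
      have h2 : P.1 = r * P.2 + 1 := by linear_combination hP.2
      rw [h2] at h1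
      linear_combination h1
  · have hneg : ∀ P ∈ A.filter (fun P => ¬P.1 - r * P.2 = 1), P.1 = r * P.2 - 1 := by
      intro P hP
      rw [Finset.mem_filter] at hP
      have h1 := (Int.eq_one_or_neg_one_of_mul_eq_one (hfac P hP.1)).resolve_left hP.2
      linear_combination h1
    refine card_le_two_of_quadratic (β := -(3 * r + b)) (γ := 2) hα ?_ ?_
    · intro P hP Q hQ hPQ
      exact Prod.ext (by linear_combination hneg P hP - hneg Q hQ + r * hPQ) hPQ
    · intro P hP
      have h1 := hfac P (Finset.mem_filter.1 hP).1
      rw [hneg P hP] at h1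
      linear_combination -1 * h1

end Reducible

/-- Cubic forms with leading coefficient one and large discriminant represent one at most seven
times. -/
theorem exists_card_le_seven_of_monic : ∃ C : ℤ, 0 < C ∧ ∀ b c d : ℤ, C ≤ |cubicDisc 1 b c d| →
    ∀ A : Finset (ℤ × ℤ), (∀ P ∈ A, monicCubic b c d P = 1) → A.card ≤ 7 := by
  obtain ⟨H, hH, key⟩ := exists_card_le_seven_of_real
  refine ⟨⌈Real.exp (2 * H)⌉, Int.ceil_pos.2 (Real.exp_pos _), fun b c d hC A hA => ?_⟩
  have hexp : Real.exp (2 * H) ≤ |(cubicDisc 1 b c d : ℝ)| := by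
    exact_mod_cast Int.ceil_le.1 hC
  have hlog : 2 * H ≤ Real.log |(cubicDisc 1 b c d : ℝ)| :=
    (Real.le_log_iff_exp_le ((Real.exp_pos _).trans_le hexp)).2 hexp
  have hD : cubicDisc 1 b c d ≠ 0 := by
    intro h
    rw [h] at hexp
    have := Real.exp_pos (2 * H)
    simp only [Int.cast_zero, abs_zero] at hexp
    linarith
  by_cases hirr : ∀ x y : ℤ, monicCubic b c d (x, y) = 0 → y = 0
  · obtain ⟨L, _, _, t, φ, hL, ht⟩ := exists_splitting hD
    obtain ⟨θ, hθ⟩ | ⟨r, z, hz⟩ := (ht.map φ).real_or_conj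
    · have hC := ht.map φ
      rw [funext hθ] at hC
      have hθt : IsRootTriple b c d θ :=
        ⟨by exact_mod_cast hC.sum, by exact_mod_cast hC.pair, by exact_mod_cast hC.prod⟩
      have h := log_norm_rootDelta hC
      rw [norm_rootDelta_ofReal] at h
      refine key hL hθt ht (fun h0 => hD ?_) hθ (by linarith) hirr hA
      have := hθt.rootDelta_sq
      rw [h0] at this
      exact_mod_cast this.symm.trans (zero_pow two_ne_zero)
    · have h := log_norm_rootDelta hz
      exact card_le_seven_of_conj hz (by linarith) hD hA
  · push Not at hirr
    obtain ⟨x, y, h, hy⟩ := hirr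
    obtain ⟨r, hr⟩ := exists_int_root h hy
    exact (card_le_four_of_int_root hD hr hA).trans (by norm_num)

/-- The discriminant of a cubic form after a linear substitution. -/
theorem cubicDisc_substitution (a b c d p q u v : ℤ) :
    cubicDisc (a * p ^ 3 + b * p ^ 2 * q + c * p * q ^ 2 + d * q ^ 3)
      (3 * a * p ^ 2 * u + b * (p ^ 2 * v + 2 * p * q * u) + c * (q ^ 2 * u + 2 * p * q * v) +
        3 * d * q ^ 2 * v)
      (3 * a * p * u ^ 2 + b * (q * u ^ 2 + 2 * p * u * v) + c * (p * v ^ 2 + 2 * q * u * v) +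
        3 * d * q * v ^ 2)
      (a * u ^ 3 + b * u ^ 2 * v + c * u * v ^ 2 + d * v ^ 3) =
    (p * v - q * u) ^ 6 * cubicDisc a b c d := by
  simp only [cubicDisc]
  ring

/-- A cubic form of large discriminant represents one at most seven times. -/
theorem exists_card_le_seven : ∃ C : ℤ, 0 < C ∧ ∀ a b c d : ℤ, C ≤ |cubicDisc a b c d| →
    ∀ A : Finset (ℤ × ℤ), (∀ P ∈ A,
      a * P.1 ^ 3 + b * P.1 ^ 2 * P.2 + c * P.1 * P.2 ^ 2 + d * P.2 ^ 3 = 1) → A.card ≤ 7 := by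
  obtain ⟨C, hC, key⟩ := exists_card_le_seven_of_monic
  refine ⟨C, hC, fun a b c d hD A hA => ?_⟩
  obtain rfl | ⟨⟨p, q⟩, hpq⟩ := A.eq_empty_or_nonempty
  · simp
  have h := hA _ hpq
  dsimp only at h
  obtain ⟨u, v, huv⟩ : ∃ u v : ℤ, p * v - q * u = 1 :=
    ⟨-(d * q ^ 2), a * p ^ 2 + b * p * q + c * q ^ 2, by linear_combination h⟩
  have hdisc := cubicDisc_substitution a b c d p q u v
  rw [h, huv, one_pow, one_mul] at hdisc
  rw [← hdisc] at hD
  let f : ℤ × ℤ → ℤ × ℤ := fun P => (v * P.1 - u * P.2, p * P.2 - q * P.1)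
  have hf : Function.Injective f := by
    rintro ⟨x, y⟩ ⟨x', y'⟩ hxy
    obtain ⟨h1, h2⟩ := Prod.ext_iff.1 hxy
    dsimp only [f] at h1 h2
    refine Prod.ext ?_ ?_
    · linear_combination p * h1 + u * h2 - (x - x') * huv
    · linear_combination q * h1 + v * h2 - (y - y') * huv
  rw [← Finset.card_image_of_injective A hf]
  refine key _ _ _ hD _ fun P hP => ?_
  obtain ⟨⟨x, y⟩, hxy, rfl⟩ := Finset.mem_image.1 hP
  have h1 := hA _ hxy
  dsimp only [monicCubic, f] at h1 ⊢
  generalize hX : v * x - u * y = X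
  generalize hY : p * y - q * x = Y
  have hx : x = p * X + u * Y := by linear_combination p * hX + u * hY - x * huv
  have hy : y = q * X + v * Y := by linear_combination q * hX + v * hY - y * huv
  rw [hx, hy] at h1
  linear_combination h1 - X ^ 3 * h

/-- There is a constant `C > 0` such that every cubic Thue equation `f(x,y) = 1` with
`|Disc(f)| ≥ C` has at most 7 integer solutions. -/
theorem cubic_thue_large_disc_at_most_7_solutions :
    ∃ C : ℤ, 0 < C ∧
      ∀ a b c d : ℤ, C ≤ |cubicDisc a b c d| →
        ∃ S : Finset (ℤ × ℤ), S.card ≤ 7 ∧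
          ∀ x y : ℤ,
            a * x ^ 3 + b * x ^ 2 * y + c * x * y ^ 2 + d * y ^ 3 = 1 → (x, y) ∈ S := by
  obtain ⟨C, hC, key⟩ := exists_card_le_seven
  refine ⟨C, hC, fun a b c d hD => ?_⟩
  let Z : Set (ℤ × ℤ) :=
    {P | a * P.1 ^ 3 + b * P.1 ^ 2 * P.2 + c * P.1 * P.2 ^ 2 + d * P.2 ^ 3 = 1}
  have hZ : Z.Finite := by
    by_contra hinf
    obtain ⟨A, hA, hcard⟩ := Set.Infinite.exists_subset_card_eq hinf 8
    have := key a b c d hD A fun P hP => hA hP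
    omega
  exact ⟨hZ.toFinset, key a b c d hD _ fun P hP => hZ.mem_toFinset.1 hP,
    fun x y hxy => hZ.mem_toFinset.2 hxy⟩
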